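/- arXiv:2204.07814 — 2 statements merged into one kernel-verified Lean document; each statement's English description precedes it below -/
import Mathlib

section
/- For γ ∈ (0,1) let T_γ : [0,1] → [0,1] be the Liverani–Saussol–Vaienti map T_γ(x) = x(1 + 2^γ x^γ) for 0 ≤ x ≤ 1/2 and T_γ(x) = 2x − 1 for 1/2 < x ≤ 1. Fix γ_1,…,γ_m ∈ (0,1) with γ_max := max_i γ_i < 1/3 and set T_i := T_{γ_i}. Let Ω := {1,…,m}^ℤ carry the Bernoulli product measure 𝐏 := (p_1,…,p_m)^{⊗ℤ} (all p_i > 0) with left shift σ, write T_ω^n := T_{ω_{n−1}} ∘ ⋯ ∘ T_{ω_0}, let m be Lebesgue measure on [0,1], and for measurable U ⊆ [0,1] let R_U(ω)(x) := inf{ k ≥ 1 : T_ω^k(x) ∈ U }. Then for m-a.e. x0 ∈ [0,1] and 𝐏-a.e. ω ∈ Ω, for all c > 0 and all 0 ≤ s < t: lim_{n→∞} Σ_{j=⌊sn⌋+1}^{⌊tn⌋} m( B_{c/n}(x0) ∩ { x : R_{B_{c/n}(x0)}(σ^j ω)(x) ≤ ⌊ n (log n)^{−1} ⌋ } ) = 0,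 where B_r(x0) := { x ∈ [0,1] : |x − x0| < r }. -/
open MeasureTheory Filter Set Topology

noncomputable section

/-- The two-sided shift space on `m` symbols. -/
abbrev Om (m : ℕ) := ℤ → Fin m

/-- The left shift on the two-sided shift space. -/
def shift {m : ℕ} (ω : Om m) : Om m := fun i => ω (i + 1)

/-- Lebesgue measure on `[0,1]`. -/
def mLeb : Measure ℝ := volume.restrict (Set.Icc 0 1)

/-- The Liverani–Saussol–Vaienti intermittent map with parameter `γ`. -/
def lsv (γ : ℝ) (x : ℝ) : ℝ :=
  if x ≤ 1 / 2 then x * (1 + 2 ^ γ * x ^ γ) else 2 * x - 1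

/-- The random composition `T_ω^n = T_{ω_{n−1}} ∘ ⋯ ∘ T_{ω_0}`. -/
def randComp {m : ℕ} (T : Fin m → ℝ → ℝ) (ω : Om m) : ℕ → ℝ → ℝ
  | 0 => fun x => x
  | n + 1 => fun x => T (ω (n : ℤ)) (randComp T ω n x)

/-- The event `{x : R_U(ω)(x) ≤ N}` that the random orbit hits `U` within `N` steps. -/
def hitWithin {m : ℕ} (T : Fin m → ℝ → ℝ) (ω : Om m) (U : Set ℝ) (N : ℕ) : Set ℝ :=
  {x | ∃ k : ℕ, 1 ≤ k ∧ k ≤ N ∧ randComp T ω k x ∈ U}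

lemma randComp_succ' {m : ℕ} (T : Fin m → ℝ → ℝ) (ω : Om m) (k : ℕ) (x : ℝ) :
    randComp T ω (k + 1) x = randComp T (shift ω) k (T (ω 0) x) := by
  induction k with
  | zero => simp [randComp]
  | succ k ih =>
    change T (ω ((k + 1 : ℕ) : ℤ)) (randComp T ω (k + 1) x) = _
    rw [ih, randComp]
    simp [shift]

/-- Itinerary of a point with respect to the two branches. -/
def itin {m : ℕ} (T : Fin m → ℝ → ℝ) : ℕ → Om m → ℝ → List Bool
  | 0, _, _ => []
  | k + 1, ω, x => decide (x ≤ 1 / 2) :: itin T k (shift ω) (T (ω 0) x)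

lemma lsv_left {g x : ℝ} (hg : 0 < g) (h0 : 0 ≤ x) (h1 : x ≤ 1 / 2) :
    lsv g x = x + 2 ^ g * x ^ (1 + g) := by
  rw [lsv, if_pos h1, Real.rpow_add_of_nonneg h0 (by norm_num) hg.le, Real.rpow_one]
  ring

lemma lsv_left' {g x : ℝ} (h0 : 0 ≤ x) (h1 : x ≤ 1 / 2) :
    lsv g x = x * (1 + (2 * x) ^ g) := by
  rw [lsv, if_pos h1, Real.mul_rpow (by norm_num) h0]

lemma lsv_half {g : ℝ} : lsv g (1 / 2) = 1 := by
  rw [lsv_left' (by norm_num) le_rfl]; norm_num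

lemma lsv_zero {g : ℝ} : lsv g 0 = 0 := by
  rw [lsv_left' (by norm_num) (by norm_num)]; norm_num

lemma lsv_right {g x : ℝ} (h1 : 1 / 2 < x) : lsv g x = 2 * x - 1 := by
  rw [lsv, if_neg (not_le.2 h1)]

lemma lsv_convex {g : ℝ} (hg : 0 < g) : ConvexOn ℝ (Icc 0 (1 / 2)) (lsv g) := by
  have h : ConvexOn ℝ (Icc (0:ℝ) (1 / 2)) (fun x : ℝ => x + 2 ^ g * x ^ (1 + g)) := by
    have h1 : ConvexOn ℝ (Icc (0:ℝ) (1/2)) (fun x : ℝ => x ^ (1 + g)) :=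
      (convexOn_rpow (by linarith)).subset Icc_subset_Ici_self (convex_Icc _ _)
    have h2 := h1.smul (c := (2:ℝ) ^ g) (by positivity)
    have := (convexOn_id (𝕜 := ℝ) (convex_Icc (0:ℝ) (1/2))).add h2
    exact this
  refine h.congr ?_
  intro x hx
  exact (lsv_left hg hx.1 hx.2).symm

/-- expansion estimate on the left branch -/
lemma lsv_expand {g a b : ℝ} (hg : 0 < g) (h0 : 0 ≤ a) (hab : a ≤ b) (hb : b ≤ 1 / 2) :
    (b - a) * (1 + (2 * b) ^ g) ≤ lsv g b - lsv g a := by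
  rw [lsv_left' h0 (hab.trans hb), lsv_left' (h0.trans hab) hb]
  have : (2 * a) ^ g ≤ (2 * b) ^ g := Real.rpow_le_rpow (by linarith) (by linarith) hg.le
  nlinarith

lemma lsv_strictMono {g : ℝ} (hg : 0 < g) : StrictMonoOn (lsv g) (Icc 0 (1 / 2)) := by
  intro a ha b hb hab
  have h := lsv_expand hg ha.1 hab.le hb.2
  have : 0 ≤ (2 * b) ^ g := Real.rpow_nonneg (by linarith [hb.1]) _
  nlinarith

lemma lsv_contOn {g : ℝ} (hg : 0 < g) : ContinuousOn (lsv g) (Icc 0 (1 / 2)) := by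
  have h : Continuous (fun x : ℝ => x + 2 ^ g * x ^ (1 + g)) := by
    have := Real.continuous_rpow_const (q := 1 + g) (by linarith)
    fun_prop
  exact h.continuousOn.congr (fun x hx => lsv_left hg hx.1 hx.2)

lemma lsv_inv {g y : ℝ} (hg : 0 < g) (hy : y ∈ Icc (0:ℝ) 1) :
    ∃ x ∈ Icc (0:ℝ) (1 / 2), lsv g x = y := by
  have := intermediate_value_Icc (by norm_num : (0:ℝ) ≤ 1 / 2) (lsv_contOn hg)
  rw [lsv_zero, lsv_half] at this
  exact this hy

lemma lsv_mem {g x : ℝ} (hg : 0 < g) (hx : x ∈ Ioc (0:ℝ) 1) : lsv g x ∈ Ioc (0:ℝ) 1 := by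
  by_cases h : x ≤ 1 / 2
  · have h0 := lsv_strictMono hg (by norm_num) (⟨hx.1.le, h⟩) hx.1
    have h1 := (lsv_strictMono hg).monotoneOn ⟨hx.1.le, h⟩ (by norm_num) h
    rw [lsv_zero] at h0
    rw [lsv_half] at h1
    exact ⟨h0, h1⟩
  · push Not at h
    rw [lsv_right h]
    constructor <;> linarith [hx.2]

lemma len_step {k : ℕ} {L L' : ℝ} (hL : 0 ≤ L) (h : L * (1 + √L) ≤ L')
    (h' : L' ≤ 36 / ((k:ℝ) + 1) ^ 2) : L ≤ 36 / ((k:ℝ) + 1 + 1) ^ 2 := by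
  by_contra hc
  push Not at hc
  have hk : (0:ℝ) ≤ k := Nat.cast_nonneg k
  have hs : 6 / ((k:ℝ) + 2) ≤ √L := by
    apply Real.le_sqrt_of_sq_le
    rw [div_pow]
    have : ((k:ℝ) + 1 + 1) = k + 2 := by ring
    rw [this] at hc
    norm_num at hc ⊢
    exact hc.le
  have h1 : 36 / ((k:ℝ) + 1 + 1) ^ 2 * (1 + 6 / ((k:ℝ) + 2)) < L * (1 + √L) := by
    apply mul_lt_mul hc (by linarith) (by positivity) hL
  have h2 : 36 / ((k:ℝ) + 1) ^ 2 ≤ 36 / ((k:ℝ) + 1 + 1) ^ 2 * (1 + 6 / ((k:ℝ) + 2)) := by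
    have : 36 / ((k:ℝ) + 1 + 1) ^ 2 * (1 + 6 / ((k:ℝ) + 2)) =
        36 * (k + 8) / ((k:ℝ) + 2) ^ 3 := by
      have : ((k:ℝ) + 1 + 1) = k + 2 := by ring
      rw [this]
      field_simp
      ring
    rw [this, div_le_div_iff₀ (by positivity) (by positivity)]
    nlinarith [mul_nonneg hk hk, mul_nonneg hk (mul_nonneg hk hk)]
  linarith

/-- Structure of the branch of `T_ω^k` through `x`. -/
structure Br {m : ℕ} (T : Fin m → ℝ → ℝ) (k : ℕ) (ω : Om m) (x a b : ℝ) (H : ℝ → ℝ) : Prop where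
  a0 : 0 ≤ a
  b1 : b ≤ 1
  mem : x ∈ Ioc a b
  fib : ∀ y, (y ∈ Ioc (0:ℝ) 1 ∧ itin T k ω y = itin T k ω x) ↔ y ∈ Ioc a b
  conv : ConvexOn ℝ (Icc a b) H
  mono : MonotoneOn H (Icc a b)
  Ha : H a = 0
  eqH : ∀ y ∈ Ioc a b, randComp T ω k y = H y
  len : b - a ≤ 36 / ((k : ℝ) + 1) ^ 2
  apos : a = 0 ∨ x / 2 ≤ a
  left0 : a = 0 → x ≤ randComp T ω k x
  left1 : a = 0 → 0 < k → x + x ^ 2 ≤ randComp T ω k x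

lemma exists_br {m : ℕ} (γ : Fin m → ℝ) (hγ : ∀ i, γ i ∈ Set.Ioo (0 : ℝ) 1)
    (hγmax : ∀ i, γ i < 1 / 3) (k : ℕ) : ∀ (ω : Om m) (x : ℝ), x ∈ Ioc (0:ℝ) 1 →
    ∃ a b H, Br (fun i => lsv (γ i)) k ω x a b H := by
  induction k with
  | zero =>
    intro ω x hx
    refine ⟨0, 1, id, le_rfl, le_rfl, hx, ?_, convexOn_id (convex_Icc _ _), monotone_id.monotoneOn _,
      rfl, ?_, by norm_num, Or.inl rfl, ?_, ?_⟩
    · intro y; simp [itin]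
    · intro y _; simp [randComp]
    · intro _; simp [randComp]
    · intro _ h; simp at h
  | succ k ih =>
    intro ω x hx
    set T : Fin m → ℝ → ℝ := fun i => lsv (γ i) with hT
    set g := γ (ω 0) with hg
    have hg0 : 0 < g := (hγ _).1
    have hT0 : T (ω 0) = lsv g := rfl
    obtain ⟨a', b', H, B⟩ := ih (shift ω) (lsv g x) (lsv_mem hg0 hx)
    have ha'b' : a' < b' := B.mem.1.trans_le B.mem.2
    by_cases hx2 : x ≤ 1 / 2
    · obtain ⟨a, ha, haa⟩ := lsv_inv (y := a') hg0 ⟨B.a0, ha'b'.le.trans B.b1⟩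
      obtain ⟨b, hb, hbb⟩ := lsv_inv (y := b') hg0 ⟨B.a0.trans ha'b'.le, B.b1⟩
      have sm := lsv_strictMono hg0
      have hab : a < b := by
        rw [← haa, ← hbb] at ha'b'
        exact (sm.lt_iff_lt ha hb).1 ha'b'
      have hxI : x ∈ Icc (0:ℝ) (1/2) := ⟨hx.1.le, hx2⟩
      have key : ∀ y ∈ Icc (0:ℝ) (1/2), (lsv g y ∈ Ioc a' b' ↔ y ∈ Ioc a b) := by
        intro y hy
        rw [mem_Ioc, mem_Ioc, ← haa, ← hbb, sm.lt_iff_lt ha hy, sm.le_iff_le hy hb]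
      have sub : Icc a b ⊆ Icc (0:ℝ) (1/2) := Icc_subset_Icc ha.1 hb.2
      have maps : ∀ y ∈ Icc a b, lsv g y ∈ Icc a' b' := by
        intro y hy
        rw [← haa, ← hbb]
        exact ⟨sm.monotoneOn ha (sub hy) hy.1, sm.monotoneOn (sub hy) hb hy.2⟩
      have a0iff : a = 0 → a' = 0 := by
        rintro rfl; rw [← haa, lsv_zero]
      refine ⟨a, b, fun y => H (lsv g y), ha.1, hb.2.trans (by norm_num), (key x hxI).1 B.mem,
        ?_, ?_, ?_, ?_, ?_, ?_, ?_, ?_, ?_⟩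
      · intro y
        constructor
        · rintro ⟨hy, h⟩
          simp only [itin, hT0, List.cons.injEq, decide_eq_decide] at h
          have hy2 : y ≤ 1 / 2 := h.1.2 hx2
          exact (key y ⟨hy.1.le, hy2⟩).1 ((B.fib _).1 ⟨lsv_mem hg0 hy, h.2⟩)
        · intro hy
          have hyI := sub (Ioc_subset_Icc_self hy)
          refine ⟨⟨ha.1.trans_lt hy.1, hyI.2.trans (by norm_num)⟩, ?_⟩
          simp only [itin, hT0, List.cons.injEq, decide_eq_decide]
          exact ⟨⟨fun _ => hx2, fun _ => hyI.2⟩, ((B.fib _).2 ((key y hyI).2 hy)).2⟩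
      · refine ⟨convex_Icc _ _, ?_⟩
        intro u hu v hv s t hs ht hst
        have h1 := (lsv_convex hg0).2 (sub hu) (sub hv) hs ht hst
        have h2 := B.conv.2 (maps u hu) (maps v hv) hs ht hst
        refine le_trans ?_ h2
        refine B.mono (maps _ (convex_Icc _ _ hu hv hs ht hst))
          (convex_Icc _ _ (maps u hu) (maps v hv) hs ht hst) h1
      · intro u hu v hv huv
        exact B.mono (maps u hu) (maps v hv) (sm.monotoneOn (sub hu) (sub hv) huv)
      · simp only [haa, B.Ha]
      · intro y hy
        rw [randComp_succ']
        exact B.eqH _ ((key y (sub (Ioc_subset_Icc_self hy))).2 hy)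
      · have h1 := lsv_expand hg0 ha.1 hab.le hb.2
        rw [haa, hbb] at h1
        have h2 : √(b - a) ≤ (2 * b) ^ g := by
          have hb0 : 0 < b := ha.1.trans_lt hab
          calc √(b - a) ≤ √(2 * b) := Real.sqrt_le_sqrt (by linarith [ha.1])
            _ = (2 * b) ^ (1 / 2 : ℝ) := Real.sqrt_eq_rpow _
            _ ≤ (2 * b) ^ g := by
              apply Real.rpow_le_rpow_of_exponent_ge (by linarith) (by linarith [hb.2])
              linarith [hγmax (ω 0)]
        push_cast
        refine len_step (L' := b' - a') (by linarith) ?_ B.len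
        refine le_trans ?_ h1
        exact mul_le_mul_of_nonneg_left (by linarith) (by linarith)
      · rcases B.apos with h | h
        · left
          rw [h, ← lsv_zero (g := g)] at haa
          exact sm.injOn ha (by norm_num) haa
        · right
          rw [← haa, lsv_left' hx.1.le hx2, lsv_left' ha.1 ha.2] at h
          have hax : a < x := ((key x hxI).1 B.mem).1
          have h3 : (2 * a) ^ g ≤ (2 * x) ^ g :=
            Real.rpow_le_rpow (by linarith [ha.1]) (by linarith) hg0.le
          have h4 : 0 ≤ (2 * x) ^ g := Real.rpow_nonneg (by linarith [hx.1]) _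
          have h5 : a * (1 + (2 * a) ^ g) ≤ a * (1 + (2 * x) ^ g) :=
            mul_le_mul_of_nonneg_left (by linarith) ha.1
          have h6 : (x / 2) * (1 + (2 * x) ^ g) ≤ a * (1 + (2 * x) ^ g) := by linarith
          exact le_of_mul_le_mul_right h6 (by linarith)
      · intro h
        rw [randComp_succ']
        refine le_trans ?_ (B.left0 (a0iff h))
        rw [lsv_left' hx.1.le hx2]
        have h4 : 0 ≤ (2 * x) ^ g := Real.rpow_nonneg (by linarith [hx.1]) _
        nlinarith [hx.1]
      · intro h _
        rw [randComp_succ']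
        refine le_trans ?_ (B.left0 (a0iff h))
        rw [lsv_left' hx.1.le hx2]
        have h4 : (2 * x) ^ (1:ℝ) ≤ (2 * x) ^ g :=
          Real.rpow_le_rpow_of_exponent_ge (by linarith [hx.1]) (by linarith) (hγ _).2.le
        rw [Real.rpow_one] at h4
        nlinarith [hx.1]
    · push Not at hx2
      have key : ∀ y, 1 / 2 < y → (lsv g y ∈ Ioc a' b' ↔ y ∈ Ioc ((a' + 1) / 2) ((b' + 1) / 2)) := by
        intro y hy
        rw [mem_Ioc, mem_Ioc, lsv_right hy]
        constructor <;> rintro ⟨h1, h2⟩ <;> constructor <;> linarith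
      have gt : ∀ y ∈ Ioc ((a' + 1) / 2) ((b' + 1) / 2), 1 / 2 < y := by
        intro y hy
        linarith [hy.1, B.a0]
      have maps : ∀ y ∈ Icc ((a' + 1) / 2) ((b' + 1) / 2), 2 * y - 1 ∈ Icc a' b' := by
        rintro y ⟨h1, h2⟩
        constructor <;> linarith
      refine ⟨(a' + 1) / 2, (b' + 1) / 2, fun y => H (2 * y - 1), by linarith [B.a0],
        by linarith [B.b1], (key x hx2).1 B.mem, ?_, ?_, ?_, ?_, ?_, ?_, ?_, ?_, ?_⟩
      · intro y
        constructor
        · rintro ⟨hy, h⟩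
          simp only [itin, hT0, List.cons.injEq, decide_eq_decide] at h
          have hy2 : 1 / 2 < y := by
            by_contra hc
            exact absurd (h.1.1 (not_lt.1 hc)) (not_le.2 hx2)
          exact (key y hy2).1 ((B.fib _).1 ⟨lsv_mem hg0 hy, h.2⟩)
        · intro hy
          have hyI := gt y hy
          refine ⟨⟨by linarith, by linarith [hy.2, B.b1]⟩, ?_⟩
          simp only [itin, hT0, List.cons.injEq, decide_eq_decide]
          exact ⟨⟨fun h => absurd h (not_le.2 hyI), fun h => absurd h (not_le.2 hx2)⟩,
            ((B.fib _).2 ((key y hyI).2 hy)).2⟩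
      · refine ⟨convex_Icc _ _, ?_⟩
        intro u hu v hv s t hs ht hst
        have h2 := B.conv.2 (maps u hu) (maps v hv) hs ht hst
        refine le_trans (le_of_eq ?_) h2
        simp only [smul_eq_mul]
        congr 1
        linear_combination hst
      · intro u hu v hv huv
        exact B.mono (maps u hu) (maps v hv) (by linarith)
      · have : 2 * ((a' + 1) / 2) - 1 = a' := by ring
        simp only [this, B.Ha]
      · intro y hy
        rw [randComp_succ', hT0, ← lsv_right (g := g) (gt y hy)]
        exact B.eqH _ ((key y (gt y hy)).2 hy)
      · push_cast
        refine len_step (L' := b' - a') (by linarith) ?_ B.len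
        have : √((b' + 1) / 2 - (a' + 1) / 2) ≤ 1 := by
          rw [Real.sqrt_le_one]
          linarith [B.a0, B.b1]
        nlinarith
      · right
        linarith [hx.2, B.a0]
      · intro h
        linarith [B.a0]
      · intro h
        linarith [B.a0]

lemma sum_fib {m : ℕ} (γ : Fin m → ℝ) (hγ : ∀ i, γ i ∈ Set.Ioo (0 : ℝ) 1)
    (hγmax : ∀ i, γ i < 1 / 3) (k : ℕ) (ω : Om m) (S U : Set ℝ) (ε : ENNReal)
    (hS : S ⊆ Ioc 0 1)
    (h : ∀ x ∈ S, ∀ a b H, Br (fun i => lsv (γ i)) k ω x a b H →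
      volume (S ∩ Ioc a b) ≤ ε * volume (Ioc a b ∩ U)) : volume S ≤ ε * volume U := by
  set T : Fin m → ℝ → ℝ := fun i => lsv (γ i) with hT
  set J : List Bool → Set ℝ := fun w => {y | y ∈ Ioc (0:ℝ) 1 ∧ itin T k ω y = w} with hJ
  have hJx : ∀ x a b H, Br T k ω x a b H → J (itin T k ω x) = Ioc a b := by
    intro x a b H B
    ext y
    exact B.fib y
  have hJm : ∀ w, MeasurableSet (J w) := by
    intro w
    by_cases hw : ∃ x, x ∈ J w
    · obtain ⟨x, hx, rfl⟩ := hw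
      obtain ⟨a, b, H, B⟩ := exists_br γ hγ hγmax k ω x hx
      rw [hJx x a b H B]
      exact measurableSet_Ioc
    · have : J w = ∅ := by
        ext y
        simp only [mem_empty_iff_false, iff_false]
        exact fun hy => hw ⟨y, hy⟩
      rw [this]
      exact MeasurableSet.empty
  have hdis : Pairwise (fun i j => Disjoint (J i) (J j)) := by
    intro i j hij
    rw [Set.disjoint_left]
    rintro y ⟨_, h1⟩ ⟨_, h2⟩
    exact hij (h1.symm.trans h2)
  calc volume S ≤ volume (⋃ w, S ∩ J w) := by
        apply measure_mono
        intro y hy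
        exact mem_iUnion.2 ⟨itin T k ω y, hy, hS hy, rfl⟩
    _ ≤ ∑' w, volume (S ∩ J w) := measure_iUnion_le _
    _ ≤ ∑' w, ε * (volume.restrict U) (J w) := by
        refine ENNReal.tsum_le_tsum fun w => ?_
        by_cases hw : ∃ x, x ∈ S ∩ J w
        · obtain ⟨x, hxS, hx, rfl⟩ := hw
          obtain ⟨a, b, H, B⟩ := exists_br γ hγ hγmax k ω x hx
          rw [Measure.restrict_apply (hJm _), hJx x a b H B]
          exact h x hxS a b H B
        · have : S ∩ J w = ∅ := by
            ext y
            simp only [mem_empty_iff_false, iff_false]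
            exact fun hy => hw ⟨y, hy⟩
          rw [this]
          simp
    _ = ε * (volume.restrict U) (⋃ w, J w) := by
        rw [ENNReal.tsum_mul_left, measure_iUnion hdis hJm]
    _ ≤ ε * volume U := by
        exact mul_le_mul_right ((measure_mono (μ := volume.restrict U) (subset_univ _)).trans_eq
          (Measure.restrict_apply_univ U)) _

lemma vol_le_of_diff {S : Set ℝ} {d : ℝ} (h : ∀ x ∈ S, ∀ y ∈ S, x < y → y - x ≤ d)
    (hd : 0 ≤ d) : volume S ≤ ENNReal.ofReal d := by
  refine (Real.volume_le_diam S).trans ?_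
  refine Metric.ediam_le ?_
  intro x hx y hy
  rw [edist_dist, Real.dist_eq]
  apply ENNReal.ofReal_le_ofReal
  rcases lt_trichotomy x y with hxy | hxy | hxy
  · rw [abs_of_neg (by linarith)]; linarith [h x hx y hy hxy]
  · subst hxy; simpa using hd
  · rw [abs_of_pos (by linarith)]; linarith [h y hy x hx hxy]

/-- long return times -/
lemma long_bound {m : ℕ} (γ : Fin m → ℝ) (hγ : ∀ i, γ i ∈ Set.Ioo (0 : ℝ) 1)
    (hγmax : ∀ i, γ i < 1 / 3) (k : ℕ) (ω : Om m) (x0 r : ℝ) (hx0 : 0 < x0) (hr : 0 < r)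
    (hr2 : r ≤ x0 / 2) (hk : 36 / ((k:ℝ) + 1) ^ 2 ≤ r) :
    volume {x | x ∈ Ioc (0:ℝ) 1 ∧ x ∈ Metric.ball x0 r ∧
      randComp (fun i => lsv (γ i)) ω k x ∈ Metric.ball x0 r} ≤
      ENNReal.ofReal (16 * r ^ 2 / x0) := by
  set S := {x | x ∈ Ioc (0:ℝ) 1 ∧ x ∈ Metric.ball x0 r ∧
      randComp (fun i => lsv (γ i)) ω k x ∈ Metric.ball x0 r} with hS
  have main := sum_fib γ hγ hγmax k ω S (Metric.ball x0 (2 * r)) (ENNReal.ofReal (4 * r / x0))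
    (fun x hx => hx.1) ?_
  · refine main.trans ?_
    rw [Real.volume_ball, ← ENNReal.ofReal_mul (by positivity)]
    apply ENNReal.ofReal_le_ofReal
    apply le_of_eq
    field_simp
    ring
  · intro x hx a b H B
    have hsub : Ioc a b ∩ Metric.ball x0 (2 * r) = Ioc a b := by
      rw [inter_eq_left]
      intro y hy
      have h1 := hx.2.1
      have h2 := B.mem
      have h3 := B.len
      rw [Metric.mem_ball, Real.dist_eq, abs_lt] at h1 ⊢
      constructor <;> linarith [hy.1, hy.2, h2.1, h2.2]
    have hab : a < b := B.mem.1.trans_le B.mem.2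
    rw [hsub, Real.volume_Ioc, ← ENNReal.ofReal_mul (by positivity)]
    refine vol_le_of_diff ?_ (mul_nonneg (by positivity) (by linarith))
    rintro y ⟨hy, hyI⟩ z ⟨hz, hzI⟩ hyz
    have hHy := hy.2.2
    have hHz := hz.2.2
    rw [B.eqH y hyI, Metric.mem_ball, Real.dist_eq, abs_lt] at hHy
    rw [B.eqH z hzI, Metric.mem_ball, Real.dist_eq, abs_lt] at hHz
    have hs := B.conv.slope_mono_adjacent (x := a) (y := y) (z := z) ⟨le_rfl, hab.le⟩
      (Ioc_subset_Icc_self hzI) hyI.1 hyz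
    have hya : 0 < y - a := by linarith [hyI.1]
    have hzy : 0 < z - y := by linarith
    rw [B.Ha, sub_zero, div_le_div_iff₀ hya hzy] at hs
    have h1 : x0 / 2 * (z - y) ≤ H y * (z - y) :=
      mul_le_mul_of_nonneg_right (by linarith) hzy.le
    have h2 : (H z - H y) * (y - a) ≤ (2 * r) * (b - a) := by
      have hyb : y - a ≤ b - a := by linarith [hyI.2]
      have : (H z - H y) * (y - a) ≤ (2 * r) * (y - a) :=
        mul_le_mul_of_nonneg_right (by linarith) hya.le
      nlinarith
    rw [div_mul_eq_mul_div, le_div_iff₀ hx0]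
    linarith

/-- short return times -/
lemma short_bound {m : ℕ} (γ : Fin m → ℝ) (hγ : ∀ i, γ i ∈ Set.Ioo (0 : ℝ) 1)
    (hγmax : ∀ i, γ i < 1 / 3) (k : ℕ) (hk : 0 < k) (ω : Om m) (δ r : ℝ) (hδ : 0 < δ)
    (hr : 0 < r) :
    volume {x | x ∈ Icc δ 1 ∧ |randComp (fun i => lsv (γ i)) ω k x - x| < 2 * r} ≤
      ENNReal.ofReal ((16 / δ + 2 / δ ^ 2) * r) := by
  set S := {x | x ∈ Icc δ 1 ∧ |randComp (fun i => lsv (γ i)) ω k x - x| < 2 * r} with hS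
  have hS01 : S ⊆ Ioc 0 1 := fun x hx => ⟨hδ.trans_le hx.1.1, hx.1.2⟩
  have p1 : 0 < 16 / δ * r := by positivity
  have p2 : 0 < 2 / δ ^ 2 * r := by positivity
  by_cases hbig : δ < 8 * r ∨ δ ^ 2 < 2 * r
  · refine (measure_mono hS01).trans ?_
    rw [Real.volume_Ioc]
    apply ENNReal.ofReal_le_ofReal
    rcases hbig with h | h
    · have : 1 ≤ 16 / δ * r := by
        rw [div_mul_eq_mul_div, le_div_iff₀ hδ]; linarith
      linarith
    · have : 1 ≤ 2 / δ ^ 2 * r := by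
        rw [div_mul_eq_mul_div, le_div_iff₀ (by positivity)]; linarith
      linarith
  · push Not at hbig
    have main := sum_fib γ hγ hγmax k ω S (Ioc 0 1) (ENNReal.ofReal (16 * r / δ)) hS01 ?_
    · refine main.trans ?_
      rw [Real.volume_Ioc, ← ENNReal.ofReal_mul (by positivity)]
      apply ENNReal.ofReal_le_ofReal
      have : 16 * r / δ * (1 - 0) = 16 / δ * r := by ring
      linarith
    · intro x hx a b H B
      have hsub : Ioc a b ∩ Ioc 0 1 = Ioc a b := by
        rw [inter_eq_left]
        exact Ioc_subset_Ioc B.a0 B.b1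
      have hab : a < b := B.mem.1.trans_le B.mem.2
      rw [hsub, Real.volume_Ioc, ← ENNReal.ofReal_mul (by positivity)]
      have ha : δ / 2 ≤ a := by
        rcases B.apos with h | h
        · have h1 := B.left1 h hk
          have h2 := (abs_lt.1 hx.2).2
          have h3 : δ ^ 2 ≤ x ^ 2 := pow_le_pow_left₀ hδ.le hx.1.1 2
          linarith [hbig.2]
        · linarith [hx.1.1]
      refine vol_le_of_diff ?_ (mul_nonneg (by positivity) (by linarith))
      rintro y ⟨hy, hyI⟩ z ⟨hz, hzI⟩ hyz
      have hHy := hy.2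
      have hHz := hz.2
      rw [B.eqH y hyI, abs_lt] at hHy
      rw [B.eqH z hzI, abs_lt] at hHz
      have hs := B.conv.slope_mono_adjacent (x := a) (y := y) (z := z) ⟨le_rfl, hab.le⟩
        (Ioc_subset_Icc_self hzI) hyI.1 hyz
      have hya : 0 < y - a := by linarith [hyI.1]
      have hzy : 0 < z - y := by linarith
      rw [B.Ha, sub_zero, div_le_div_iff₀ hya hzy] at hs
      have h0 : (H y - (y - a)) * (z - y) ≤ (H z - H y - (z - y)) * (y - a) := by nlinarith
      have h1 : δ / 4 * (z - y) ≤ (H y - (y - a)) * (z - y) :=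
        mul_le_mul_of_nonneg_right (by linarith [hbig.1]) hzy.le
      have h2 : (H z - H y - (z - y)) * (y - a) ≤ (4 * r) * (b - a) := by
        have hyb : y - a ≤ b - a := by linarith [hyI.2]
        have : (H z - H y - (z - y)) * (y - a) ≤ (4 * r) * (y - a) :=
          mul_le_mul_of_nonneg_right (by linarith) hya.le
        nlinarith
      rw [div_mul_eq_mul_div, le_div_iff₀ hδ]
      linarith

/-- points that come back close to themselves within `K` steps -/
def recSet {m : ℕ} (T : Fin m → ℝ → ℝ) (δ r : ℝ) (K : ℕ) (ω : Om m) : Set ℝ :=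
  {x | x ∈ Icc δ 1 ∧ ∃ k ∈ Finset.Icc 1 K, |randComp T ω k x - x| < 2 * r}

lemma recSet_bound {m : ℕ} (γ : Fin m → ℝ) (hγ : ∀ i, γ i ∈ Set.Ioo (0 : ℝ) 1)
    (hγmax : ∀ i, γ i < 1 / 3) (K : ℕ) (ω : Om m) (δ r : ℝ) (hδ : 0 < δ)
    (hr : 0 < r) :
    volume (recSet (fun i => lsv (γ i)) δ r K ω) ≤
      ENNReal.ofReal (K * ((16 / δ + 2 / δ ^ 2) * r)) := by
  have : recSet (fun i => lsv (γ i)) δ r K ω = ⋃ k ∈ Finset.Icc 1 K,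
      {x | x ∈ Icc δ 1 ∧ |randComp (fun i => lsv (γ i)) ω k x - x| < 2 * r} := by
    ext x
    simp only [recSet, mem_ofPred_eq, mem_iUnion, exists_prop]
    constructor
    · rintro ⟨h, k, hk, h'⟩; exact ⟨k, hk, h, h'⟩
    · rintro ⟨k, hk, h, h'⟩; exact ⟨h, k, hk, h'⟩
  rw [this]
  refine (measure_biUnion_finset_le _ _).trans ?_
  refine (Finset.sum_le_card_nsmul _ _ _ (fun k hk => short_bound γ hγ hγmax k
    (by have := (Finset.mem_Icc.1 hk).1; omega) ω δ r hδ hr)).trans ?_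
  rw [Nat.card_Icc, nsmul_eq_mul, ENNReal.ofReal_mul (Nat.cast_nonneg K),
    ENNReal.ofReal_natCast]
  simp

lemma measurable_lsv (g : ℝ) : Measurable (lsv g) := by
  unfold lsv
  refine Measurable.ite measurableSet_Iic ?_ ?_ <;> fun_prop

lemma measurable_shift {m : ℕ} : Measurable (shift : Om m → Om m) := by
  unfold shift
  exact measurable_pi_lambda _ (fun i => measurable_pi_apply _)

lemma measurable_randComp {m : ℕ} (T : Fin m → ℝ → ℝ) (hT : ∀ i, Measurable (T i)) (k : ℕ) :
    Measurable (fun z : Om m × ℝ => randComp T z.1 k z.2) := by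
  induction k with
  | zero => exact measurable_snd
  | succ k ih =>
    have h1 : Measurable (fun z : Fin m × ℝ => T z.1 z.2) :=
      measurable_from_prod_countable_right hT
    have h2 : Measurable (fun z : Om m × ℝ => z.1 (k : ℤ)) :=
      (measurable_pi_apply _).comp measurable_fst
    exact h1.comp (h2.prodMk ih)

lemma measurableSet_rec {m : ℕ} (T : Fin m → ℝ → ℝ) (hT : ∀ i, Measurable (T i)) (δ r : ℝ)
    (K : ℕ) : MeasurableSet {z : Om m × ℝ | z.2 ∈ recSet T δ r K z.1} := by
  have : {z : Om m × ℝ | z.2 ∈ recSet T δ r K z.1} = (Prod.snd ⁻¹' Icc δ 1) ∩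
      ⋃ k ∈ Finset.Icc 1 K, {z : Om m × ℝ | |randComp T z.1 k z.2 - z.2| < 2 * r} := by
    ext z
    simp [recSet]
  rw [this]
  refine (measurable_snd measurableSet_Icc).inter ?_
  refine Finset.measurableSet_biUnion _ fun k _ => ?_
  have h1 : Measurable (fun z : Om m × ℝ => |randComp T z.1 k z.2 - z.2|) := by
    have := (measurable_randComp T hT k).sub measurable_snd
    exact continuous_abs.measurable.comp this
  exact measurableSet_lt h1 measurable_const

/-- the integrated quantity -/
lemma measurable_term {m : ℕ} (T : Fin m → ℝ → ℝ) (hT : ∀ i, Measurable (T i)) (δ r : ℝ)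
    (K j : ℕ) : Measurable (fun z : ℝ × Om m =>
      volume (Metric.ball z.1 r ∩ recSet T δ r K (shift^[j] z.2))) := by
  have hs : MeasurableSet {q : (ℝ × Om m) × ℝ | q.2 ∈ Metric.ball q.1.1 r ∩
      recSet T δ r K (shift^[j] q.1.2)} := by
    have h1 : MeasurableSet {q : (ℝ × Om m) × ℝ | dist q.2 q.1.1 < r} :=
      measurableSet_lt (by fun_prop) measurable_const
    have h2 : Measurable (fun q : (ℝ × Om m) × ℝ => ((shift^[j] q.1.2, q.2) : Om m × ℝ)) :=
      (((measurable_shift.iterate j).comp (measurable_snd.comp measurable_fst))).prodMk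
        measurable_snd
    exact h1.inter (h2 (measurableSet_rec T hT δ r K))
  exact measurable_measure_prodMk_left hs

lemma integral_ball (E : Set ℝ) (hE : MeasurableSet E) (r : ℝ) :
    ∫⁻ x0, volume (Metric.ball x0 r ∩ E) ∂mLeb ≤ ENNReal.ofReal (2 * r) * volume E := by
  have hs : MeasurableSet {q : ℝ × ℝ | q.2 ∈ Metric.ball q.1 r ∩ E} :=
    (measurableSet_lt (f := fun q : ℝ × ℝ => dist q.2 q.1) (by fun_prop) measurable_const).inter
      (measurable_snd hE)
  calc ∫⁻ x0, volume (Metric.ball x0 r ∩ E) ∂mLeb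
      ≤ ∫⁻ x0, volume (Metric.ball x0 r ∩ E) := lintegral_mono' Measure.restrict_le_self le_rfl
    _ = (volume.prod volume) {q : ℝ × ℝ | q.2 ∈ Metric.ball q.1 r ∩ E} :=
        (Measure.prod_apply hs).symm
    _ = ∫⁻ y, volume {x | y ∈ Metric.ball x r ∩ E} := Measure.prod_apply_symm hs
    _ = ∫⁻ y, E.indicator (fun _ => ENNReal.ofReal (2 * r)) y := by
        refine lintegral_congr fun y => ?_
        by_cases hy : y ∈ E
        · rw [indicator_of_mem hy, ← Real.volume_ball y r]
          congr 1
          ext x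
          simp [hy, dist_comm]
        · rw [indicator_of_notMem hy]
          simp [hy]
    _ = _ := by rw [lintegral_indicator hE, setLIntegral_const]

instance : IsFiniteMeasure mLeb := by unfold mLeb; infer_instance

/-- dyadic cut-off between short and long return times -/
def cutoff (i : ℕ) : ℕ := ⌊(2:ℝ) ^ (i + 3) / (i:ℝ) ^ 2⌋₊

/-- dyadic sums of short-return measures -/
def Phi {m : ℕ} (T : Fin m → ℝ → ℝ) (q c t i : ℕ) (z : ℝ × Om m) : ENNReal :=
  ∑ j ∈ Finset.range (t * 2 ^ (i + 1) + 1),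
    volume (Metric.ball z.1 ((c:ℝ) / 2 ^ i) ∩
      recSet T (1 / (q:ℝ)) ((c:ℝ) / 2 ^ i) (cutoff i) (shift^[j] z.2))

lemma Phi_integral {m : ℕ} (γ : Fin m → ℝ) (hγ : ∀ i, γ i ∈ Set.Ioo (0 : ℝ) 1)
    (hγmax : ∀ i, γ i < 1 / 3) (P : Measure (Om m)) [IsProbabilityMeasure P]
    (q c t i : ℕ) (hq : 0 < q) (hc : 0 < c) (ht : 0 < t) :
    ∫⁻ z, Phi (fun i => lsv (γ i)) q c t i z ∂(mLeb.prod P) ≤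
      ENNReal.ofReal (64 * t * c ^ 2 * (16 / (1 / (q:ℝ)) + 2 / (1 / (q:ℝ)) ^ 2) *
        (1 / (i:ℝ) ^ 2)) := by
  set T : Fin m → ℝ → ℝ := fun i => lsv (γ i) with hT
  have hTm : ∀ i, Measurable (T i) := fun i => measurable_lsv _
  set r : ℝ := (c:ℝ) / 2 ^ i with hr
  set δ : ℝ := 1 / (q:ℝ) with hδ
  set C : ℝ := 16 / δ + 2 / δ ^ 2 with hC
  have hc' : (0:ℝ) < c := by exact_mod_cast hc
  have hq' : (0:ℝ) < q := by exact_mod_cast hq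
  have ht' : (1:ℝ) ≤ t := by exact_mod_cast ht
  have hr0 : 0 < r := by positivity
  have hδ0 : 0 < δ := by positivity
  have hC0 : 0 < C := by positivity
  have hterm : ∀ j : ℕ, ∫⁻ z : ℝ × Om m, volume (Metric.ball z.1 r ∩
      recSet T δ r (cutoff i) (shift^[j] z.2)) ∂(mLeb.prod P) ≤
      ENNReal.ofReal (2 * r * (cutoff i * (C * r))) := by
    intro j
    rw [lintegral_prod_symm _ (measurable_term T hTm δ r (cutoff i) j).aemeasurable]
    calc _ ≤ ∫⁻ _ : Om m, ENNReal.ofReal (2 * r * (cutoff i * (C * r))) ∂P := by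
          refine lintegral_mono fun ω => ?_
          have hE : MeasurableSet (recSet T δ r (cutoff i) (shift^[j] ω)) :=
            (measurable_prodMk_left (x := shift^[j] ω)) (measurableSet_rec T hTm δ r (cutoff i))
          refine (integral_ball _ hE r).trans ?_
          rw [ENNReal.ofReal_mul (p := 2 * r) (by positivity)]
          exact mul_le_mul_right (recSet_bound γ hγ hγmax _ _ δ r hδ0 hr0) _
      _ = _ := by simp
  unfold Phi
  rw [lintegral_finsetSum _ (fun j _ => measurable_term T hTm δ r (cutoff i) j)]
  refine (Finset.sum_le_card_nsmul _ _ _ (fun j _ => hterm j)).trans ?_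
  rw [Finset.card_range, nsmul_eq_mul, ← ENNReal.ofReal_natCast,
    ← ENNReal.ofReal_mul (Nat.cast_nonneg _)]
  apply ENNReal.ofReal_le_ofReal
  have hK : (cutoff i : ℝ) ≤ (2:ℝ) ^ (i + 3) / (i:ℝ) ^ 2 := Nat.floor_le (by positivity)
  have hN : ((t * 2 ^ (i + 1) + 1 : ℕ) : ℝ) ≤ t * 2 ^ (i + 2) := by
    push_cast
    have h1 : (1:ℝ) ≤ 2 ^ (i + 1) := one_le_pow₀ (by norm_num)
    have h2 : (1:ℝ) ≤ t * 2 ^ (i + 1) := by nlinarith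
    have : (t:ℝ) * 2 ^ (i + 2) = t * 2 ^ (i + 1) + t * 2 ^ (i + 1) := by ring
    linarith
  calc ((t * 2 ^ (i + 1) + 1 : ℕ) : ℝ) * (2 * r * (cutoff i * (C * r)))
      ≤ (t * 2 ^ (i + 2)) * (2 * r * ((2:ℝ) ^ (i + 3) / (i:ℝ) ^ 2 * (C * r))) := by
        gcongr
    _ = _ := by
        rw [hr]
        rcases Nat.eq_zero_or_pos i with h | h
        · subst h; simp
        · have : (0:ℝ) < i := by exact_mod_cast h
          field_simp
          ring

lemma Phi_ae {m : ℕ} (γ : Fin m → ℝ) (hγ : ∀ i, γ i ∈ Set.Ioo (0 : ℝ) 1)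
    (hγmax : ∀ i, γ i < 1 / 3) (P : Measure (Om m)) [IsProbabilityMeasure P]
    (q c t : ℕ) (hq : 0 < q) (hc : 0 < c) (ht : 0 < t) :
    ∀ᵐ z ∂(mLeb.prod P), Tendsto (fun i => Phi (fun i => lsv (γ i)) q c t i z) atTop (𝓝 0) := by
  have hm : ∀ i, Measurable (fun z => Phi (m := m) (fun i => lsv (γ i)) q c t i z) := fun i =>
    Finset.measurable_sum _ (fun j _ => measurable_term _ (fun i => measurable_lsv _) _ _ _ j)
  have hfin : ∫⁻ z, ∑' i, Phi (fun i => lsv (γ i)) q c t i z ∂(mLeb.prod P) ≠ ⊤ := by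
    rw [lintegral_tsum (fun i => (hm i).aemeasurable)]
    refine ne_top_of_le_ne_top ?_ (ENNReal.tsum_le_tsum
      (fun i => Phi_integral γ hγ hγmax P q c t i hq hc ht))
    refine Summable.tsum_ofReal_ne_top ?_
    exact (Real.summable_one_div_nat_pow.2 (by norm_num)).mul_left _
  have := ae_lt_top (Measurable.tsum hm) hfin
  filter_upwards [this] with z hz
  exact ENNReal.tendsto_atTop_zero_of_tsum_ne_top hz.ne

lemma tendsto_natLog : Tendsto (fun n : ℕ => Nat.log 2 n) atTop atTop := by
  refine tendsto_atTop.2 fun b => ?_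
  filter_upwards [eventually_ge_atTop (2 ^ b)] with n hn
  exact Nat.le_log_of_pow_le (by norm_num) hn

lemma cutoff_eventually (c : ℝ) (hc : 0 < c) :
    ∀ᶠ n : ℕ in atTop, ∀ k, cutoff (Nat.log 2 n) < k → 36 / ((k:ℝ) + 1) ^ 2 ≤ c / n := by
  have hlog : Tendsto (fun n : ℕ => Nat.log 2 n) atTop atTop :=
    tendsto_natLog
  have h1 : ∀ᶠ i : ℕ in atTop, (i:ℝ) ^ 4 / 2 ^ i < c / 2 :=
    (tendsto_pow_const_div_const_pow_of_one_lt 4 (by norm_num : (1:ℝ) < 2)).eventually_lt_const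
      (half_pos hc)
  filter_upwards [hlog.eventually h1, hlog.eventually (eventually_gt_atTop 0),
    eventually_gt_atTop 0] with n hn hi hn0 k hk
  set i := Nat.log 2 n with hidef
  have hi0 : (0:ℝ) < i := by exact_mod_cast hi
  have hn1 : (n:ℝ) ≤ 2 ^ (i + 1) := by
    exact_mod_cast (Nat.lt_pow_succ_log_self (by norm_num) n).le
  have hn0' : (0:ℝ) < n := by exact_mod_cast hn0
  have hk1 : (2:ℝ) ^ (i + 3) / (i:ℝ) ^ 2 ≤ k + 1 := by
    have h2 := Nat.lt_floor_add_one ((2:ℝ) ^ (i + 3) / (i:ℝ) ^ 2)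
    have h3 : ((cutoff i : ℕ) : ℝ) ≤ k := by exact_mod_cast hk.le
    unfold cutoff at h3
    linarith
  have hsq : ((2:ℝ) ^ (i + 3) / (i:ℝ) ^ 2) ^ 2 ≤ ((k:ℝ) + 1) ^ 2 :=
    pow_le_pow_left₀ (by positivity) hk1 2
  calc 36 / ((k:ℝ) + 1) ^ 2 ≤ 36 / ((2:ℝ) ^ (i + 3) / (i:ℝ) ^ 2) ^ 2 := by gcongr
    _ = (36 / 32) * ((i:ℝ) ^ 4 / 2 ^ i) / (2 * 2 ^ i) := by
        field_simp
        ring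
    _ ≤ c / (2 * 2 ^ i) := by
        gcongr
        have : (0:ℝ) ≤ (i:ℝ) ^ 4 / 2 ^ i := by positivity
        linarith
    _ ≤ c / n := by
        gcongr
        rw [pow_succ] at hn1
        linarith

theorem stmt10 (m : ℕ) (hm : 1 ≤ m)
    (γ : Fin m → ℝ) (hγ : ∀ i, γ i ∈ Set.Ioo (0 : ℝ) 1) (hγmax : ∀ i, γ i < 1 / 3)
    (p : Fin m → ℝ) (hp : ∀ i, 0 < p i) (hp1 : ∑ i, p i = 1)
    (P : Measure (Om m)) (hPprob : IsProbabilityMeasure P)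
    -- `P` is the Bernoulli product measure `(p_1, …, p_m)^{⊗ℤ}`
    (hP : ∀ (s : Finset ℤ) (f : ℤ → Fin m),
      P {ω | ∀ i ∈ s, ω i = f i} = ENNReal.ofReal (∏ i ∈ s, p (f i))) :
    ∀ᵐ x0 ∂mLeb, ∀ᵐ ω ∂P, ∀ c : ℝ, 0 < c → ∀ s t : ℝ, 0 ≤ s → s < t →
      Tendsto (fun n : ℕ =>
        ∑ j ∈ Finset.Ioc ⌊s * (n : ℝ)⌋₊ ⌊t * (n : ℝ)⌋₊,
          (mLeb (Metric.ball x0 (c / (n : ℝ)) ∩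
            hitWithin (fun i => lsv (γ i)) (shift^[j] ω) (Metric.ball x0 (c / (n : ℝ)))
              ⌊(n : ℝ) / Real.log n⌋₊)).toReal)
        atTop (𝓝 0) := by
  set T : Fin m → ℝ → ℝ := fun i => lsv (γ i) with hT
  have hall : ∀ᵐ z ∂(mLeb.prod P), ∀ q c t : ℕ,
      Tendsto (fun i => Phi T (q + 1) (c + 1) (t + 1) i z) atTop (𝓝 0) := by
    rw [ae_all_iff]; intro q
    rw [ae_all_iff]; intro c
    rw [ae_all_iff]; intro t
    exact Phi_ae γ hγ hγmax P (q + 1) (c + 1) (t + 1) (by omega) (by omega) (by omega)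
  have hpos : ∀ᵐ x0 ∂mLeb, 0 < x0 := by
    have h1 : ∀ᵐ x0 ∂mLeb, x0 ∈ Icc (0:ℝ) 1 := ae_restrict_mem measurableSet_Icc
    have h2 : ∀ᵐ x0 ∂mLeb, x0 ≠ 0 := ae_restrict_of_ae (Measure.ae_ne volume 0)
    filter_upwards [h1, h2] with x h1 h2
    exact lt_of_le_of_ne h1.1 (Ne.symm h2)
  filter_upwards [Measure.ae_ae_of_ae_prod hall, hpos] with x0 hx hx0
  filter_upwards [hx] with ω hω
  intro c hc s t hs hst
  have ht : 0 < t := hs.trans_lt hst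
  obtain ⟨q, hq⟩ := exists_nat_one_div_lt (half_pos hx0)
  obtain ⟨c', hc'⟩ := exists_nat_ge c
  obtain ⟨t', ht'⟩ := exists_nat_ge t
  have hPhi := (hω q c' t').comp tendsto_natLog
  have hlog : Tendsto (fun n : ℕ => ENNReal.ofReal (16 * t * c ^ 2 / x0 * (Real.log n)⁻¹)) atTop
      (𝓝 0) := by
    have h1 : Tendsto (fun n : ℕ => (Real.log n)⁻¹) atTop (𝓝 0) :=
      tendsto_inv_atTop_zero.comp (Real.tendsto_log_atTop.comp tendsto_natCast_atTop_atTop)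
    have h2 := ENNReal.tendsto_ofReal (h1.const_mul (16 * t * c ^ 2 / x0))
    simpa using h2
  have hsum := hPhi.add hlog
  rw [add_zero] at hsum
  have hfin : ∀ A : Set ℝ, mLeb A ≠ ⊤ := fun A => measure_ne_top _ _
  have hball : ∀ᶠ n : ℕ in atTop, c / (n:ℝ) < x0 / 2 :=
    (tendsto_const_div_atTop_nhds_zero_nat c).eventually_lt_const (half_pos hx0)
  have main : Tendsto (fun n : ℕ =>
        ∑ j ∈ Finset.Ioc ⌊s * (n : ℝ)⌋₊ ⌊t * (n : ℝ)⌋₊,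
          mLeb (Metric.ball x0 (c / (n : ℝ)) ∩
            hitWithin T (shift^[j] ω) (Metric.ball x0 (c / (n : ℝ)))
              ⌊(n : ℝ) / Real.log n⌋₊)) atTop (𝓝 0) := by
    refine tendsto_of_tendsto_of_tendsto_of_le_of_le' tendsto_const_nhds hsum
      (Eventually.of_forall fun _ => zero_le) ?_
    filter_upwards [hball, cutoff_eventually c hc, eventually_gt_atTop 1] with n hnb hnk hn1
    set i := Nat.log 2 n with hi
    set N := ⌊(n : ℝ) / Real.log n⌋₊ with hN
    set r := c / (n:ℝ) with hr
    set r' : ℝ := ((c' + 1 : ℕ) : ℝ) / 2 ^ i with hr'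
    have hn0 : (0:ℝ) < n := by exact_mod_cast (by omega : 0 < n)
    have hn1' : (1:ℝ) < n := by exact_mod_cast hn1
    have hlogpos : 0 < Real.log n := Real.log_pos hn1'
    have hr0 : 0 < r := by positivity
    have hrr : r ≤ r' := by
      have h1 : ((2:ℝ) ^ i) ≤ n := by exact_mod_cast Nat.pow_log_le_self 2 (by omega : n ≠ 0)
      have h2 : c ≤ ((c' + 1 : ℕ) : ℝ) := by push_cast; linarith
      rw [hr, hr']
      gcongr
    have hn2 : n ≤ 2 ^ (i + 1) := (Nat.lt_pow_succ_log_self (by norm_num) n).le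
    have hNle : (N:ℝ) ≤ n / Real.log n := Nat.floor_le (by positivity)
    have htn : (⌊t * (n:ℝ)⌋₊ : ℝ) ≤ t * n := Nat.floor_le (by positivity)
    have hterm : ∀ j : ℕ, mLeb (Metric.ball x0 r ∩ hitWithin T (shift^[j] ω)
        (Metric.ball x0 r) N) ≤
        volume (Metric.ball x0 r' ∩
          recSet T (1 / ((q + 1 : ℕ) : ℝ)) r' (cutoff i) (shift^[j] ω)) +
        ENNReal.ofReal (n / Real.log n * (16 * r ^ 2 / x0)) := by
      intro j
      set L : ℕ → Set ℝ := fun k => {x | x ∈ Ioc (0:ℝ) 1 ∧ x ∈ Metric.ball x0 r ∧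
        randComp T (shift^[j] ω) k x ∈ Metric.ball x0 r} with hL
      have hsub : (Metric.ball x0 r ∩ hitWithin T (shift^[j] ω) (Metric.ball x0 r) N) ∩ Icc 0 1 ⊆
          (Metric.ball x0 r' ∩
            recSet T (1 / ((q + 1 : ℕ) : ℝ)) r' (cutoff i) (shift^[j] ω)) ∪
          ⋃ k ∈ Finset.Ioc (cutoff i) N, L k := by
        rintro x ⟨⟨hxb, k, hk1, hkN, hkb⟩, hx01⟩
        have hxb' := hxb
        have hkb' := hkb
        rw [Metric.mem_ball, Real.dist_eq, abs_lt] at hxb' hkb'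
        by_cases hk : k ≤ cutoff i
        · left
          refine ⟨Metric.ball_subset_ball hrr hxb, ⟨?_, hx01.2⟩, k,
            Finset.mem_Icc.2 ⟨hk1, hk⟩, ?_⟩
          · push_cast
            linarith
          · rw [abs_lt]
            constructor <;> linarith
        · right
          push Not at hk
          refine mem_biUnion (Finset.mem_coe.2 (Finset.mem_Ioc.2 ⟨hk, hkN⟩)) ?_
          exact ⟨⟨by linarith, hx01.2⟩, hxb, hkb⟩
      have hm1 : mLeb (Metric.ball x0 r ∩ hitWithin T (shift^[j] ω) (Metric.ball x0 r) N) =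
          volume ((Metric.ball x0 r ∩ hitWithin T (shift^[j] ω) (Metric.ball x0 r) N)
            ∩ Icc 0 1) := Measure.restrict_apply' measurableSet_Icc
      rw [hm1]
      refine (measure_mono hsub).trans ((measure_union_le _ _).trans ?_)
      refine add_le_add le_rfl ?_
      refine (measure_biUnion_finset_le _ _).trans ?_
      refine (Finset.sum_le_card_nsmul _ _ (ENNReal.ofReal (16 * r ^ 2 / x0))
        (fun k hk => ?_)).trans ?_
      · exact long_bound γ hγ hγmax k _ x0 r hx0 hr0 hnb.le (hnk k (Finset.mem_Ioc.1 hk).1)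
      · rw [Nat.card_Ioc, nsmul_eq_mul, ← ENNReal.ofReal_natCast,
          ← ENNReal.ofReal_mul (Nat.cast_nonneg _)]
        apply ENNReal.ofReal_le_ofReal
        have h1 : ((N - cutoff i : ℕ) : ℝ) ≤ N := by exact_mod_cast Nat.sub_le _ _
        exact mul_le_mul_of_nonneg_right (h1.trans hNle) (by positivity)
    refine (Finset.sum_le_sum fun j _ => hterm j).trans ?_
    rw [Finset.sum_add_distrib]
    refine add_le_add ?_ ?_
    · simp only [Function.comp, Phi]
      refine Finset.sum_le_sum_of_subset ?_
      intro j hj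
      rw [Finset.mem_range]
      have h1 : (⌊t * (n:ℝ)⌋₊ : ℝ) ≤ ((t' * n : ℕ) : ℝ) := by
        push_cast
        exact htn.trans (by gcongr)
      have h2 : ⌊t * (n:ℝ)⌋₊ ≤ t' * n := by exact_mod_cast h1
      have h3 : t' * n ≤ (t' + 1) * 2 ^ (i + 1) := Nat.mul_le_mul (by omega) hn2
      have h4 := (Finset.mem_Ioc.1 hj).2
      exact Nat.lt_succ_of_le (h4.trans (h2.trans h3))
    · rw [Finset.sum_const, Nat.card_Ioc, nsmul_eq_mul, ← ENNReal.ofReal_natCast,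
        ← ENNReal.ofReal_mul (Nat.cast_nonneg _)]
      apply ENNReal.ofReal_le_ofReal
      have h1 : ((⌊t * (n:ℝ)⌋₊ - ⌊s * (n:ℝ)⌋₊ : ℕ) : ℝ) ≤ ⌊t * (n:ℝ)⌋₊ := by
        exact_mod_cast Nat.sub_le _ _
      refine (mul_le_mul_of_nonneg_right (h1.trans htn) (by positivity)).trans (le_of_eq ?_)
      rw [hr]
      field_simp
  have h0 := (ENNReal.tendsto_toReal ENNReal.zero_ne_top).comp main
  rw [ENNReal.toReal_zero] at h0
  refine h0.congr fun n => ?_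
  simp only [Function.comp]
  rw [ENNReal.toReal_sum (fun j _ => hfin _)]
end
end

section
/- Let 𝒮 = {T_1,…,T_m} be a finite collection of piecewise C² uniformly expanding maps of [0,1] whose transfer-operator cocycle (P_ω^n) with respect to Lebesgue measure m satisfies the conditions (LY), (Dec), and (Min) on BV, and let Ω := {1,…,m}^ℤ carry the Bernoulli measure 𝐏 := (p_1,…,p_m)^{⊗ℤ} (all p_i > 0) with left shift σ; write T_ω^n := T_{ω_{n−1}} ∘ ⋯ ∘ T_{ω_0}. Let (h_ω) be the unique equivariant family of BV probability densities with P_ω h_ω = h_{σω}, set ν^ω := h_ω·m and ν := ∫_Ω ν^ω d𝐏(ω). Fix α ∈ (0,2) and x0 ∈ [0,1] such that every composition T_ω^n is continuous at x0 and T_ω^n(x0) ≠ x0 for all ω and n ≥ 1 (x0 ∉ 𝒟 and non-periodic). Let φ(x) := |x − x0|^{−1/α}; the limit b := lim_{ε→0⁺} ε^{−1} ν({x : |x − x0| < ε}) exists and is positive; set b_n := (b n)^{1/α}. Let J = ⋃_{i=1}^{q} (u_i, v_i] be a finite disjoint union of intervals with 0 < u_i < v_i ≤ ∞, set Π_α(J)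 := Σ_i (u_i^{−α} − v_i^{−α}), and A_n := { x : φ(x)/b_n ∈ J }. Then for 𝐏-a.e. ω ∈ Ω and all 0 ≤ s < t: lim_{n→∞} ν^{σ^{⌊ns⌋} ω}( { x : R_{A_n}(σ^{⌊ns⌋} ω)(x) > ⌊n(t−s)⌋ } ) = e^{−(t−s) Π_α(J)}, where R_U(ω)(x) := inf{ k ≥ 1 : T_ω^k(x) ∈ U }. -/
open MeasureTheory Filter Set Topology ENNReal

noncomputable section

/-- `T` is a piecewise `C²` uniformly expanding map of `[0,1]` with expansion constant `lam`. -/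
def PiecewiseC2Expanding (T : ℝ → ℝ) (lam : ℝ) : Prop :=
  ∃ (N : ℕ) (a : ℕ → ℝ), 1 ≤ N ∧ a 0 = 0 ∧ a N = 1 ∧ (∀ i < N, a i < a (i + 1)) ∧
    ∀ i < N, ∃ g : ℝ → ℝ,
      ContDiffOn ℝ 2 g (Set.Icc (a i) (a (i + 1))) ∧
      Set.EqOn T g (Set.Ioo (a i) (a (i + 1))) ∧
      (StrictMonoOn g (Set.Icc (a i) (a (i + 1))) ∨
        StrictAntiOn g (Set.Icc (a i) (a (i + 1)))) ∧
      ∀ x ∈ Set.Icc (a i) (a (i + 1)),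
        lam ≤ |derivWithin g (Set.Icc (a i) (a (i + 1))) x|

/-- The transfer-operator cocycle `P_ω^n = P_{σ^{n−1}ω} ∘ ⋯ ∘ P_ω`. -/
def Pcomp {m : ℕ} (Pop : Fin m → (ℝ → ℝ) → ℝ → ℝ) (ω : Om m) : ℕ → (ℝ → ℝ) → ℝ → ℝ
  | 0 => fun f => f
  | n + 1 => fun f => Pop (ω (n : ℤ)) (Pcomp Pop ω n f)

/-- The total variation of `f` on `[0,1]`. -/
def var (f : ℝ → ℝ) : ℝ := (eVariationOn f (Set.Icc 0 1)).toReal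

/-- The BV norm `‖f‖_BV = ‖f‖_{L¹(m)} + var(f)` on `[0,1]`. -/
def BVnorm (f : ℝ → ℝ) : ℝ := (∫ x, |f x| ∂mLeb) + var f

/-- `f` is of bounded variation on `[0,1]` (and integrable). -/
def IsBV (f : ℝ → ℝ) : Prop :=
  Integrable f mLeb ∧ BoundedVariationOn f (Set.Icc 0 1)

/-- The observable `φ(x) = |x − x0|^{−1/α}`. -/
def phiObs (α x0 x : ℝ) : ℝ := |x - x0| ^ (-α⁻¹)

/-- Membership in `J = ⋃_i (u_i, v_i]` (with `v_i = ∞` allowed). -/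
def memJ {q : ℕ} (u : Fin q → ℝ) (v : Fin q → ℝ≥0∞) (y : ℝ) : Prop :=
  ∃ i, u i < y ∧ ENNReal.ofReal y ≤ v i

/-- `Π_α(J) = Σ_i (u_i^{−α} − v_i^{−α})`. -/
def PiAlpha (α : ℝ) {q : ℕ} (u : Fin q → ℝ) (v : Fin q → ℝ≥0∞) : ℝ :=
  ∑ i, ((u i) ^ (-α) - ((v i).toReal) ^ (-α))

/-- The set `A_n = φ^{−1}(b_n J) = {x : φ(x)/b_n ∈ J}`. -/
def Aset (α x0 bn : ℝ) {q : ℕ} (u : Fin q → ℝ) (v : Fin q → ℝ≥0∞) : Set ℝ :=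
  {x | memJ u v (phiObs α x0 x / bn)}

/-- The survival event `{x : R_A(ω)(x) > N}`. -/
def survSet {m : ℕ} (T : Fin m → ℝ → ℝ) (ω : Om m) (A : Set ℝ) (N : ℕ) : Set ℝ :=
  {x | ∀ k : ℕ, 1 ≤ k → k ≤ N → randComp T ω k x ∉ A}


/-! ### Basic facts on `mLeb` and functions of bounded variation -/

instance mLeb_prob : IsProbabilityMeasure mLeb := by
  constructor
  simp [mLeb]

lemma ae_mLeb_mem : ∀ᵐ x ∂mLeb, x ∈ Set.Icc (0:ℝ) 1 :=
  ae_restrict_mem measurableSet_Icc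

lemma eVariationOn_add_le' (f g : ℝ → ℝ) (s : Set ℝ) :
    eVariationOn (fun x => f x + g x) s ≤ eVariationOn f s + eVariationOn g s := by
  apply iSup_le
  rintro ⟨n, ⟨u, u_mono, u_mem⟩⟩
  calc ∑ i ∈ Finset.range n, edist (f (u (i + 1)) + g (u (i + 1))) (f (u i) + g (u i))
      ≤ ∑ i ∈ Finset.range n, (edist (f (u (i + 1))) (f (u i)) +
          edist (g (u (i + 1))) (g (u i))) :=
        Finset.sum_le_sum fun i _ => edist_add_add_le _ _ _ _
    _ = (∑ i ∈ Finset.range n, edist (f (u (i + 1))) (f (u i))) +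
          ∑ i ∈ Finset.range n, edist (g (u (i + 1))) (g (u i)) := Finset.sum_add_distrib
    _ ≤ _ := add_le_add (eVariationOn.sum_le u_mono u_mem) (eVariationOn.sum_le u_mono u_mem)

lemma eVariationOn_const' (c : ℝ) (s : Set ℝ) : eVariationOn (fun _ => c) s = 0 := by
  apply eVariationOn.constant_on
  rintro _ ⟨x, _, rfl⟩ _ ⟨y, _, rfl⟩
  rfl

lemma var_nonneg' (f : ℝ → ℝ) : 0 ≤ var f := ENNReal.toReal_nonneg

lemma var_const (c : ℝ) : var (fun _ => c) = 0 := by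
  simp [var, eVariationOn_const']

lemma IsBV.const (c : ℝ) : IsBV (fun _ => c) :=
  ⟨integrable_const c, by simp [BoundedVariationOn, eVariationOn_const']⟩

lemma IsBV.add {f g : ℝ → ℝ} (hf : IsBV f) (hg : IsBV g) : IsBV (fun x => f x + g x) :=
  ⟨hf.1.add hg.1, ne_top_of_le_ne_top (ENNReal.add_ne_top.2 ⟨hf.2, hg.2⟩)
    (eVariationOn_add_le' f g _)⟩

lemma var_add_le {f g : ℝ → ℝ} (hf : IsBV f) (hg : IsBV g) :
    var (fun x => f x + g x) ≤ var f + var g := by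
  unfold var
  rw [← ENNReal.toReal_add hf.2 hg.2]
  exact ENNReal.toReal_mono (ENNReal.add_ne_top.2 ⟨hf.2, hg.2⟩) (eVariationOn_add_le' f g _)

lemma BVnorm_nonneg (f : ℝ → ℝ) : 0 ≤ BVnorm f :=
  add_nonneg (integral_nonneg fun _ => abs_nonneg _) (var_nonneg' f)

lemma BVnorm_add_le {f g : ℝ → ℝ} (hf : IsBV f) (hg : IsBV g) :
    BVnorm (fun x => f x + g x) ≤ BVnorm f + BVnorm g := by
  unfold BVnorm
  have h1 := var_add_le hf hg
  have h2 : ∫ x, |f x + g x| ∂mLeb ≤ ∫ x, |f x| ∂mLeb + ∫ x, |g x| ∂mLeb := by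
    rw [← integral_add hf.1.abs hg.1.abs]
    exact integral_mono (hf.1.add hg.1).abs (hf.1.abs.add hg.1.abs) fun x => abs_add_le _ _
  linarith

lemma BVnorm_const (c : ℝ) : BVnorm (fun _ => c) = |c| := by
  simp [BVnorm, var_const]

lemma abs_sub_le_var {f : ℝ → ℝ} (hf : IsBV f) {x y : ℝ} (hx : x ∈ Set.Icc (0:ℝ) 1)
    (hy : y ∈ Set.Icc (0:ℝ) 1) : |f x - f y| ≤ var f := by
  have := hf.2.dist_le hx hy
  rwa [Real.dist_eq] at this

lemma abs_le_BVnorm {f : ℝ → ℝ} (hf : IsBV f) {x : ℝ} (hx : x ∈ Set.Icc (0:ℝ) 1) :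
    |f x| ≤ BVnorm f := by
  have h1 : |f x| - var f ≤ ∫ y, |f y| ∂mLeb := by
    have h2 : ∫ y, (|f x| - var f) ∂mLeb ≤ ∫ y, |f y| ∂mLeb := by
      apply integral_mono_ae (integrable_const _) hf.1.abs
      filter_upwards [ae_mLeb_mem] with y hy
      have := abs_sub_le_var hf hx hy
      have h3 := abs_sub_abs_le_abs_sub (f x) (f y)
      linarith
    simpa using h2
  unfold BVnorm
  linarith

lemma enorm_le_of_abs {f : ℝ → ℝ} {F x : ℝ} (h : |f x| ≤ F) : ‖f x‖ₑ ≤ ENNReal.ofReal F := by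
  rw [Real.enorm_eq_ofReal_abs]
  exact ENNReal.ofReal_le_ofReal h

lemma IsBV.mul {f g : ℝ → ℝ} (hf : IsBV f) (hg : IsBV g) : IsBV (fun x => f x * g x) := by
  refine ⟨?_, hf.2.fun_mul hg.2⟩
  refine Integrable.bdd_mul (c := BVnorm f) hg.1 hf.1.1 ?_
  filter_upwards [ae_mLeb_mem] with y hy
  exact abs_le_BVnorm hf hy

lemma var_mul_le {f g : ℝ → ℝ} (hf : IsBV f) (hg : IsBV g) {F G : ℝ}
    (hF : ∀ x ∈ Set.Icc (0:ℝ) 1, |f x| ≤ F) (hG : ∀ x ∈ Set.Icc (0:ℝ) 1, |g x| ≤ G) :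
    var (fun x => f x * g x) ≤ F * var g + G * var f := by
  have h0 : (0:ℝ) ∈ Set.Icc (0:ℝ) 1 := by simp
  have hF0 : 0 ≤ F := (abs_nonneg _).trans (hF 0 h0)
  have hG0 : 0 ≤ G := (abs_nonneg _).trans (hG 0 h0)
  have := eVariationOn_fun_mul_le (s := Set.Icc (0:ℝ) 1) (fun x hx => enorm_le_of_abs (hF x hx))
    (fun x hx => enorm_le_of_abs (hG x hx))
  have h1 : ENNReal.ofReal F * eVariationOn g (Set.Icc 0 1) ≠ ⊤ :=
    ENNReal.mul_ne_top ENNReal.ofReal_ne_top hg.2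
  have h2 : ENNReal.ofReal G * eVariationOn f (Set.Icc 0 1) ≠ ⊤ :=
    ENNReal.mul_ne_top ENNReal.ofReal_ne_top hf.2
  have h3 := ENNReal.toReal_mono (ENNReal.add_ne_top.2 ⟨h1, h2⟩) this
  rw [ENNReal.toReal_add h1 h2, ENNReal.toReal_mul, ENNReal.toReal_mul,
    ENNReal.toReal_ofReal hF0, ENNReal.toReal_ofReal hG0] at h3
  exact h3

lemma IsBV.const_mul {f : ℝ → ℝ} (hf : IsBV f) (c : ℝ) : IsBV (fun x => c * f x) :=
  (IsBV.const c).mul hf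

lemma BVnorm_const_mul_le {f : ℝ → ℝ} (hf : IsBV f) (c : ℝ) :
    BVnorm (fun x => c * f x) ≤ |c| * BVnorm f := by
  have h1 := var_mul_le (IsBV.const c) hf (F := |c|) (G := BVnorm f) (fun _ _ => le_rfl)
    (fun x hx => abs_le_BVnorm hf hx)
  rw [var_const] at h1
  unfold BVnorm at *
  simp only [abs_mul]
  rw [integral_const_mul]
  linarith

lemma IsBV.sub {f g : ℝ → ℝ} (hf : IsBV f) (hg : IsBV g) : IsBV (fun x => f x - g x) := by
  have := hf.add (hg.const_mul (-1))
  convert this using 2 with x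
  ring

lemma BVnorm_sub_le {f g : ℝ → ℝ} (hf : IsBV f) (hg : IsBV g) :
    BVnorm (fun x => f x - g x) ≤ BVnorm f + BVnorm g := by
  have h1 := BVnorm_add_le hf (hg.const_mul (-1))
  have h2 := BVnorm_const_mul_le hg (-1)
  have h3 : (fun x => f x - g x) = fun x => f x + (-1) * g x := by
    ext x; ring
  rw [h3]
  simp only [abs_neg, abs_one, one_mul] at h2
  linarith

/-- Product with a bounded BV function. -/
lemma BVnorm_mul_le {f g : ℝ → ℝ} (hf : IsBV f) (hg : IsBV g) {F : ℝ}
    (hF : ∀ x ∈ Set.Icc (0:ℝ) 1, |f x| ≤ F) :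
    BVnorm (fun x => f x * g x) ≤ (F + var f) * BVnorm g := by
  have h1 := var_mul_le hf hg hF (fun x hx => abs_le_BVnorm hg hx)
  have h2 : ∫ x, |f x * g x| ∂mLeb ≤ ∫ x, F * |g x| ∂mLeb := by
    apply integral_mono_ae (hf.mul hg).1.abs (hg.1.abs.const_mul F)
    filter_upwards [ae_mLeb_mem] with y hy
    simp only [abs_mul]
    exact mul_le_mul_of_nonneg_right (hF y hy) (abs_nonneg _)
  rw [integral_const_mul] at h2
  have h3 : BVnorm g = (∫ x, |g x| ∂mLeb) + var g := rfl
  have h4 : BVnorm (fun x => f x * g x) = (∫ x, |f x * g x| ∂mLeb) + var fun x => f x * g x := rfl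
  rw [h4]
  have h5 : F * BVnorm g = F * (∫ x, |g x| ∂mLeb) + F * var g := by rw [h3]; ring
  have h6 : (F + var f) * BVnorm g = F * BVnorm g + BVnorm g * var f := by ring
  rw [h6, h5]
  linarith

lemma IsBV_of_monotone {f : ℝ → ℝ} (hf : Monotone f) : IsBV f ∧ var f ≤ f 1 - f 0 := by
  have h1 := (hf.monotoneOn (Set.Icc (0:ℝ) 1)).eVariationOn_eq (a := 0) (b := 1) (by simp) (by simp)
  rw [Set.inter_self] at h1
  refine ⟨⟨?_, ?_⟩, ?_⟩
  · exact (hf.monotoneOn _).integrableOn_isCompact isCompact_Icc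
  · rw [BoundedVariationOn, h1]; exact ENNReal.ofReal_ne_top
  · unfold var
    rw [h1, ENNReal.toReal_ofReal]
    have := hf (zero_le_one' ℝ)
    linarith

/-- the indicator of the open ball `{|x-x0|<r}`. -/
def ballInd (x0 r : ℝ) (x : ℝ) : ℝ := Set.indicator {x | |x - x0| < r} (fun _ => (1:ℝ)) x

lemma ballInd_bv (x0 r : ℝ) : IsBV (ballInd x0 r) ∧ var (ballInd x0 r) ≤ 2 := by
  classical
  let f1 : ℝ → ℝ := fun x => if x0 - r < x then 1 else 0
  let f2 : ℝ → ℝ := fun x => if x < x0 + r then 0 else 1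
  rcases le_or_gt r 0 with hr | hr
  · have : ballInd x0 r = fun _ => 0 := by
      ext x
      simp only [ballInd, Set.indicator]
      rw [if_neg]
      simp only [mem_ofPred_eq, not_lt]
      exact hr.trans (abs_nonneg _)
    rw [this]
    exact ⟨IsBV.const 0, by rw [var_const]; norm_num⟩
  have m1 : Monotone f1 := by
    intro x y hxy
    simp only [f1]
    split_ifs <;> grind
  have m2 : Monotone f2 := by
    intro x y hxy
    simp only [f2]
    split_ifs <;> grind
  obtain ⟨b1, v1⟩ := IsBV_of_monotone m1
  obtain ⟨b2, v2⟩ := IsBV_of_monotone m2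
  have e : ballInd x0 r = fun x => f1 x + (-1) * f2 x := by
    ext x
    simp only [ballInd, Set.indicator, mem_ofPred_eq, f1, f2, abs_lt]
    split_ifs <;> grind
  have b01 : ∀ x, 0 ≤ f1 x ∧ f1 x ≤ 1 := by intro x; simp only [f1]; split_ifs <;> norm_num
  have b02 : ∀ x, 0 ≤ f2 x ∧ f2 x ≤ 1 := by intro x; simp only [f2]; split_ifs <;> norm_num
  rw [e]
  refine ⟨b1.add (b2.const_mul _), ?_⟩
  have h1 := var_add_le b1 (b2.const_mul (-1))
  have h2 := var_mul_le (IsBV.const (-1)) b2 (F := 1) (G := 1) (by simp)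
    (fun x _ => by rw [abs_le]; constructor <;> linarith [(b02 x).1, (b02 x).2])
  rw [var_const] at h2
  linarith [(b01 0).1, (b01 1).2, (b02 0).1, (b02 1).2]

/-! ### The transfer operator cocycle -/

/-- The part of the hypotheses used in the quenched estimates. -/
structure Hyp {m : ℕ} (T : Fin m → ℝ → ℝ) (Pop : Fin m → (ℝ → ℝ) → ℝ → ℝ)
    (C θ M cmin : ℝ) : Prop where
  hC : 1 ≤ C
  hθ0 : 0 < θ
  hθ1 : θ < 1
  hM : 0 < M
  meas : ∀ i, Measurable (T i)
  dual : ∀ (i : Fin m) (f : ℝ → ℝ), IsBV f →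
      ∀ g : ℝ → ℝ, Measurable g → (∃ Cg : ℝ, ∀ x, |g x| ≤ Cg) →
        ∫ x, g (T i x) * f x ∂mLeb = ∫ x, g x * Pop i f x ∂mLeb
  popBV : ∀ (i : Fin m) (f : ℝ → ℝ), IsBV f → IsBV (Pop i f)
  ly : ∀ (i : Fin m) (f : ℝ → ℝ), IsBV f → BVnorm (Pop i f) ≤ M * BVnorm f
  dec : ∀ (n : ℕ) (ω : Om m) (f : ℝ → ℝ), IsBV f →
      (∫ x, f x ∂mLeb) = 0 → BVnorm (Pcomp Pop ω n f) ≤ C * θ ^ n * BVnorm f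
  min : ∀ (n : ℕ), 1 ≤ n → ∀ (ω : Om m), ∀ x ∈ Set.Icc (0 : ℝ) 1,
      cmin ≤ Pcomp Pop ω n (fun _ => 1) x

lemma shift_iter_apply {m : ℕ} (i : ℕ) (ω : Om m) (k : ℤ) :
    (shift^[i] ω) k = ω (k + i) := by
  induction i generalizing ω with
  | zero => simp
  | succ i ih =>
    rw [Function.iterate_succ_apply, ih]
    simp only [shift]
    congr 1
    push_cast
    ring

lemma randComp_add {m : ℕ} (T : Fin m → ℝ → ℝ) (ω : Om m) (i j : ℕ) (x : ℝ) :
    randComp T ω (i + j) x = randComp T (shift^[i] ω) j (randComp T ω i x) := by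
  induction j with
  | zero => rfl
  | succ j ih =>
    rw [← add_assoc]
    simp only [randComp]
    rw [ih, shift_iter_apply]
    congr 2
    push_cast
    ring

lemma randComp_meas {m : ℕ} {T : Fin m → ℝ → ℝ} (hT : ∀ i, Measurable (T i)) (ω : Om m) (n : ℕ) :
    Measurable (randComp T ω n) := by
  induction n with
  | zero => exact measurable_id
  | succ n ih => exact (hT _).comp ih

lemma randComp_congr {m : ℕ} (T : Fin m → ℝ → ℝ) (ω ω' : Om m) (n : ℕ)
    (h : ∀ i : ℕ, i < n → ω i = ω' i) : randComp T ω n = randComp T ω' n := by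
  induction n with
  | zero => rfl
  | succ n ih =>
    funext x
    simp only [randComp]
    rw [ih fun i hi => h i (by omega), h n (by omega)]

/-- indicator function with value one -/
def ind (B : Set ℝ) : ℝ → ℝ := B.indicator (fun _ => (1:ℝ))

lemma ind_meas {B : Set ℝ} (hB : MeasurableSet B) : Measurable (ind B) :=
  measurable_const.indicator hB

lemma ind_nonneg (B : Set ℝ) (x : ℝ) : 0 ≤ ind B x :=
  Set.indicator_nonneg (fun _ _ => zero_le_one) x

lemma ind_le_one (B : Set ℝ) (x : ℝ) : ind B x ≤ 1 :=
  Set.indicator_le_self' (fun _ _ => zero_le_one) x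

lemma ind_abs (B : Set ℝ) (x : ℝ) : |ind B x| ≤ 1 := by
  rw [abs_of_nonneg (ind_nonneg B x)]; exact ind_le_one B x

lemma ind_preimage (S : ℝ → ℝ) (B : Set ℝ) (x : ℝ) : ind B (S x) = ind (S ⁻¹' B) x := by
  classical
  simp only [ind, Set.indicator, mem_preimage]

lemma ind_inter (A B : Set ℝ) (x : ℝ) : ind (A ∩ B) x = ind A x * ind B x := by
  classical
  by_cases h1 : x ∈ A <;> by_cases h2 : x ∈ B <;> simp [ind, h1, h2]

lemma integral_ind {B : Set ℝ} (hB : MeasurableSet B) (μ : Measure ℝ) :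
    ∫ x, ind B x ∂μ = μ.real B := by
  unfold ind
  rw [integral_indicator hB]
  simp

lemma integrable_ind_mul {B : Set ℝ} (hB : MeasurableSet B) {f : ℝ → ℝ}
    (hf : Integrable f mLeb) : Integrable (fun x => ind B x * f x) mLeb := by
  refine Integrable.bdd_mul (c := 1) hf (ind_meas hB).aestronglyMeasurable ?_
  filter_upwards with y
  exact ind_abs _ _

section Dyn

variable {m : ℕ} {T : Fin m → ℝ → ℝ} {Pop : Fin m → (ℝ → ℝ) → ℝ → ℝ} {C θ M cmin : ℝ}

lemma Pcomp_BV (H : Hyp T Pop C θ M cmin) (ω : Om m) (n : ℕ) {f : ℝ → ℝ} (hf : IsBV f) :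
    IsBV (Pcomp Pop ω n f) := by
  induction n with
  | zero => exact hf
  | succ n ih => exact H.popBV _ _ ih

lemma Pcomp_dual (H : Hyp T Pop C θ M cmin) (ω : Om m) (n : ℕ) {f : ℝ → ℝ} (hf : IsBV f)
    (g : ℝ → ℝ) (hg : Measurable g) (hgb : ∃ Cg : ℝ, ∀ x, |g x| ≤ Cg) :
    ∫ x, g (randComp T ω n x) * f x ∂mLeb = ∫ x, g x * Pcomp Pop ω n f x ∂mLeb := by
  induction n generalizing g with
  | zero => rfl
  | succ n ih =>
    simp only [randComp, Pcomp]
    obtain ⟨Cg, hCg⟩ := hgb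
    rw [ih (fun x => g (T (ω n) x)) (hg.comp (H.meas _)) ⟨Cg, fun x => hCg _⟩]
    exact H.dual _ _ (Pcomp_BV H ω n hf) g hg ⟨Cg, hCg⟩

/-- Decay of correlations against indicator functions. -/
lemma decay (H : Hyp T Pop C θ M cmin) (ω : Om m) (n : ℕ) {f : ℝ → ℝ} (hf : IsBV f)
    (h0 : ∫ x, f x ∂mLeb = 0) {U : Set ℝ} (hU : MeasurableSet U) :
    |∫ x, ind U (randComp T ω n x) * f x ∂mLeb| ≤ C * θ ^ n * BVnorm f * mLeb.real U := by
  rw [Pcomp_dual H ω n hf (ind U) (ind_meas hU) ⟨1, ind_abs U⟩]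
  have hb := Pcomp_BV H ω n hf
  have h1 := H.dec n ω f hf h0
  calc |∫ x, ind U x * Pcomp Pop ω n f x ∂mLeb|
      ≤ ∫ x, |ind U x * Pcomp Pop ω n f x| ∂mLeb := abs_integral_le_integral_abs
    _ ≤ ∫ x, (C * θ ^ n * BVnorm f) * ind U x ∂mLeb := by
        apply integral_mono_ae (integrable_ind_mul hU hb.1).abs
        · have := integrable_ind_mul hU (integrable_const (C * θ ^ n * BVnorm f) (μ := mLeb))
          simpa [mul_comm] using this
        · filter_upwards [ae_mLeb_mem] with y hy
          rw [abs_mul, abs_of_nonneg (ind_nonneg U y), mul_comm]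
          exact mul_le_mul_of_nonneg_right ((abs_le_BVnorm hb hy).trans h1) (ind_nonneg U y)
    _ = _ := by rw [integral_const_mul, integral_ind hU]

/-- `μ` has BV density `f`. -/
def HasDens (μ : Measure ℝ) (f : ℝ → ℝ) : Prop :=
  IsBV f ∧ ∀ B, MeasurableSet B → μ.real B = ∫ x, ind B x * f x ∂mLeb

lemma HasDens.real_le {μ : Measure ℝ} {f : ℝ → ℝ} (h : HasDens μ f) {B : Set ℝ}
    (hB : MeasurableSet B) : μ.real B ≤ BVnorm f * mLeb.real B := by
  rw [h.2 B hB, ← integral_ind hB, ← integral_const_mul]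
  apply integral_mono_ae (integrable_ind_mul hB h.1.1)
  · have := integrable_ind_mul hB (integrable_const (BVnorm f) (μ := mLeb))
    simpa [mul_comm] using this
  · filter_upwards [ae_mLeb_mem] with y hy
    rw [mul_comm]
    exact mul_le_mul_of_nonneg_right ((le_abs_self _).trans (abs_le_BVnorm h.1 hy)) (ind_nonneg B y)

lemma HasDens.integral_eq {μ : Measure ℝ} [IsProbabilityMeasure μ] {f : ℝ → ℝ}
    (h : HasDens μ f) : ∫ x, f x ∂mLeb = 1 := by
  have := h.2 univ MeasurableSet.univ
  simpa [ind] using this.symm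

lemma hasDens_mLeb : HasDens mLeb (fun _ => 1) :=
  ⟨IsBV.const 1, fun B hB => by simp [integral_ind hB]⟩

lemma map_real (H : Hyp T Pop C θ M cmin) (μ : Measure ℝ) (ω : Om m) (n : ℕ) {B : Set ℝ}
    (hB : MeasurableSet B) :
    (μ.map (randComp T ω n)).real B = μ.real (randComp T ω n ⁻¹' B) := by
  rw [map_measureReal_apply (randComp_meas H.meas ω n) hB]

lemma map_succ_head (H : Hyp T Pop C θ M cmin) (μ : Measure ℝ) (ω : Om m) (n : ℕ) :
    μ.map (randComp T ω (n + 1)) = (μ.map (T (ω 0))).map (randComp T (shift ω) n) := by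
  rw [Measure.map_map (randComp_meas H.meas _ n) (H.meas _)]
  congr 1
  funext x
  rw [add_comm n 1, randComp_add]
  rfl

lemma sum_geo_le (hθ0 : 0 < θ) (hθ1 : θ < 1) (j : ℕ) :
    ∑ i ∈ Finset.range j, θ ^ i ≤ 1 / (1 - θ) := by
  rw [one_div, ← tsum_geometric_of_lt_one hθ0.le hθ1]
  exact (summable_geometric_of_lt_one hθ0.le hθ1).sum_le_tsum _ (fun i _ => pow_nonneg hθ0.le i)

lemma hasDens_one_aux (H : Hyp T Pop C θ M cmin) (j : ℕ) (ω : Om m) :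
    ∃ R, HasDens (mLeb.map (randComp T ω j)) R ∧
      BVnorm R ≤ 1 + C * (M + 1) * ∑ i ∈ Finset.range j, θ ^ i := by
  induction j generalizing ω with
  | zero =>
    refine ⟨fun _ => 1, ?_, by simp [BVnorm_const]⟩
    have : mLeb.map (randComp T ω 0) = mLeb := Measure.map_id
    rw [this]
    exact hasDens_mLeb
  | succ j ih =>
    obtain ⟨R, hR, hRn⟩ := ih (shift ω)
    set d : ℝ → ℝ := fun x => Pop (ω 0) (fun _ => 1) x - 1 with hd
    have b1 : IsBV (fun _ : ℝ => (1:ℝ)) := IsBV.const 1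
    have bp : IsBV (Pop (ω 0) (fun _ => 1)) := H.popBV _ _ b1
    have bd : IsBV d := bp.sub b1
    have nd : BVnorm d ≤ M + 1 := by
      have h1 := BVnorm_sub_le bp b1
      have h2 := H.ly (ω 0) _ b1
      rw [BVnorm_const] at h1 h2
      simp only [abs_one, mul_one] at h1 h2
      linarith
    have id : ∫ x, d x ∂mLeb = 0 := by
      have h1 := H.dual (ω 0) _ b1 (fun _ => 1) measurable_const ⟨1, by simp⟩
      simp only [one_mul] at h1
      rw [hd, integral_sub bp.1 b1.1, ← h1, sub_self]
    refine ⟨fun x => R x + Pcomp Pop (shift ω) j d x, ⟨hR.1.add (Pcomp_BV H _ j bd), ?_⟩, ?_⟩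
    · intro B hB
      have hRB := hR.2 B hB
      rw [map_real H _ _ _ hB] at hRB ⊢
      have hpre : MeasurableSet (randComp T (shift ω) j ⁻¹' B) := randComp_meas H.meas _ _ hB
      have e1 : randComp T ω (j+1) ⁻¹' B = T (ω 0) ⁻¹' (randComp T (shift ω) j ⁻¹' B) := by
        ext x
        simp only [mem_preimage]
        rw [add_comm j 1, randComp_add]
        rfl
      have e2 : mLeb.real (randComp T ω (j+1) ⁻¹' B) =
          ∫ x, ind (randComp T (shift ω) j ⁻¹' B) x * Pop (ω 0) (fun _ => 1) x ∂mLeb := by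
        rw [← H.dual (ω 0) _ b1 _ (ind_meas hpre) ⟨1, ind_abs _⟩, e1]
        simp only [ind_preimage (T (ω 0)), mul_one]
        rw [integral_ind (H.meas _ hpre)]
      have e3 : ∫ x, ind (randComp T (shift ω) j ⁻¹' B) x * Pop (ω 0) (fun _ => 1) x ∂mLeb
          = mLeb.real (randComp T (shift ω) j ⁻¹' B)
            + ∫ x, ind (randComp T (shift ω) j ⁻¹' B) x * d x ∂mLeb := by
        rw [← integral_ind hpre, ← integral_add _ (integrable_ind_mul hpre bd.1)]
        · congr 1; ext x; simp only [hd]; ring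
        · simpa using integrable_ind_mul hpre (integrable_const (1:ℝ) (μ := mLeb))
      have e4 := Pcomp_dual H (shift ω) j bd (ind B) (ind_meas hB) ⟨1, ind_abs _⟩
      simp only [ind_preimage (randComp T (shift ω) j)] at e4
      rw [e2, e3, e4, hRB, ← integral_add (integrable_ind_mul hB hR.1.1)
        (integrable_ind_mul hB (Pcomp_BV H _ j bd).1)]
      congr 1; ext x; ring
    · have h1 := BVnorm_add_le hR.1 (Pcomp_BV H (shift ω) j bd)
      have h2 := H.dec j (shift ω) d bd id
      have h3 : C * θ ^ j * BVnorm d ≤ C * θ ^ j * (M + 1) :=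
        mul_le_mul_of_nonneg_left nd (mul_nonneg (by linarith [H.hC]) (pow_nonneg H.hθ0.le _))
      rw [Finset.sum_range_succ]
      nlinarith [h1, h2, h3, hRn]

/-- uniform constant -/
def K0 (C θ M : ℝ) : ℝ := 1 + C * (M + 1) * (1 / (1 - θ))

lemma K0_ge_one (H : Hyp T Pop C θ M cmin) : 1 ≤ K0 C θ M := by
  have h1 := H.hC
  have h2 := H.hM
  have h3 : 0 < 1 - θ := by linarith [H.hθ1]
  have : 0 ≤ C * (M + 1) * (1 / (1 - θ)) := by positivity
  unfold K0; linarith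

lemma hasDens_one (H : Hyp T Pop C θ M cmin) (j : ℕ) (ω : Om m) :
    ∃ R, HasDens (mLeb.map (randComp T ω j)) R ∧ BVnorm R ≤ K0 C θ M := by
  obtain ⟨R, h1, h2⟩ := hasDens_one_aux H j ω
  refine ⟨R, h1, h2.trans ?_⟩
  unfold K0
  have := sum_geo_le H.hθ0 H.hθ1 j
  have h3 : 0 ≤ C * (M + 1) := mul_nonneg (by linarith [H.hC]) (by linarith [H.hM])
  linarith [mul_le_mul_of_nonneg_left this h3]

/-- Loss of memory: image of a BV-density versus image of Lebesgue measure. -/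
lemma dens_vs_leb (H : Hyp T Pop C θ M cmin) {μ : Measure ℝ} [IsProbabilityMeasure μ]
    {f : ℝ → ℝ} (hf : HasDens μ f) (ω : Om m) (n : ℕ) {B : Set ℝ} (hB : MeasurableSet B) :
    |μ.real (randComp T ω n ⁻¹' B) - mLeb.real (randComp T ω n ⁻¹' B)|
      ≤ C * θ ^ n * (BVnorm f + 1) * mLeb.real B := by
  have b1 : IsBV (fun _ : ℝ => (1:ℝ)) := IsBV.const 1
  have hpre : MeasurableSet (randComp T ω n ⁻¹' B) := randComp_meas H.meas _ _ hB
  have bd := hf.1.sub b1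
  have id : ∫ x, (f x - 1) ∂mLeb = 0 := by
    rw [integral_sub hf.1.1 b1.1, hf.integral_eq]; simp
  have h1 := decay H ω n bd id hB
  have h2 := BVnorm_sub_le hf.1 b1
  rw [BVnorm_const, abs_one] at h2
  have h3 : ∫ x, ind B (randComp T ω n x) * (f x - 1) ∂mLeb =
      μ.real (randComp T ω n ⁻¹' B) - mLeb.real (randComp T ω n ⁻¹' B) := by
    rw [hf.2 _ hpre, hasDens_mLeb.2 _ hpre, ← integral_sub (integrable_ind_mul hpre hf.1.1)
      (integrable_ind_mul hpre b1.1)]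
    congr 1; ext x; rw [ind_preimage]; ring
  rw [h3] at h1
  refine h1.trans ?_
  have : 0 ≤ C * θ ^ n := mul_nonneg (by linarith [H.hC]) (pow_nonneg H.hθ0.le _)
  gcongr

lemma hasDens_map (H : Hyp T Pop C θ M cmin) {μ : Measure ℝ} [IsProbabilityMeasure μ]
    {f : ℝ → ℝ} (hf : HasDens μ f) (ω : Om m) (n : ℕ) :
    ∃ g, HasDens (μ.map (randComp T ω n)) g ∧
      BVnorm g ≤ K0 C θ M + C * (BVnorm f + 1) := by
  obtain ⟨R, hR, hRn⟩ := hasDens_one H n ω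
  have b1 : IsBV (fun _ : ℝ => (1:ℝ)) := IsBV.const 1
  have bd := hf.1.sub b1
  have id : ∫ x, (f x - 1) ∂mLeb = 0 := by
    rw [integral_sub hf.1.1 b1.1, hf.integral_eq]; simp
  have h2 := BVnorm_sub_le hf.1 b1
  rw [BVnorm_const, abs_one] at h2
  have bP := Pcomp_BV H ω n bd
  refine ⟨fun x => R x + Pcomp Pop ω n (fun x => f x - 1) x, ⟨hR.1.add bP, ?_⟩, ?_⟩
  · intro B hB
    have hpre : MeasurableSet (randComp T ω n ⁻¹' B) := randComp_meas H.meas _ _ hB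
    have hRB := hR.2 B hB
    rw [map_real H _ _ _ hB] at hRB ⊢
    have h4 := Pcomp_dual H ω n bd (ind B) (ind_meas hB) ⟨1, ind_abs _⟩
    simp only [mul_add]
    rw [integral_add (integrable_ind_mul hB hR.1.1) (integrable_ind_mul hB bP.1), ← h4, ← hRB,
      hf.2 _ hpre, hasDens_mLeb.2 _ hpre, ← integral_add (integrable_ind_mul hpre b1.1)]
    · congr 1; ext x; rw [ind_preimage]; ring
    · simp only [ind_preimage (randComp T ω n)]
      exact integrable_ind_mul hpre bd.1
  · have h1 := BVnorm_add_le hR.1 bP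
    have h3 := H.dec n ω _ bd id
    have h4 : θ ^ n ≤ 1 := pow_le_one₀ H.hθ0.le H.hθ1.le
    have h5 : C * θ ^ n * BVnorm (fun x => f x - 1) ≤ C * 1 * (BVnorm f + 1) := by
      have := BVnorm_nonneg f
      have := H.hC
      apply mul_le_mul _ h2 (BVnorm_nonneg _) (by linarith)
      exact mul_le_mul_of_nonneg_left h4 (by linarith)
    linarith

/-- Mixing for a set with BV indicator. -/
lemma mixing (H : Hyp T Pop C θ M cmin) {μ : Measure ℝ} [IsProbabilityMeasure μ]
    {f : ℝ → ℝ} (hf : HasDens μ f) {A : Set ℝ} (hA : MeasurableSet A) {ψ : ℝ → ℝ}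
    (hψ : IsBV ψ) (hψA : ψ =ᵐ[mLeb] ind A) {V : ℝ}
    (hV : BVnorm (fun x => ψ x * f x) ≤ V * BVnorm f) (ω : Om m) (n : ℕ) {U : Set ℝ}
    (hU : MeasurableSet U) :
    |μ.real (A ∩ randComp T ω n ⁻¹' U) - μ.real A * μ.real (randComp T ω n ⁻¹' U)|
      ≤ C * θ ^ n * ((V + 1) * BVnorm f) * mLeb.real U := by
  have hpre : MeasurableSet (randComp T ω n ⁻¹' U) := randComp_meas H.meas _ _ hU
  set a := μ.real A with ha
  have ha0 : 0 ≤ a := measureReal_nonneg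
  have ha1 : a ≤ 1 := measureReal_le_one
  have bψ := hψ.mul hf.1
  have ba := hf.1.const_mul a
  have bd := bψ.sub ba
  have iψ : ∀ g : ℝ → ℝ, ∫ x, g x * (ψ x * f x) ∂mLeb = ∫ x, g x * (ind A x * f x) ∂mLeb := by
    intro g
    apply integral_congr_ae
    filter_upwards [hψA] with x hx
    rw [hx]
  have id : ∫ x, (ψ x * f x - a * f x) ∂mLeb = 0 := by
    have h1 := iψ (fun _ => 1)
    simp only [one_mul] at h1
    rw [integral_sub bψ.1 ba.1, h1, integral_const_mul, hf.integral_eq, ← hf.2 A hA]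
    simp [ha]
  have h1 := decay H ω n bd id hU
  have h2 : BVnorm (fun x => ψ x * f x - a * f x) ≤ (V + 1) * BVnorm f := by
    have h3 := BVnorm_sub_le bψ ba
    have h4 := BVnorm_const_mul_le hf.1 a
    rw [abs_of_nonneg ha0] at h4
    nlinarith [BVnorm_nonneg f]
  have h3 : ∫ x, ind U (randComp T ω n x) * (ψ x * f x - a * f x) ∂mLeb =
      μ.real (A ∩ randComp T ω n ⁻¹' U) - a * μ.real (randComp T ω n ⁻¹' U) := by
    simp only [mul_sub, ind_preimage (randComp T ω n)]
    rw [integral_sub (integrable_ind_mul hpre bψ.1) (integrable_ind_mul hpre ba.1), iψ,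
      hf.2 _ (hA.inter hpre), hf.2 _ hpre, ← integral_const_mul]
    congr 1
    · congr 1; ext x; rw [ind_inter]; ring
    · congr 1; ext x; ring
  rw [h3] at h1
  refine h1.trans ?_
  have : 0 ≤ C * θ ^ n := mul_nonneg (by linarith [H.hC]) (pow_nonneg H.hθ0.le _)
  gcongr

end Dyn

/-! ### The exponential law for a fixed target set -/

/-- An orbit of quenched measures along a realisation `ω`. -/
structure Orb {m : ℕ} (T : Fin m → ℝ → ℝ) (ω : Om m) (ν : ℕ → Measure ℝ) (f : ℕ → ℝ → ℝ)
    (K : ℝ) : Prop where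
  prob : ∀ j, IsProbabilityMeasure (ν j)
  dens : ∀ j, HasDens (ν j) (f j)
  bound : ∀ j, BVnorm (f j) ≤ K
  map : ∀ j i, ν (j + i) = (ν j).map (randComp T (shift^[j] ω) i)

/-- A set with a BV version of its indicator function. -/
structure GoodSet (A : Set ℝ) (V : ℝ) : Prop where
  meas : MeasurableSet A
  ex : ∃ ψ : ℝ → ℝ, IsBV ψ ∧ ψ =ᵐ[mLeb] ind A ∧
    ∀ f, IsBV f → BVnorm (fun x => ψ x * f x) ≤ V * BVnorm f

section Dyn

variable {m : ℕ} {T : Fin m → ℝ → ℝ} {Pop : Fin m → (ℝ → ℝ) → ℝ → ℝ} {C θ M cmin : ℝ}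
  {ω : Om m} {ν : ℕ → Measure ℝ} {f : ℕ → ℝ → ℝ} {K V : ℝ} {A : Set ℝ}

lemma survSet_meas (H : Hyp T Pop C θ M cmin) (hA : MeasurableSet A) (ω : Om m) (N : ℕ) :
    MeasurableSet (survSet T ω A N) := by
  have : survSet T ω A N = ⋂ k : ℕ, ⋂ _ : 1 ≤ k, ⋂ _ : k ≤ N, (randComp T ω k ⁻¹' A)ᶜ := by
    ext x; simp [survSet]
  rw [this]
  exact MeasurableSet.iInter fun k => MeasurableSet.iInter fun _ => MeasurableSet.iInter fun _ =>
    (randComp_meas H.meas ω k hA).compl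

lemma orb_mixing (H : Hyp T Pop C θ M cmin) (O : Orb T ω ν f K) (hA : GoodSet A V) (hV : 0 ≤ V)
    (j i : ℕ) {U : Set ℝ} (hU : MeasurableSet U) :
    |(ν j).real (A ∩ randComp T (shift^[j] ω) i ⁻¹' U) - (ν j).real A * (ν (j + i)).real U|
      ≤ C * θ ^ i * ((V + 1) * K) * mLeb.real U := by
  have := O.prob j
  obtain ⟨ψ, h1, h2, h3⟩ := hA.ex
  have := mixing H (O.dens j) hA.meas h1 h2 (h3 _ (O.dens j).1) (shift^[j] ω) i hU
  rw [O.map j i, map_real H _ _ _ hU]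
  refine this.trans ?_
  have h5 : 0 ≤ C * θ ^ i := mul_nonneg (by linarith [H.hC]) (pow_nonneg H.hθ0.le _)
  have := O.bound j
  gcongr

lemma orb_real_le (O : Orb T ω ν f K) (j : ℕ) {B : Set ℝ} (hB : MeasurableSet B) :
    (ν j).real B ≤ K * mLeb.real B :=
  ((O.dens j).real_le hB).trans (mul_le_mul_of_nonneg_right (O.bound j) measureReal_nonneg)

lemma step_err (H : Hyp T Pop C θ M cmin) (O : Orb T ω ν f K) (hA : GoodSet A V) (hV : 0 ≤ V)
    {κ eret : ℝ} (ℓ : ℕ) (hκ : ∀ j, (ν j).real A ≤ κ)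
    (hret : ∀ j, ∑ i ∈ Finset.Icc 1 ℓ, (ν j).real (A ∩ randComp T (shift^[j] ω) i ⁻¹' A) ≤ eret)
    (j p : ℕ) :
    |(ν j).real (A ∩ survSet T (shift^[j] ω) A p)
        - (ν j).real A * (ν j).real (survSet T (shift^[j] ω) A p)|
      ≤ C * θ ^ ℓ * ((V + 1) * K) + eret + ℓ * κ ^ 2 := by
  have hprob := O.prob
  have hκ0 : 0 ≤ κ := measureReal_nonneg.trans (hκ j)
  set U := survSet T (shift^[j + ℓ] ω) A (p - ℓ) with hUdef
  set S := survSet T (shift^[j] ω) A p with hSdef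
  set W := randComp T (shift^[j] ω) ℓ ⁻¹' U with hWdef
  have mU : MeasurableSet U := survSet_meas H hA.meas _ _
  have mS : MeasurableSet S := survSet_meas H hA.meas _ _
  have mW : MeasurableSet W := randComp_meas H.meas _ _ mU
  have key : ∀ k x, randComp T (shift^[j + ℓ] ω) k (randComp T (shift^[j] ω) ℓ x)
      = randComp T (shift^[j] ω) (ℓ + k) x := by
    intro k x
    rw [randComp_add, ← Function.iterate_add_apply, add_comm ℓ j]
  have SW : S ⊆ W := by
    intro x hx k hk1 hk2
    rw [key]
    exact hx (ℓ + k) (by omega) (by omega)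
  have WS : W ⊆ S ∪ ⋃ i ∈ Finset.Icc 1 ℓ, randComp T (shift^[j] ω) i ⁻¹' A := by
    intro x hx
    by_cases hxS : x ∈ S
    · exact Or.inl hxS
    · right
      simp only [hSdef, survSet, mem_ofPred_eq, not_forall, not_not] at hxS
      obtain ⟨k, hk1, hk2, hk⟩ := hxS
      rcases le_or_gt k ℓ with hkl | hkl
      · simp only [mem_iUnion]
        exact ⟨k, Finset.mem_Icc.2 ⟨hk1, hkl⟩, hk⟩
      · exfalso
        have := hx (k - ℓ) (by omega) (by omega)
        rw [key, show ℓ + (k - ℓ) = k by omega] at this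
        exact this hk
  have hmix := orb_mixing H O hA hV j ℓ mU
  have hWν : (ν (j + ℓ)).real U = (ν j).real W := by
    rw [O.map j ℓ, map_real H _ _ _ mU]
  rw [hWν] at hmix
  have hmU : mLeb.real U ≤ 1 := measureReal_le_one
  have hK : 0 ≤ K := (BVnorm_nonneg _).trans (O.bound j)
  have hmix' : |(ν j).real (A ∩ W) - (ν j).real A * (ν j).real W| ≤ C * θ ^ ℓ * ((V + 1) * K) := by
    refine hmix.trans ?_
    have h5 : 0 ≤ C * θ ^ ℓ := mul_nonneg (by linarith [H.hC]) (pow_nonneg H.hθ0.le _)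
    have h6 : 0 ≤ C * θ ^ ℓ * ((V + 1) * K) := by positivity
    nlinarith
  -- comparison of the intersections
  have c1 : (ν j).real (A ∩ S) ≤ (ν j).real (A ∩ W) :=
    measureReal_mono (inter_subset_inter_right _ SW)
  have c2 : (ν j).real (A ∩ W) ≤ (ν j).real (A ∩ S) + eret := by
    have h1 : A ∩ W ⊆ (A ∩ S) ∪ ⋃ i ∈ Finset.Icc 1 ℓ, (A ∩ randComp T (shift^[j] ω) i ⁻¹' A) := by
      intro x hx
      rcases WS hx.2 with h | h
      · exact Or.inl ⟨hx.1, h⟩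
      · right
        simp only [mem_iUnion] at h ⊢
        obtain ⟨i, hi, hh⟩ := h
        exact ⟨i, hi, hx.1, hh⟩
    calc (ν j).real (A ∩ W) ≤ _ := measureReal_mono h1
      _ ≤ _ := measureReal_union_le _ _
      _ ≤ _ := by
        gcongr
        exact (measureReal_biUnion_finset_le _ _).trans (hret j)
  have d1 : (ν j).real S ≤ (ν j).real W := measureReal_mono SW
  have d2 : (ν j).real W ≤ (ν j).real S + ℓ * κ := by
    calc (ν j).real W ≤ _ := measureReal_mono WS
      _ ≤ _ := measureReal_union_le _ _
      _ ≤ _ := by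
        gcongr
        refine (measureReal_biUnion_finset_le _ _).trans ?_
        have : ∀ i ∈ Finset.Icc 1 ℓ, (ν j).real (randComp T (shift^[j] ω) i ⁻¹' A) ≤ κ := by
          intro i _
          rw [← map_real H _ _ _ hA.meas, ← O.map j i]
          exact hκ _
        refine (Finset.sum_le_sum this).trans ?_
        simp
  have ha0 : 0 ≤ (ν j).real A := measureReal_nonneg
  have haκ := hκ j
  have e1 : (ν j).real A * (ν j).real S ≤ (ν j).real A * (ν j).real W :=
    mul_le_mul_of_nonneg_left d1 ha0
  have e2 : (ν j).real A * (ν j).real W ≤ (ν j).real A * (ν j).real S + ℓ * κ ^ 2 := by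
    have h1 := mul_le_mul_of_nonneg_left d2 ha0
    have h2 : (ν j).real A * (ℓ * κ) ≤ κ * (ℓ * κ) := by gcongr
    nlinarith
  have her : 0 ≤ eret := (Finset.sum_nonneg fun i _ => measureReal_nonneg).trans (hret j)
  have hl : 0 ≤ (ℓ:ℝ) * κ ^ 2 := by positivity
  rw [abs_le] at hmix' ⊢
  constructor <;> linarith [hmix'.1, hmix'.2]

lemma exp_quad {a : ℝ} (h0 : 0 ≤ a) (h1 : a ≤ 1) : |(1 - a) - Real.exp (-a)| ≤ a ^ 2 := by
  have := Real.abs_exp_sub_one_sub_id_le (x := -a) (by rw [abs_neg, abs_of_nonneg h0]; exact h1)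
  rw [abs_sub_comm]
  calc |Real.exp (-a) - (1 - a)| = |Real.exp (-a) - 1 - -a| := by congr 1; ring
    _ ≤ (-a)^2 := this
    _ = a ^ 2 := by ring

lemma surv_exp (H : Hyp T Pop C θ M cmin) (O : Orb T ω ν f K) (hA : MeasurableSet A)
    {κ E : ℝ} (hκ : ∀ j, (ν j).real A ≤ κ) (hκ1 : κ ≤ 1)
    (hE : ∀ j p, |(ν j).real (A ∩ survSet T (shift^[j] ω) A p)
        - (ν j).real A * (ν j).real (survSet T (shift^[j] ω) A p)| ≤ E) (p j : ℕ) :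
    |(ν j).real (survSet T (shift^[j] ω) A p)
      - Real.exp (-∑ i ∈ Finset.range p, (ν (j + 1 + i)).real A)| ≤ p * (E + κ ^ 2) := by
  have hprob := O.prob
  induction p generalizing j with
  | zero =>
    have : survSet T (shift^[j] ω) A 0 = univ := by
      ext x; simp only [survSet, mem_ofPred_eq, mem_univ, iff_true]; intro k h1 h2; omega
    simp [this]
  | succ p ih =>
    have h1 := ih (j + 1)
    set S := survSet T (shift^[j + 1] ω) A p with hS
    set S' := survSet T (shift^[j] ω) A (p + 1) with hS'
    have mS : MeasurableSet S := survSet_meas H hA _ _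
    have key : ∀ k x, randComp T (shift^[j + 1] ω) k (randComp T (shift^[j] ω) 1 x)
        = randComp T (shift^[j] ω) (1 + k) x := by
      intro k x
      rw [randComp_add, ← Function.iterate_add_apply, add_comm 1 j]
    have e1 : S' = randComp T (shift^[j] ω) 1 ⁻¹' (S \ A) := by
      ext x
      constructor
      · intro hx
        refine ⟨fun k hk1 hk2 => ?_, hx 1 le_rfl (by omega)⟩
        rw [key]
        exact hx (1 + k) (by omega) (by omega)
      · rintro ⟨hx1, hx2⟩ k hk1 hk2
        rcases Nat.lt_or_ge 1 k with h | h
        · have := hx1 (k - 1) (by omega) (by omega)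
          rwa [key, show 1 + (k - 1) = k by omega] at this
        · have : k = 1 := by omega
          rw [this]; exact hx2
    have e2 : (ν j).real S' = (ν (j + 1)).real S - (ν (j + 1)).real (A ∩ S) := by
      rw [e1, ← map_real H _ _ _ (mS.diff hA), ← O.map j 1, inter_comm A S]
      have := measureReal_inter_add_sdiff (μ := ν (j + 1)) (s := S) hA
      linarith
    have h2 := hE (j + 1) p
    rw [← hS] at h2
    set a := (ν (j + 1)).real A with ha
    have ha0 : 0 ≤ a := measureReal_nonneg
    have haκ : a ≤ κ := hκ _
    have h3 := exp_quad ha0 (haκ.trans hκ1)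
    have h4 : a ^ 2 ≤ κ ^ 2 := by gcongr
    rw [Finset.sum_range_succ']
    simp only [add_zero]
    have e3 : ∑ k ∈ Finset.range p, (ν (j + 1 + (k + 1))).real A
        = ∑ i ∈ Finset.range p, (ν (j + 1 + 1 + i)).real A := by
      apply Finset.sum_congr rfl
      intro k _
      congr 2
      ring
    rw [e3, neg_add, Real.exp_add]
    set X := Real.exp (-∑ i ∈ Finset.range p, (ν (j + 1 + 1 + i)).real A) with hX
    have hX0 : 0 ≤ X := (Real.exp_pos _).le
    set s := (ν (j + 1)).real S with hs
    have hs0 : 0 ≤ s := measureReal_nonneg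
    have hs1 : s ≤ 1 := measureReal_le_one
    have hea : Real.exp (-a) ≤ 1 := Real.exp_le_one_iff.2 (by linarith)
    have hea0 : 0 ≤ Real.exp (-a) := (Real.exp_pos _).le
    rw [e2]
    have t1 : s - (ν (j + 1)).real (A ∩ S) - X * Real.exp (-a)
        = -((ν (j + 1)).real (A ∩ S) - a * s) + s * ((1 - a) - Real.exp (-a))
          + (s - X) * Real.exp (-a) := by ring
    rw [t1]
    have b1 : |s * ((1 - a) - Real.exp (-a))| ≤ κ ^ 2 := by
      rw [abs_mul, abs_of_nonneg hs0]
      nlinarith [abs_nonneg (1 - a - Real.exp (-a))]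
    have b2 : |(s - X) * Real.exp (-a)| ≤ p * (E + κ ^ 2) := by
      rw [abs_mul, abs_of_nonneg hea0]
      nlinarith [abs_nonneg (s - X)]
    calc _ ≤ |-((ν (j + 1)).real (A ∩ S) - a * s) + s * ((1 - a) - Real.exp (-a))|
          + |(s - X) * Real.exp (-a)| := abs_add_le _ _
      _ ≤ |-((ν (j + 1)).real (A ∩ S) - a * s)| + |s * ((1 - a) - Real.exp (-a))|
          + |(s - X) * Real.exp (-a)| := by gcongr; exact abs_add_le _ _
      _ ≤ E + κ ^ 2 + p * (E + κ ^ 2) := by rw [abs_neg]; gcongr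
      _ = _ := by push_cast; ring

/-- short returns -/
lemma short_ret (H : Hyp T Pop C θ M cmin) (O : Orb T ω ν f K) (hA : GoodSet A V) (hV : 0 ≤ V)
    {κ : ℝ} (hκ : ∀ j, (ν j).real A ≤ κ) (L ℓ : ℕ)
    (hemp : ∀ j i, 1 ≤ i → i ≤ L → A ∩ randComp T (shift^[j] ω) i ⁻¹' A = ∅) (j : ℕ) :
    ∑ i ∈ Finset.Icc 1 ℓ, (ν j).real (A ∩ randComp T (shift^[j] ω) i ⁻¹' A)
      ≤ C * ((V + 1) * K) * mLeb.real A * (θ ^ L / (1 - θ)) + ℓ * κ ^ 2 := by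
  have hprob := O.prob
  have hK : 0 ≤ K := (BVnorm_nonneg _).trans (O.bound j)
  have hC0 : 0 ≤ C := by linarith [H.hC]
  have hκ0 : 0 ≤ κ := measureReal_nonneg.trans (hκ j)
  set Q := C * ((V + 1) * K) * mLeb.real A with hQ
  have hQ0 : 0 ≤ Q := by positivity
  have hb : ∀ i ∈ Finset.Icc 1 ℓ, (ν j).real (A ∩ randComp T (shift^[j] ω) i ⁻¹' A)
      ≤ (if L ≤ i then Q * θ ^ i else 0) + κ ^ 2 := by
    intro i hi
    rw [Finset.mem_Icc] at hi
    split_ifs with h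
    · have h1 := (abs_le.1 (orb_mixing H O hA hV j i hA.meas)).2
      have h2 : (ν j).real A * (ν (j + i)).real A ≤ κ ^ 2 := by
        rw [pow_two]
        exact mul_le_mul (hκ _) (hκ _) measureReal_nonneg hκ0
      have h3 : C * θ ^ i * ((V + 1) * K) * mLeb.real A = Q * θ ^ i := by rw [hQ]; ring
      linarith
    · rw [hemp j i hi.1 (by omega)]
      simp only [measureReal_empty, zero_add]
      positivity
  refine (Finset.sum_le_sum hb).trans ?_
  rw [Finset.sum_add_distrib]
  have s2 : ∑ i ∈ Finset.Icc 1 ℓ, κ ^ 2 = ℓ * κ ^ 2 := by simp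
  have s1 : ∑ i ∈ Finset.Icc 1 ℓ, (if L ≤ i then Q * θ ^ i else 0) ≤ Q * (θ ^ L / (1 - θ)) := by
    rw [← Finset.sum_filter]
    calc ∑ i ∈ Finset.Icc 1 ℓ with L ≤ i, Q * θ ^ i
        ≤ ∑ i ∈ (Finset.range (ℓ + 1)).map (addLeftEmbedding L), Q * θ ^ i := by
          apply Finset.sum_le_sum_of_subset_of_nonneg
          · intro i hi
            simp only [Finset.mem_filter, Finset.mem_Icc, Finset.mem_map, Finset.mem_range,
              addLeftEmbedding_apply] at hi ⊢
            exact ⟨i - L, by omega, by omega⟩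
          · intro i _ _
            have := H.hθ0
            positivity
      _ = Q * θ ^ L * ∑ i ∈ Finset.range (ℓ + 1), θ ^ i := by
          rw [Finset.sum_map, Finset.mul_sum]
          apply Finset.sum_congr rfl
          intro i _
          simp only [addLeftEmbedding_apply, pow_add]; ring
      _ ≤ Q * θ ^ L * (1 / (1 - θ)) := by
          have := H.hθ0
          have := sum_geo_le H.hθ0 H.hθ1 (ℓ + 1)
          gcongr
      _ = _ := by ring
  linarith

/-- Final quantitative estimate for fixed target. -/
lemma surv_main (H : Hyp T Pop C θ M cmin) (O : Orb T ω ν f K) (hA : GoodSet A V) (hV : 0 ≤ V)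
    {κ : ℝ} (hκ : ∀ j, (ν j).real A ≤ κ) (hκ1 : κ ≤ 1) (L ℓ : ℕ)
    (hemp : ∀ j i, 1 ≤ i → i ≤ L → A ∩ randComp T (shift^[j] ω) i ⁻¹' A = ∅) (j p : ℕ) :
    |(ν j).real (survSet T (shift^[j] ω) A p)
      - Real.exp (-∑ i ∈ Finset.range p, (ν (j + 1 + i)).real A)| ≤
    p * (C * θ ^ ℓ * ((V + 1) * K) +
      (C * ((V + 1) * K) * mLeb.real A * (θ ^ L / (1 - θ)) + ℓ * κ ^ 2) + ℓ * κ ^ 2 + κ ^ 2) :=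
  surv_exp H O hA.meas hκ hκ1
    (step_err H O hA hV ℓ hκ (short_ret H O hA hV hκ L ℓ hemp)) p j

end Dyn

/-! ### The target sets -/

/-- The ball around `x0`. -/
abbrev bl (x0 r : ℝ) : Set ℝ := {x | |x - x0| < r}

lemma bl_meas (x0 r : ℝ) : MeasurableSet (bl x0 r) :=
  measurableSet_lt (by fun_prop) measurable_const

lemma ballInd_eq (x0 r : ℝ) : ballInd x0 r = ind (bl x0 r) := rfl

lemma mLeb_bl_le (x0 : ℝ) {r : ℝ} (hr : 0 ≤ r) : mLeb.real (bl x0 r) ≤ 2 * r := by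
  have h1 : bl x0 r = Metric.ball x0 r := by
    ext x; simp [Real.dist_eq]
  rw [h1]
  have h2 : mLeb.real (Metric.ball x0 r) ≤ volume.real (Metric.ball x0 r) := by
    unfold mLeb Measure.real
    apply ENNReal.toReal_mono (by rw [Real.volume_ball]; exact ENNReal.ofReal_ne_top)
    exact Measure.restrict_apply_le _ _
  refine h2.trans ?_
  rw [Measure.real, Real.volume_ball, ENNReal.toReal_ofReal (by linarith)]

section ASet

variable {α x0 c : ℝ} {q : ℕ} {u : Fin q → ℝ} {v : Fin q → ℝ≥0∞}

lemma y_facts (hα : 0 < α) (hc : 0 < c) {d : ℝ} (hd : 0 < d) :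
    0 < d ^ (-α⁻¹) / c ^ α⁻¹ ∧ (d ^ (-α⁻¹) / c ^ α⁻¹) ^ (-α) = d * c := by
  have h1 : d ^ (-α⁻¹) / c ^ α⁻¹ = (d * c) ^ (-α⁻¹) := by
    rw [Real.mul_rpow hd.le hc.le, Real.rpow_neg hc.le, div_eq_mul_inv]
  refine ⟨by positivity, ?_⟩
  rw [h1, ← Real.rpow_mul (by positivity)]
  have : -α⁻¹ * -α = 1 := by field_simp
  rw [this, Real.rpow_one]

lemma y_lt_iff (hα : 0 < α) {y u : ℝ} (hy : 0 < y) (hu : 0 < u) :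
    u < y ↔ y ^ (-α) < u ^ (-α) :=
  (Real.rpow_lt_rpow_iff_of_neg hy hu (by linarith)).symm

lemma y_le_iff (hα : 0 < α) {y : ℝ} {v : ℝ≥0∞} (hy : 0 < y) (hv : 0 < v) :
    ENNReal.ofReal y ≤ v ↔ v.toReal ^ (-α) ≤ y ^ (-α) := by
  by_cases h : v = ∞
  · subst h
    simp only [le_top, ENNReal.toReal_top, true_iff]
    rw [Real.zero_rpow (by linarith)]
    positivity
  · have hv' : 0 < v.toReal := ENNReal.toReal_pos hv.ne' h
    rw [ENNReal.ofReal_le_iff_le_toReal h]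
    exact (Real.rpow_le_rpow_iff_of_neg hv' hy (by linarith)).symm

lemma mem_A_iff (hα : 0 < α) (hc : 0 < c) (hu : ∀ i, 0 < u i)
    (huv : ∀ i, ENNReal.ofReal (u i) < v i) {x : ℝ} (hx : x ≠ x0) (i : Fin q) :
    (u i < phiObs α x0 x / c ^ α⁻¹ ∧ ENNReal.ofReal (phiObs α x0 x / c ^ α⁻¹) ≤ v i) ↔
      ((v i).toReal ^ (-α) / c ≤ |x - x0| ∧ |x - x0| < u i ^ (-α) / c) := by
  have hd : 0 < |x - x0| := abs_pos.mpr (sub_ne_zero.mpr hx)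
  obtain ⟨hy, hy2⟩ := y_facts hα hc hd
  unfold phiObs
  rw [y_lt_iff hα hy (hu i), y_le_iff hα hy ((zero_le).trans_lt (huv i)), hy2, div_le_iff₀ hc,
    lt_div_iff₀ hc, and_comm]

lemma x0_notMem (hα : 0 < α) (hu : ∀ i, 0 < u i) : x0 ∉ Aset α x0 (c ^ α⁻¹) u v := by
  rintro ⟨i, h1, -⟩
  have : phiObs α x0 x0 = 0 := by
    unfold phiObs
    rw [sub_self, abs_zero, Real.zero_rpow (neg_ne_zero.mpr (inv_ne_zero hα.ne'))]
  rw [this, zero_div] at h1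
  exact absurd h1 (hu i).not_gt

lemma phi_meas : Measurable (phiObs α x0) := by
  unfold phiObs
  fun_prop

lemma A_meas (c : ℝ) : MeasurableSet (Aset α x0 c u v) := by
  have : Aset α x0 c u v = ⋃ i, {x | u i < phiObs α x0 x / c} ∩
      {x | ENNReal.ofReal (phiObs α x0 x / c) ≤ v i} := by
    ext x; simp [Aset, memJ]
  rw [this]
  have h := phi_meas (α := α) (x0 := x0)
  refine MeasurableSet.iUnion fun i => ?_
  exact (measurableSet_lt measurable_const (h.div_const c)).inter
    (measurableSet_le (h.div_const c).ennreal_ofReal measurable_const)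

lemma rad_le (hα : 0 < α) (hu : ∀ i, 0 < u i) (huv : ∀ i, ENNReal.ofReal (u i) < v i) (i : Fin q) :
    0 ≤ (v i).toReal ^ (-α) ∧ (v i).toReal ^ (-α) ≤ u i ^ (-α) := by
  refine ⟨by positivity, ?_⟩
  exact (y_le_iff hα (hu i) ((zero_le).trans_lt (huv i))).1 (huv i).le

/-- The outer radius of the (rescaled) target. -/
def RR (α : ℝ) (u : Fin q → ℝ) : ℝ := ∑ i, u i ^ (-α)

lemma RR_nonneg (hu : ∀ i, 0 < u i) : 0 ≤ RR α u :=
  Finset.sum_nonneg fun i _ => (Real.rpow_pos_of_pos (hu i) _).le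

lemma A_sub (hα : 0 < α) (hc : 0 < c) (hu : ∀ i, 0 < u i)
    (huv : ∀ i, ENNReal.ofReal (u i) < v i) :
    Aset α x0 (c ^ α⁻¹) u v ⊆ bl x0 (RR α u / c) := by
  intro x hx
  have hne : x ≠ x0 := by rintro rfl; exact x0_notMem hα hu hx
  obtain ⟨i, hi⟩ := hx
  have := ((mem_A_iff hα hc hu huv hne i).1 hi).2
  refine this.trans_le ?_
  gcongr
  exact Finset.single_le_sum (f := fun i => u i ^ (-α))
    (fun j _ => (Real.rpow_pos_of_pos (hu j) _).le) (Finset.mem_univ i)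

lemma ind_A (hα : 0 < α) (hc : 0 < c) (hu : ∀ i, 0 < u i)
    (huv : ∀ i, ENNReal.ofReal (u i) < v i)
    (hdisj : ∀ i j, i ≠ j → ∀ y : ℝ,
      ¬((u i < y ∧ ENNReal.ofReal y ≤ v i) ∧ (u j < y ∧ ENNReal.ofReal y ≤ v j)))
    {x : ℝ} (hx : x ≠ x0) :
    ind (Aset α x0 (c ^ α⁻¹) u v) x =
      ∑ i, (ballInd x0 (u i ^ (-α) / c) x - ballInd x0 ((v i).toReal ^ (-α) / c) x) := by
  classical
  have key : ∀ i, ballInd x0 (u i ^ (-α) / c) x - ballInd x0 ((v i).toReal ^ (-α) / c) x =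
      if ((v i).toReal ^ (-α) / c ≤ |x - x0| ∧ |x - x0| < u i ^ (-α) / c) then 1 else 0 := by
    intro i
    have h1 : (v i).toReal ^ (-α) / c ≤ u i ^ (-α) / c := by
      have := (rad_le hα hu huv i).2
      gcongr
    simp only [ballInd, Set.indicator, mem_ofPred_eq]
    grind
  simp_rw [key]
  by_cases hm : x ∈ Aset α x0 (c ^ α⁻¹) u v
  · obtain ⟨i, hi⟩ := id hm
    rw [Finset.sum_eq_single i, if_pos ((mem_A_iff hα hc hu huv hx i).1 hi)]
    · simp [ind, hm]
    · intro j _ hj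
      rw [if_neg]
      intro hcon
      exact hdisj j i hj _ ⟨(mem_A_iff hα hc hu huv hx j).2 hcon, hi⟩
    · simp
  · rw [Finset.sum_eq_zero]
    · simp [ind, hm]
    · intro i _
      rw [if_neg]
      intro hcon
      exact hm ⟨i, (mem_A_iff hα hc hu huv hx i).2 hcon⟩

lemma mLeb_ae_ne (x0 : ℝ) : ∀ᵐ x ∂mLeb, x ≠ x0 := by
  have : mLeb {x0} = 0 := by
    unfold mLeb
    exact le_antisymm ((Measure.restrict_apply_le _ _).trans (by simp)) (zero_le)
  rw [ae_iff]
  simpa using this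

lemma sum_bv {ι : Type*} (s : Finset ι) (g : ι → ℝ → ℝ) (V : ℝ)
    (h : ∀ i ∈ s, IsBV (g i) ∧ var (g i) ≤ V) :
    IsBV (fun x => ∑ i ∈ s, g i x) ∧ var (fun x => ∑ i ∈ s, g i x) ≤ s.card * V := by
  classical
  induction s using Finset.induction_on with
  | empty =>
    simp only [Finset.sum_empty, Finset.card_empty, Nat.cast_zero, zero_mul]
    exact ⟨IsBV.const 0, (var_const 0).le⟩
  | insert a s ha ih =>
    obtain ⟨h1, h2⟩ := ih fun i hi => h i (Finset.mem_insert_of_mem hi)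
    obtain ⟨h3, h4⟩ := h a (Finset.mem_insert_self _ _)
    simp only [Finset.sum_insert ha, Finset.card_insert_of_notMem ha]
    refine ⟨h3.add h1, ?_⟩
    have := var_add_le h3 h1
    push_cast
    linarith

lemma sub_ball_bv (x0 r r' : ℝ) : IsBV (fun x => ballInd x0 r x - ballInd x0 r' x) ∧
    var (fun x => ballInd x0 r x - ballInd x0 r' x) ≤ 4 := by
  obtain ⟨h1, h2⟩ := ballInd_bv x0 r
  obtain ⟨h3, h4⟩ := ballInd_bv x0 r'
  have h5 : IsBV (fun x => (-1) * ballInd x0 r' x) := h3.const_mul (-1)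
  have h6 : (fun x => ballInd x0 r x - ballInd x0 r' x) =
      fun x => ballInd x0 r x + (-1) * ballInd x0 r' x := by funext x; ring
  refine ⟨h1.sub h3, ?_⟩
  rw [h6]
  have h7 := var_add_le h1 h5
  have h8 : var (fun x => (-1) * ballInd x0 r' x) ≤ 2 := by
    have h9 := var_mul_le (IsBV.const (-1)) h3 (F := 1) (G := 1) (by simp)
      (fun x _ => by rw [ballInd_eq]; exact ind_abs _ _)
    rw [var_const] at h9
    linarith
  linarith

lemma A_good (hα : 0 < α) (hc : 0 < c) (hu : ∀ i, 0 < u i)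
    (huv : ∀ i, ENNReal.ofReal (u i) < v i)
    (hdisj : ∀ i j, i ≠ j → ∀ y : ℝ,
      ¬((u i < y ∧ ENNReal.ofReal y ≤ v i) ∧ (u j < y ∧ ENNReal.ofReal y ≤ v j))) :
    GoodSet (Aset α x0 (c ^ α⁻¹) u v) (6 * q) := by
  obtain ⟨h1, h2⟩ := sum_bv Finset.univ (fun i x => ballInd x0 (u i ^ (-α) / c) x -
    ballInd x0 ((v i).toReal ^ (-α) / c) x) 4 (fun i _ => sub_ball_bv _ _ _)
  refine ⟨A_meas _, _, h1, ?_, ?_⟩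
  · filter_upwards [mLeb_ae_ne x0] with x hx
    exact (ind_A hα hc hu huv hdisj hx).symm
  · intro f hf
    refine (BVnorm_mul_le h1 hf (F := 2 * q) ?_).trans ?_
    · intro x _
      refine (Finset.abs_sum_le_sum_abs _ _).trans ?_
      have : ∀ i ∈ (Finset.univ : Finset (Fin q)), |ballInd x0 (u i ^ (-α) / c) x -
          ballInd x0 ((v i).toReal ^ (-α) / c) x| ≤ 2 := by
        intro i _
        refine (abs_sub _ _).trans ?_
        have e1 := ind_abs (bl x0 (u i ^ (-α) / c)) x
        have e2 := ind_abs (bl x0 ((v i).toReal ^ (-α) / c)) x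
        rw [← ballInd_eq] at e1 e2
        linarith
      refine (Finset.sum_le_card_nsmul _ _ _ this).trans ?_
      simp [mul_comm]
    · apply mul_le_mul_of_nonneg_right _ (BVnorm_nonneg f)
      rw [Finset.card_univ, Fintype.card_fin] at h2
      linarith

lemma A_real (hα : 0 < α) (hc : 0 < c) (hu : ∀ i, 0 < u i)
    (huv : ∀ i, ENNReal.ofReal (u i) < v i)
    (hdisj : ∀ i j, i ≠ j → ∀ y : ℝ,
      ¬((u i < y ∧ ENNReal.ofReal y ≤ v i) ∧ (u j < y ∧ ENNReal.ofReal y ≤ v j)))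
    {μ : Measure ℝ} {f : ℝ → ℝ} (hf : HasDens μ f) :
    μ.real (Aset α x0 (c ^ α⁻¹) u v) =
      ∑ i, (μ.real (bl x0 (u i ^ (-α) / c)) - μ.real (bl x0 ((v i).toReal ^ (-α) / c))) := by
  rw [hf.2 _ (A_meas _)]
  have h1 : (fun x => ind (Aset α x0 (c ^ α⁻¹) u v) x * f x) =ᵐ[mLeb]
      fun x => ∑ i, (ind (bl x0 (u i ^ (-α) / c)) x * f x
        - ind (bl x0 ((v i).toReal ^ (-α) / c)) x * f x) := by
    filter_upwards [mLeb_ae_ne x0] with x hx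
    rw [ind_A hα hc hu huv hdisj hx, Finset.sum_mul]
    refine Finset.sum_congr rfl fun i _ => ?_
    rw [sub_mul]; rfl
  have hi := fun r => integrable_ind_mul (bl_meas x0 r) hf.1.1
  rw [integral_congr_ae h1, integral_finsetSum _ (fun i _ => by exact (hi _).sub (hi _))]
  refine Finset.sum_congr rfl fun i _ => ?_
  rw [integral_sub (hi _) (hi _), hf.2 _ (bl_meas _ _), hf.2 _ (bl_meas _ _)]

lemma mLeb_A_le (hα : 0 < α) (hc : 0 < c) (hu : ∀ i, 0 < u i)
    (huv : ∀ i, ENNReal.ofReal (u i) < v i) :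
    mLeb.real (Aset α x0 (c ^ α⁻¹) u v) ≤ 2 * (RR α u / c) :=
  (measureReal_mono (A_sub hα hc hu huv)).trans
    (mLeb_bl_le _ (div_nonneg (RR_nonneg hu) hc.le))

/-- Rescaled ball asymptotics. -/
lemma scaled_ball {μ : Measure ℝ} {cl b : ℝ} (hb : 0 < b)
    (hlim : Tendsto (fun ε : ℝ => μ.real (bl x0 ε) / ε) (𝓝[>] (0 : ℝ)) (𝓝 cl)) {a : ℝ}
    (ha : 0 ≤ a) :
    Tendsto (fun n : ℕ => (n : ℝ) * μ.real (bl x0 (a / (b * n)))) atTop (𝓝 (cl / b * a)) := by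
  rcases ha.eq_or_lt with rfl | ha
  · have : ∀ n : ℕ, (n : ℝ) * μ.real (bl x0 (0 / (b * n))) = 0 := by
      intro n
      have : bl x0 (0 / (b * n)) = ∅ := by
        ext x; simp
      rw [this]; simp
    simp_rw [this]; simp
  · have h1 : Tendsto (fun n : ℕ => a / (b * n)) atTop (𝓝[>] 0) := by
      rw [tendsto_nhdsWithin_iff]
      refine ⟨?_, ?_⟩
      · exact Tendsto.const_div_atTop (tendsto_natCast_atTop_atTop.const_mul_atTop hb) a
      · filter_upwards [eventually_gt_atTop 0] with n hn
        have : (0:ℝ) < n := by exact_mod_cast hn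
        exact mem_Ioi.mpr (by positivity)
    have h2 := (hlim.comp h1).mul_const (a / b)
    have e : cl * (a / b) = cl / b * a := by ring
    rw [e] at h2
    refine h2.congr' ?_
    filter_upwards [eventually_gt_atTop 0] with n hn
    have : (0:ℝ) < n := by exact_mod_cast hn
    simp only [Function.comp]
    field_simp

lemma A_asymp (hα : 0 < α) (hu : ∀ i, 0 < u i)
    (huv : ∀ i, ENNReal.ofReal (u i) < v i)
    (hdisj : ∀ i j, i ≠ j → ∀ y : ℝ,
      ¬((u i < y ∧ ENNReal.ofReal y ≤ v i) ∧ (u j < y ∧ ENNReal.ofReal y ≤ v j)))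
    {μ : Measure ℝ} {f : ℝ → ℝ} (hf : HasDens μ f) {b cl : ℝ} (hb : 0 < b)
    (hlim : Tendsto (fun ε : ℝ => μ.real (bl x0 ε) / ε) (𝓝[>] (0 : ℝ)) (𝓝 cl)) :
    Tendsto (fun n : ℕ => (n : ℝ) * μ.real (Aset α x0 ((b * n) ^ α⁻¹) u v)) atTop
      (𝓝 (cl / b * PiAlpha α u v)) := by
  unfold PiAlpha
  rw [Finset.mul_sum]
  have := tendsto_finsetSum Finset.univ (fun (i : Fin q) _ =>
    (scaled_ball hb hlim (Real.rpow_pos_of_pos (hu i) (-α)).le).sub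
      (scaled_ball hb hlim (rad_le hα hu huv i).1))
  simp_rw [← mul_sub] at this
  refine this.congr' ?_
  filter_upwards [eventually_gt_atTop 0] with n hn
  have : (0:ℝ) < n := by exact_mod_cast hn
  rw [A_real hα (by positivity) hu huv hdisj hf, Finset.mul_sum]

end ASet

/-! ### Local densities of measures with BV density -/

lemma ext_right {f : ℝ → ℝ} (hf : BoundedVariationOn f (Icc 0 1)) {x0 : ℝ}
    (hx0 : x0 ∈ Icc (0:ℝ) 1) :
    ∃ c, Tendsto ((Icc (0:ℝ) 1).indicator f) (𝓝[>] x0) (𝓝 c) := by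
  rcases hx0.2.eq_or_lt with h1 | h1
  · refine ⟨0, tendsto_const_nhds.congr' ?_⟩
    filter_upwards [self_mem_nhdsWithin] with x hx
    rw [indicator_of_notMem]
    rintro ⟨-, h⟩
    exact absurd (mem_Ioi.1 hx) (by rw [h1]; exact h.not_gt)
  · obtain ⟨l, hl⟩ := hf.exists_tendsto_right x0
    have hm : Icc 0 1 ∩ Ioi x0 ∈ 𝓝[>] x0 := by
      filter_upwards [Ioc_mem_nhdsGT h1] with x hx
      exact ⟨⟨hx0.1.trans hx.1.le, hx.2⟩, hx.1⟩
    refine ⟨l, (hl.mono_left (nhdsWithin_le_of_mem hm)).congr' ?_⟩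
    filter_upwards [hm] with x hx
    rw [indicator_of_mem hx.1]

lemma ext_left {f : ℝ → ℝ} (hf : BoundedVariationOn f (Icc 0 1)) {x0 : ℝ}
    (hx0 : x0 ∈ Icc (0:ℝ) 1) :
    ∃ c, Tendsto ((Icc (0:ℝ) 1).indicator f) (𝓝[<] x0) (𝓝 c) := by
  rcases hx0.1.eq_or_lt with h1 | h1
  · refine ⟨0, tendsto_const_nhds.congr' ?_⟩
    filter_upwards [self_mem_nhdsWithin] with x hx
    rw [indicator_of_notMem]
    rintro ⟨h, -⟩
    exact absurd (mem_Iio.1 hx) (by rw [← h1]; exact h.not_gt)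
  · obtain ⟨l, hl⟩ := hf.exists_tendsto_left x0
    have hm : Icc 0 1 ∩ Iio x0 ∈ 𝓝[<] x0 := by
      filter_upwards [Ico_mem_nhdsLT h1] with x hx
      exact ⟨⟨hx.1, hx.2.le.trans hx0.2⟩, hx.2⟩
    refine ⟨l, (hl.mono_left (nhdsWithin_le_of_mem hm)).congr' ?_⟩
    filter_upwards [hm] with x hx
    rw [indicator_of_mem hx.1]

lemma ae_le_lt (x0 : ℝ) : 𝓝[≤] x0 ⊓ ae volume ≤ 𝓝[<] x0 := by
  have h : ({x0}ᶜ : Set ℝ) ∈ ae (volume : Measure ℝ) := by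
    rw [mem_ae_iff, compl_compl]; simp
  have : 𝓝[<] x0 = 𝓝[≤] x0 ⊓ 𝓟 {x0}ᶜ := by
    rw [nhdsWithin, nhdsWithin, inf_assoc, inf_principal]
    congr 2
    ext x; simp [lt_iff_le_and_ne]
  rw [this]
  exact inf_le_inf_left _ (le_principal_iff.2 h)

lemma local_dens {μ : Measure ℝ} {f : ℝ → ℝ} (hf : HasDens μ f) {x0 : ℝ}
    (hx0 : x0 ∈ Icc (0:ℝ) 1) :
    ∃ c, Tendsto (fun ε : ℝ => μ.real (bl x0 ε) / ε) (𝓝[>] (0 : ℝ)) (𝓝 c) := by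
  obtain ⟨cR, hR⟩ := ext_right hf.1.2 hx0
  obtain ⟨cL, hL⟩ := ext_left hf.1.2 hx0
  set F := (Icc (0:ℝ) 1).indicator f with hF
  have hFi : Integrable F volume := by
    rw [hF, integrable_indicator_iff measurableSet_Icc]
    exact hf.1.1
  have hsm : ∀ l : Filter ℝ, StronglyMeasurableAtFilter F l volume := fun l =>
    hFi.aestronglyMeasurable.stronglyMeasurableAtFilter
  have dR : HasDerivWithinAt (fun u => ∫ x in x0..u, F x) cR (Ici x0) x0 :=
    intervalIntegral.integral_hasDerivWithinAt_of_tendsto_ae_right (t := Ioi x0)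
      hFi.intervalIntegrable (hsm _) (hR.mono_left inf_le_left)
  have dL : HasDerivWithinAt (fun u => ∫ x in x0..u, F x) cL (Iic x0) x0 :=
    intervalIntegral.integral_hasDerivWithinAt_of_tendsto_ae_right (t := Iic x0)
      hFi.intervalIntegrable (hsm _) (hL.mono_left (ae_le_lt x0))
  rw [hasDerivWithinAt_iff_tendsto_slope] at dR dL
  have e1 : Tendsto (fun ε : ℝ => x0 + ε) (𝓝[>] 0) (𝓝[Ici x0 \ {x0}] x0) := by
    rw [tendsto_nhdsWithin_iff]
    refine ⟨?_, ?_⟩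
    · have : Tendsto (fun ε : ℝ => x0 + ε) (𝓝 0) (𝓝 (x0 + 0)) := by
        apply Continuous.tendsto; fun_prop
      rw [add_zero] at this
      exact this.mono_left nhdsWithin_le_nhds
    · filter_upwards [self_mem_nhdsWithin] with ε hε
      have := mem_Ioi.1 hε
      exact ⟨mem_Ici.2 (by linarith), by simp; linarith⟩
  have e2 : Tendsto (fun ε : ℝ => x0 - ε) (𝓝[>] 0) (𝓝[Iic x0 \ {x0}] x0) := by
    rw [tendsto_nhdsWithin_iff]
    refine ⟨?_, ?_⟩
    · have : Tendsto (fun ε : ℝ => x0 - ε) (𝓝 0) (𝓝 (x0 - 0)) := by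
        apply Continuous.tendsto; fun_prop
      rw [sub_zero] at this
      exact this.mono_left nhdsWithin_le_nhds
    · filter_upwards [self_mem_nhdsWithin] with ε hε
      have := mem_Ioi.1 hε
      exact ⟨mem_Iic.2 (by linarith), by simp; linarith⟩
  refine ⟨cR + cL, ((dR.comp e1).add (dL.comp e2)).congr' ?_⟩
  filter_upwards [self_mem_nhdsWithin] with ε hε
  have hε0 : 0 < ε := mem_Ioi.1 hε
  have key : μ.real (bl x0 ε) = ∫ x in (x0 - ε)..(x0 + ε), F x := by
    rw [hf.2 _ (bl_meas _ _), intervalIntegral.integral_of_le (by linarith),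
      integral_Ioc_eq_integral_Ioo, ← integral_indicator measurableSet_Ioo, mLeb,
      ← integral_indicator measurableSet_Icc]
    congr 1
    funext x
    have : x ∈ bl x0 ε ↔ x ∈ Ioo (x0 - ε) (x0 + ε) := by
      rw [mem_ofPred_eq, abs_lt, mem_Ioo]
      constructor <;> rintro ⟨h1, h2⟩ <;> constructor <;> linarith
    classical
    rw [hF]
    simp only [indicator, ind, this]
    grind
  rw [key]
  have hadd : ∫ x in (x0 - ε)..(x0 + ε), F x =
      (∫ x in x0..(x0 + ε), F x) - ∫ x in x0..(x0 - ε), F x := by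
    rw [intervalIntegral.integral_interval_sub_left hFi.intervalIntegrable hFi.intervalIntegrable]
  simp only [Function.comp, slope_def_field, intervalIntegral.integral_same, sub_zero]
  rw [hadd]
  have : x0 - ε - x0 = -ε := by ring
  rw [this, add_sub_cancel_left]
  field_simp
  ring

/-- A lower bound for Lebesgue measure of balls. -/
lemma mLeb_bl_ge {x0 : ℝ} (hx0 : x0 ∈ Icc (0:ℝ) 1) {ε : ℝ} (h0 : 0 < ε) (h1 : ε ≤ 1 / 2) :
    ε ≤ mLeb.real (bl x0 ε) := by
  have key : ∀ a : ℝ, Ioo a (a + ε) ⊆ bl x0 ε ∩ Icc 0 1 → ε ≤ mLeb.real (bl x0 ε) := by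
    intro a ha
    have : volume.real (Ioo a (a + ε)) ≤ mLeb.real (bl x0 ε) := by
      have h2 : mLeb (bl x0 ε) = volume (bl x0 ε ∩ Icc 0 1) := by
        unfold mLeb
        exact Measure.restrict_apply (bl_meas _ _)
      unfold Measure.real
      rw [h2]
      exact ENNReal.toReal_mono ((measure_mono inter_subset_right).trans_lt (by simp)).ne
        (measure_mono ha)
    rw [Measure.real, Real.volume_Ioo, add_sub_cancel_left, ENNReal.toReal_ofReal h0.le] at this
    exact this
  rcases le_total x0 (1 / 2) with h | h
  · apply key x0
    rintro x ⟨hx1, hx2⟩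
    exact ⟨show |x - x0| < ε from abs_lt.2 ⟨by linarith, by linarith⟩, by linarith [hx0.1], by linarith⟩
  · apply key (x0 - ε)
    rintro x ⟨hx1, hx2⟩
    exact ⟨show |x - x0| < ε from abs_lt.2 ⟨by linarith, by linarith⟩, by linarith, by linarith [hx0.2]⟩

/-! ### The Bernoulli measure and the law of large numbers -/

/-- The defining property of the Bernoulli measure. -/
def IsBern {m : ℕ} (p : Fin m → ℝ) (P : Measure (Om m)) : Prop :=
  ∀ (s : Finset ℤ) (f : ℤ → Fin m),
      P {ω | ∀ i ∈ s, ω i = f i} = ENNReal.ofReal (∏ i ∈ s, p (f i))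

section Bern

variable {m : ℕ} {p : Fin m → ℝ}

/-- The one-site marginal. -/
def mu0 (p : Fin m → ℝ) : Measure (Fin m) := ∑ i, ENNReal.ofReal (p i) • Measure.dirac i

lemma mu0_singleton (p : Fin m → ℝ) (a : Fin m) : mu0 p {a} = ENNReal.ofReal (p a) := by
  classical
  unfold mu0
  rw [Measure.finsetSum_apply]
  simp only [Measure.smul_apply, smul_eq_mul, MeasurableSet.singleton, Measure.dirac_apply']
  rw [Finset.sum_eq_single a]
  · simp
  · intro b _ hb
    simp [hb]
  · simp

lemma mu0_prob (hp : ∀ i, 0 < p i) (hp1 : ∑ i, p i = 1) : IsProbabilityMeasure (mu0 p) := by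
  constructor
  unfold mu0
  rw [Measure.finsetSum_apply]
  simp only [Measure.smul_apply, smul_eq_mul, measure_univ, mul_one]
  rw [← ENNReal.ofReal_sum_of_nonneg fun i _ => (hp i).le, hp1, ENNReal.ofReal_one]

lemma bern_eq (hp : ∀ i, 0 < p i) (hp1 : ∑ i, p i = 1) {P : Measure (Om m)} (hP : IsBern p P) :
    P = Measure.infinitePi (fun _ : ℤ => mu0 p) := by
  classical
  have := mu0_prob hp hp1
  refine ((Measure.isProjectiveLimit_infinitePi (fun _ : ℤ => mu0 p)).unique ?_).symm
  intro I
  apply Measure.ext_of_singleton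
  intro w
  have hm : Measurable (I.restrict : Om m → _) := Finset.measurable_restrict I
  rw [Measure.map_apply hm (MeasurableSet.singleton w), Measure.pi_singleton]
  have hne : Nonempty (Fin m) := by
    by_contra h
    rw [not_nonempty_iff] at h
    simp at hp1
  obtain ⟨a0⟩ := hne
  let f : ℤ → Fin m := fun i => if h : i ∈ I then w ⟨i, h⟩ else a0
  have h1 : (I.restrict ⁻¹' {w} : Set (Om m)) = {ω | ∀ i ∈ I, ω i = f i} := by
    ext ω
    simp only [mem_preimage, mem_singleton_iff, mem_ofPred_eq, funext_iff, Finset.restrict, f]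
    constructor
    · intro h i hi
      rw [dif_pos hi]; exact h ⟨i, hi⟩
    · rintro h ⟨i, hi⟩
      have := h i hi
      rwa [dif_pos hi] at this
  rw [h1, hP I f, ENNReal.ofReal_prod_of_nonneg fun i _ => (hp _).le]
  simp only [mu0_singleton]
  rw [← Finset.prod_coe_sort]
  refine Finset.prod_congr rfl fun i _ => ?_
  simp [f]

lemma shift_meas : Measurable (shift : Om m → Om m) := by
  unfold shift
  exact measurable_pi_lambda _ fun i => measurable_pi_apply _

lemma bern_shift (hp : ∀ i, 0 < p i) (hp1 : ∑ i, p i = 1) {P : Measure (Om m)}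
    (hP : IsBern p P) : MeasurePreserving shift P P := by
  refine ⟨shift_meas, ?_⟩
  have hP2 : IsBern p (P.map shift) := by
    intro s f
    have hms : MeasurableSet {ω : Om m | ∀ i ∈ s, ω i = f i} := by
      have : {ω : Om m | ∀ i ∈ s, ω i = f i} = ⋂ i ∈ s, {ω | ω i = f i} := by ext; simp
      rw [this]
      exact Finset.measurableSet_biInter s fun i _ =>
        measurableSet_eq_fun (measurable_pi_apply i) measurable_const
    rw [Measure.map_apply shift_meas hms]
    have h1 : (shift ⁻¹' {ω : Om m | ∀ i ∈ s, ω i = f i}) =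
        {ω | ∀ i ∈ s.map (addRightEmbedding (1:ℤ)), ω i = f (i - 1)} := by
      ext ω; simp [shift]
    rw [h1, hP]
    simp
  rw [bern_eq hp hp1 hP2, ← bern_eq hp hp1 hP]

lemma bern_shift_iter (hp : ∀ i, 0 < p i) (hp1 : ∑ i, p i = 1) {P : Measure (Om m)}
    (hP : IsBern p P) (n : ℕ) : MeasurePreserving (shift^[n]) P P :=
  (bern_shift hp hp1 hP).iterate n

/-- `F` depends only on the coordinates `0, …, L-1`. -/
def Cyl (L : ℕ) (F : Om m → ℝ) : Prop :=
  ∀ ω ω' : Om m, (∀ i : ℕ, i < L → ω i = ω' i) → F ω = F ω'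

/-- The window of coordinates `k, …, k+L-1`. -/
def wind (k L : ℕ) : Finset ℤ := Finset.Ico (k : ℤ) (k + L)

lemma cyl_factor {L : ℕ} {F : Om m → ℝ} (hF : Cyl L F) (k : ℕ) (ω0 : Om m) :
    ∃ φ : ((i : wind k L) → Fin m) → ℝ, ∀ ω : Om m,
      F (shift^[k] ω) = φ (fun i => ω i) := by
  classical
  refine ⟨fun w => F (shift^[k] (fun i => if h : i ∈ wind k L then w ⟨i, h⟩ else ω0 i)), ?_⟩
  intro ω
  apply hF
  intro i hi
  rw [shift_iter_apply, shift_iter_apply, dif_pos]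
  simp only [wind, Finset.mem_Ico]
  omega

lemma cyl_meas {L : ℕ} {F : Om m → ℝ} (hF : Cyl L F) : Measurable F := by
  rcases isEmpty_or_nonempty (Om m) with h | ⟨⟨ω0⟩⟩
  · exact measurable_of_empty F
  obtain ⟨φ, hφ⟩ := cyl_factor hF 0 ω0
  have : F = φ ∘ (fun ω (i : wind 0 L) => ω i) := by
    funext ω; exact hφ ω
  rw [this]
  exact (measurable_of_countable φ).comp
    (measurable_pi_lambda _ fun i => measurable_pi_apply _)

lemma cyl_bdd {L : ℕ} {F : Om m → ℝ} (hF : Cyl L F) : ∃ B, 0 ≤ B ∧ ∀ ω, |F ω| ≤ B := by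
  rcases isEmpty_or_nonempty (Om m) with h | ⟨⟨ω0⟩⟩
  · exact ⟨0, le_rfl, fun ω => (h.false ω).elim⟩
  obtain ⟨φ, hφ⟩ := cyl_factor hF 0 ω0
  refine ⟨∑ w, |φ w|, Finset.sum_nonneg fun _ _ => abs_nonneg _, fun ω => ?_⟩
  have := hφ ω
  simp only [Function.iterate_zero, id_eq] at this
  rw [this]
  exact Finset.single_le_sum (f := fun w => |φ w|) (fun _ _ => abs_nonneg _) (Finset.mem_univ _)

lemma cyl_int {L : ℕ} {F : Om m → ℝ} (hF : Cyl L F) (P : Measure (Om m)) [IsFiniteMeasure P] :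
    Integrable F P := by
  obtain ⟨B, -, hB⟩ := cyl_bdd hF
  exact Integrable.of_bound (cyl_meas hF).aestronglyMeasurable B (ae_of_all _ hB)

lemma coord_indep (hp : ∀ i, 0 < p i) (hp1 : ∑ i, p i = 1) {P : Measure (Om m)}
    (hP : IsBern p P) : ProbabilityTheory.iIndepFun (fun (i : ℤ) (ω : Om m) => ω i) P := by
  have := mu0_prob hp hp1
  rw [bern_eq hp hp1 hP]
  rw [ProbabilityTheory.iIndepFun_iff_map_fun_eq_infinitePi_map (fun i => measurable_pi_apply i)]
  have h2 : (fun (ω : Om m) (i : ℤ) => ω i) = id := rfl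
  rw [h2, Measure.map_id]
  congr 1
  funext i
  exact ((measurePreserving_eval_infinitePi (fun _ : ℤ => mu0 p) i).map_eq).symm

lemma cyl_indep (hp : ∀ i, 0 < p i) (hp1 : ∑ i, p i = 1) {P : Measure (Om m)}
    (hP : IsBern p P) {L : ℕ} {F : Om m → ℝ} (hF : Cyl L F) {k l : ℕ} (hkl : k + L ≤ l) (ω0 : Om m) :
    ProbabilityTheory.IndepFun (fun ω => F (shift^[k] ω)) (fun ω => F (shift^[l] ω)) P := by
  obtain ⟨φ, hφ⟩ := cyl_factor hF k ω0
  obtain ⟨ψ, hψ⟩ := cyl_factor hF l ω0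
  have hd : Disjoint (wind k L) (wind l L) := by
    rw [Finset.disjoint_left]
    intro a h1 h2
    simp only [wind, Finset.mem_Ico] at h1 h2
    omega
  have := (coord_indep hp hp1 hP).indepFun_finset (wind k L) (wind l L) hd
    (fun i => measurable_pi_apply i)
  have h2 := this.comp (measurable_of_countable φ) (measurable_of_countable ψ)
  convert h2 using 1
  · funext ω; exact hφ ω
  · funext ω; exact hψ ω

/-- `e` grows sublinearly. -/
def SubLin (e : ℕ → ℝ) : Prop := ∀ η : ℝ, 0 < η → ∃ D : ℝ, 0 ≤ D ∧ ∀ n : ℕ, |e n| ≤ η * n + D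

lemma sublin_of_tendsto {S : ℕ → ℝ} {a : ℝ} (h : Tendsto (fun n : ℕ => S n / n) atTop (𝓝 a)) :
    SubLin (fun n => S n - a * n) := by
  intro η hη
  obtain ⟨N, hN⟩ := (Metric.tendsto_atTop.1 h) η hη
  refine ⟨∑ k ∈ Finset.range (N + 1), |S k - a * k|, Finset.sum_nonneg fun _ _ => abs_nonneg _, ?_⟩
  intro n
  have hs : 0 ≤ ∑ k ∈ Finset.range (N + 1), |S k - a * k| :=
    Finset.sum_nonneg fun _ _ => abs_nonneg _
  by_cases hn : n ≤ N
  · have := Finset.single_le_sum (f := fun k : ℕ => |S k - a * k|) (fun _ _ => abs_nonneg _)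
      (Finset.mem_range.2 (Nat.lt_succ_of_le hn))
    have : 0 ≤ η * n := by positivity
    linarith
  · have hn0 : (0:ℝ) < n := by
      have : 0 < n := by omega
      exact_mod_cast this
    have := hN n (by omega)
    rw [Real.dist_eq] at this
    have e : S n - a * n = (S n / n - a) * n := by field_simp
    beta_reduce
    rw [e, abs_mul, abs_of_pos hn0]
    have := mul_le_mul_of_nonneg_right this.le hn0.le
    linarith

lemma sum_blocks (g : ℕ → ℝ) (L n : ℕ) :
    ∑ k ∈ Finset.range (L * n), g k
      = ∑ r ∈ Finset.range L, ∑ j ∈ Finset.range n, g (r + j * L) := by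
  induction n with
  | zero => simp
  | succ n ih =>
    rw [Nat.mul_succ, Finset.sum_range_add, ih, ← Finset.sum_add_distrib]
    refine Finset.sum_congr rfl fun r _ => ?_
    rw [Finset.sum_range_succ]
    congr 2
    ring

lemma sublin_blocks {g : ℕ → ℝ} {L : ℕ} (hL : 0 < L) {a B : ℝ} (hB : ∀ k, |g k| ≤ B)
    (h : ∀ r < L, SubLin (fun n => ∑ j ∈ Finset.range n, g (r + j * L) - a * n)) :
    SubLin (fun n => ∑ k ∈ Finset.range n, g k - a * n) := by
  intro η hη
  have h' : ∀ r, ∃ D, 0 ≤ D ∧ (r < L → ∀ n : ℕ,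
      |∑ j ∈ Finset.range n, g (r + j * L) - a * n| ≤ η * n + D) := by
    intro r
    by_cases hr : r < L
    · obtain ⟨D, h0, h1⟩ := h r hr η hη
      exact ⟨D, h0, fun _ => h1⟩
    · exact ⟨0, le_rfl, fun h => absurd h hr⟩
  choose D hD0 hD using h'
  have hB0 : 0 ≤ B := (abs_nonneg _).trans (hB 0)
  have hDs : 0 ≤ ∑ r ∈ Finset.range L, D r := Finset.sum_nonneg fun r _ => hD0 r
  refine ⟨∑ r ∈ Finset.range L, D r + L * (B + |a|), by positivity, ?_⟩
  intro N
  set n := N / L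
  set s := N % L
  have hN : N = L * n + s := (Nat.div_add_mod N L).symm
  have hs : s < L := Nat.mod_lt _ hL
  have e : ∑ k ∈ Finset.range N, g k - a * N =
      ∑ r ∈ Finset.range L, (∑ j ∈ Finset.range n, g (r + j * L) - a * n)
      + ∑ k ∈ Finset.range s, (g (L * n + k) - a) := by
    rw [hN, Finset.sum_range_add, sum_blocks]
    simp only [Finset.sum_sub_distrib, Finset.sum_const, Finset.card_range, nsmul_eq_mul]
    push_cast
    ring
  beta_reduce
  rw [e]
  refine (abs_add_le _ _).trans ?_
  have b1 : |∑ r ∈ Finset.range L, (∑ j ∈ Finset.range n, g (r + j * L) - a * n)| ≤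
      ∑ r ∈ Finset.range L, (η * n + D r) :=
    (Finset.abs_sum_le_sum_abs _ _).trans
      (Finset.sum_le_sum fun r hr => hD r (Finset.mem_range.1 hr) n)
  have b2 : |∑ k ∈ Finset.range s, (g (L * n + k) - a)| ≤ ∑ k ∈ Finset.range s, (B + |a|) :=
    (Finset.abs_sum_le_sum_abs _ _).trans
      (Finset.sum_le_sum fun k _ => (abs_sub _ _).trans (by linarith [hB (L * n + k)]))
  simp only [Finset.sum_add_distrib, Finset.sum_const, Finset.card_range, nsmul_eq_mul] at b1 b2
  have b3 : (s : ℝ) * (B + |a|) ≤ L * (B + |a|) := by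
    have : (s : ℝ) ≤ L := by exact_mod_cast hs.le
    gcongr
  have b4 : (L : ℝ) * (η * n) ≤ η * N := by
    have : ((L * n : ℕ) : ℝ) ≤ N := by exact_mod_cast (by omega)
    push_cast at this
    nlinarith
  rw [mul_add] at b3
  linarith

/-- The law of large numbers for cylinder functions. -/
lemma slln (hp : ∀ i, 0 < p i) (hp1 : ∑ i, p i = 1) {P : Measure (Om m)} [IsProbabilityMeasure P]
    (hP : IsBern p P) {L : ℕ} {F : Om m → ℝ} (hF : Cyl L F) :
    ∀ᵐ ω ∂P, SubLin (fun n => ∑ k ∈ Finset.range n, F (shift^[k] ω) - (∫ ω, F ω ∂P) * n) := by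
  have hne : Nonempty (Om m) := P.nonempty_of_neZero
  obtain ⟨ω0⟩ := hne
  have hF' : Cyl (L + 1) F := fun ω ω' h => hF ω ω' fun i hi => h i (by omega)
  have key : ∀ r : ℕ, ∀ᵐ ω ∂P, SubLin (fun n => ∑ j ∈ Finset.range n,
      F (shift^[r + j * (L + 1)] ω) - (∫ ω, F ω ∂P) * n) := by
    intro r
    have hmp := bern_shift_iter hp hp1 hP
    have h1 := ProbabilityTheory.strong_law_ae_real (μ := P)
      (fun j ω => F (shift^[r + j * (L + 1)] ω)) ?_ ?_ ?_
    · have h2 : ∫ ω, F (shift^[r + 0 * (L + 1)] ω) ∂P = ∫ ω, F ω ∂P := by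
        have h4 : AEStronglyMeasurable F (P.map (shift^[r + 0 * (L + 1)])) :=
          (cyl_meas hF).aestronglyMeasurable
        have h3 := integral_map (μ := P) (hmp (r + 0 * (L + 1))).measurable.aemeasurable h4
        rw [(hmp _).map_eq] at h3
        exact h3.symm
      simp only [h2] at h1
      filter_upwards [h1] with ω hω
      exact sublin_of_tendsto hω
    · exact (hmp _).integrable_comp_of_integrable (cyl_int hF P)
    · intro i j hij
      rcases lt_or_gt_of_ne hij with h | h
      · refine cyl_indep hp hp1 hP hF' ?_ ω0
        have : (i + 1) * (L + 1) ≤ j * (L + 1) := Nat.mul_le_mul_right _ h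
        linarith
      · refine (cyl_indep hp hp1 hP hF' ?_ ω0).symm
        have : (j + 1) * (L + 1) ≤ i * (L + 1) := Nat.mul_le_mul_right _ h
        linarith
    · intro i
      have hm := cyl_meas hF
      refine ⟨(hm.comp (hmp _).measurable).aemeasurable, (hm.comp (hmp _).measurable).aemeasurable, ?_⟩
      have h3 : ∀ k, P.map (fun ω => F (shift^[k] ω)) = P.map F := by
        intro k
        have := Measure.map_map (μ := P) hm (hmp k).measurable
        rw [(hmp k).map_eq] at this
        exact this.symm
      rw [h3, h3]
  obtain ⟨B, -, hB⟩ := cyl_bdd hF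
  filter_upwards [ae_all_iff.2 key] with ω hω
  exact sublin_blocks (L := L + 1) (by omega) (fun k => hB _) (fun r _ => hω r)

end Bern

/-! ### The quenched family and the annealed measure -/

/-- The equivariant family. -/
structure Fam {m : ℕ} (Pop : Fin m → (ℝ → ℝ) → ℝ → ℝ) (h : Om m → ℝ → ℝ)
    (ν : Om m → Measure ℝ) : Prop where
  bv : ∀ ω, IsBV (h ω)
  equi : ∀ ω : Om m, Pop (ω 0) (h ω) =ᵐ[mLeb] h (shift ω)
  probd : ∀ ω, (∀ᵐ x ∂mLeb, 0 ≤ h ω x) ∧ ∫ x, h ω x ∂mLeb = 1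
  eq : ∀ ω, ν ω = mLeb.withDensity (fun x => ENNReal.ofReal (h ω x))

section Fam

variable {m : ℕ} {T : Fin m → ℝ → ℝ} {Pop : Fin m → (ℝ → ℝ) → ℝ → ℝ} {C θ M cmin : ℝ}
  {h : Om m → ℝ → ℝ} {ν : Om m → Measure ℝ}

lemma fam_prob (F : Fam Pop h ν) (ω : Om m) : IsProbabilityMeasure (ν ω) := by
  constructor
  rw [F.eq, withDensity_apply _ MeasurableSet.univ, Measure.restrict_univ,
    ← ofReal_integral_eq_lintegral_ofReal (F.bv ω).1 (F.probd ω).1, (F.probd ω).2, ENNReal.ofReal_one]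

lemma fam_dens (F : Fam Pop h ν) (ω : Om m) : HasDens (ν ω) (h ω) := by
  refine ⟨F.bv ω, fun B hB => ?_⟩
  have e : (fun x => ind B x * h ω x) = B.indicator (h ω) := by
    classical
    funext x
    by_cases hx : x ∈ B <;> simp [ind, hx]
  rw [e, integral_indicator hB, Measure.real, F.eq, withDensity_apply _ hB,
    integral_eq_lintegral_of_nonneg_ae (ae_restrict_of_ae (F.probd ω).1)
      (F.bv ω).1.aestronglyMeasurable.restrict]

lemma fam_step (H : Hyp T Pop C θ M cmin) (F : Fam Pop h ν) (ω : Om m) :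
    ν (shift ω) = (ν ω).map (T (ω 0)) := by
  have h1 := fam_prob F ω
  have h2 := fam_prob F (shift ω)
  have h3 : IsProbabilityMeasure ((ν ω).map (T (ω 0))) :=
    Measure.isProbabilityMeasure_map (H.meas _).aemeasurable
  ext B hB
  have hB' : MeasurableSet (T (ω 0) ⁻¹' B) := H.meas _ hB
  rw [Measure.map_apply (H.meas _) hB]
  rw [← ENNReal.toReal_eq_toReal_iff' (measure_ne_top _ _) (measure_ne_top _ _)]
  change (ν (shift ω)).real B = (ν ω).real _
  rw [(fam_dens F (shift ω)).2 B hB, (fam_dens F ω).2 _ hB']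
  have h4 := H.dual (ω 0) (h ω) (F.bv ω) (ind B) (ind_meas hB) ⟨1, ind_abs B⟩
  simp only [ind_preimage] at h4
  rw [h4]
  apply integral_congr_ae
  filter_upwards [F.equi ω] with x hx
  rw [hx]

lemma fam_iter (H : Hyp T Pop C θ M cmin) (F : Fam Pop h ν) (ω : Om m) (n : ℕ) :
    ν (shift^[n] ω) = (ν ω).map (randComp T ω n) := by
  induction n with
  | zero => simp [randComp]
  | succ n ih =>
    rw [Function.iterate_succ_apply', fam_step H F, ih, shift_iter_apply,
      Measure.map_map (H.meas _) (randComp_meas H.meas ω n)]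
    simp only [zero_add]
    rfl

lemma fam_orb (H : Hyp T Pop C θ M cmin) (F : Fam Pop h ν) (ω : Om m) :
    ∃ f, Orb T ω (fun j => ν (shift^[j] ω)) f (K0 C θ M + C * (BVnorm (h ω) + 1)) := by
  have hp := fam_prob F ω
  have := fun n => hasDens_map H (fam_dens F ω) ω n
  choose f hf1 hf2 using this
  refine ⟨f, fun j => fam_prob F _, fun j => ?_, hf2, fun j i => ?_⟩
  · rw [fam_iter H F]; exact hf1 j
  · rw [← fam_iter H F, ← Function.iterate_add_apply, add_comm]

/-- The image of Lebesgue measure. -/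
def GG (T : Fin m → ℝ → ℝ) (L : ℕ) (ω : Om m) (B : Set ℝ) : ℝ := mLeb.real (randComp T ω L ⁻¹' B)

lemma GG_cyl (T : Fin m → ℝ → ℝ) (L : ℕ) (B : Set ℝ) : Cyl L (fun ω => GG T L ω B) := by
  intro ω ω' hh
  simp only [GG, randComp_congr T ω ω' L hh]

lemma GG_bd (T : Fin m → ℝ → ℝ) (L : ℕ) (ω : Om m) (B : Set ℝ) : 0 ≤ GG T L ω B ∧ GG T L ω B ≤ 1 :=
  ⟨measureReal_nonneg, measureReal_le_one⟩

lemma GG_comp (H : Hyp T Pop C θ M cmin) (k L : ℕ) (ω : Om m) {B : Set ℝ} (hB : MeasurableSet B) :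
    |GG T (k + L) ω B - GG T L (shift^[k] ω) B| ≤ C * θ ^ L * (K0 C θ M + 1) * mLeb.real B := by
  obtain ⟨R, hR, hRb⟩ := hasDens_one H k ω
  have hm : IsProbabilityMeasure (mLeb.map (randComp T ω k)) :=
    Measure.isProbabilityMeasure_map (randComp_meas H.meas ω k).aemeasurable
  have := dens_vs_leb H hR (shift^[k] ω) L hB
  rw [map_real H _ _ _ (randComp_meas H.meas _ _ hB)] at this
  have e : randComp T ω k ⁻¹' (randComp T (shift^[k] ω) L ⁻¹' B) = randComp T ω (k + L) ⁻¹' B := by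
    ext x; simp only [mem_preimage, randComp_add]
  rw [e] at this
  refine this.trans ?_
  have h5 : 0 ≤ C * θ ^ L := mul_nonneg (by linarith [H.hC]) (pow_nonneg H.hθ0.le _)
  gcongr

lemma GG_ge (H : Hyp T Pop C θ M cmin) {k : ℕ} (hk : 1 ≤ k) (ω : Om m) {B : Set ℝ}
    (hB : MeasurableSet B) : cmin * mLeb.real B ≤ GG T k ω B := by
  have h1 := Pcomp_dual H ω k (IsBV.const 1) (ind B) (ind_meas hB) ⟨1, ind_abs B⟩
  simp only [mul_one, ind_preimage] at h1
  rw [integral_ind (randComp_meas H.meas ω k hB)] at h1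
  unfold GG
  rw [h1, ← integral_ind hB, ← integral_const_mul]
  have hb := Pcomp_BV H ω k (IsBV.const 1)
  apply integral_mono_ae
  · have := integrable_ind_mul hB (integrable_const cmin (μ := mLeb))
    simpa [mul_comm] using this
  · exact integrable_ind_mul hB hb.1
  · filter_upwards [ae_mLeb_mem] with y hy
    rw [mul_comm]
    exact mul_le_mul_of_nonneg_left (H.min k hk ω y hy) (ind_nonneg B y)

variable {p : Fin m → ℝ} {P : Measure (Om m)} {νa : Measure ℝ}

lemma fam_aem [IsProbabilityMeasure P] (F : Fam Pop h ν)
    (hνa : ∀ A : Set ℝ, MeasurableSet A → νa A = ∫⁻ ω, ν ω A ∂P) {B : Set ℝ}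
    (hB : MeasurableSet B) : AEMeasurable (fun ω => ν ω B) P := by
  have hpr := fam_prob F
  obtain ⟨φ, hφm, hφle, hφ⟩ := exists_measurable_le_lintegral_eq P (fun ω => ν ω B)
  obtain ⟨ψ, hψm, hψle, hψ⟩ := exists_measurable_le_lintegral_eq P (fun ω => ν ω Bᶜ)
  have hsum : ∀ ω, ν ω B + ν ω Bᶜ = 1 := fun ω => prob_add_prob_compl hB
  have hle : ∀ ω, φ ω + ψ ω ≤ 1 := fun ω => (add_le_add (hφle ω) (hψle ω)).trans (hsum ω).le
  have hu : νa univ = 1 := by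
    rw [hνa _ MeasurableSet.univ]; simp
  have hint : ∫⁻ ω, (φ ω + ψ ω) ∂P = 1 := by
    rw [lintegral_add_left hφm, ← hφ, ← hψ, ← hνa B hB, ← hνa _ hB.compl,
      measure_add_measure_compl hB, hu]
  have hae : (fun ω => φ ω + ψ ω) =ᵐ[P] fun _ => 1 := by
    apply ae_eq_of_ae_le_of_lintegral_le (ae_of_all _ hle) (by rw [hint]; simp)
      aemeasurable_const
    rw [hint]; simp
  refine ⟨φ, hφm, ?_⟩
  filter_upwards [hae] with ω hω
  apply le_antisymm _ (hφle ω)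
  have h1 : ν ω B + ν ω Bᶜ ≤ φ ω + ν ω Bᶜ := by
    rw [hsum ω, ← hω]
    exact add_le_add le_rfl (hψle ω)
  exact (ENNReal.add_le_add_iff_right (measure_ne_top _ _)).1 h1

lemma nua_eq [IsProbabilityMeasure P] (F : Fam Pop h ν) (hp : ∀ i, 0 < p i) (hp1 : ∑ i, p i = 1)
    (hP : IsBern p P)
    (hνa : ∀ A : Set ℝ, MeasurableSet A → νa A = ∫⁻ ω, ν ω A ∂P) {B : Set ℝ}
    (hB : MeasurableSet B) (k : ℕ) :
    Integrable (fun ω => (ν (shift^[k] ω)).real B) P ∧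
    ∫ ω, (ν (shift^[k] ω)).real B ∂P = νa.real B := by
  have hpr := fam_prob F
  have hmp := bern_shift_iter hp hp1 hP k
  have hm := fam_aem F hνa hB
  have hm2 : AEStronglyMeasurable (fun ω => (ν ω).real B) P := hm.ennreal_toReal.aestronglyMeasurable
  have hi : Integrable (fun ω => (ν ω).real B) P :=
    Integrable.of_bound hm2 1 (ae_of_all _ fun ω => by
      rw [Real.norm_of_nonneg measureReal_nonneg]; exact measureReal_le_one)
  refine ⟨hmp.integrable_comp_of_integrable hi, ?_⟩
  have h3 := integral_map (μ := P) (φ := shift^[k]) (f := fun ω => (ν ω).real B)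
    hmp.measurable.aemeasurable (by rw [hmp.map_eq]; exact hm2)
  rw [hmp.map_eq] at h3
  rw [← h3, Measure.real, hνa B hB]
  exact integral_toReal hm (ae_of_all _ fun ω => measure_lt_top _ _)

lemma GG_tendsto [IsProbabilityMeasure P] (H : Hyp T Pop C θ M cmin) (F : Fam Pop h ν)
    (hp : ∀ i, 0 < p i) (hp1 : ∑ i, p i = 1) (hP : IsBern p P)
    (hνa : ∀ A : Set ℝ, MeasurableSet A → νa A = ∫⁻ ω, ν ω A ∂P) {B : Set ℝ}
    (hB : MeasurableSet B) :
    Tendsto (fun k => ∫ ω, GG T k ω B ∂P) atTop (𝓝 (νa.real B)) := by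
  have hpr := fam_prob F
  have h1 : Tendsto (fun k => ∫ ω, ((ν (shift^[k] ω)).real B - GG T k ω B) ∂P) atTop
      (𝓝 (∫ _, (0:ℝ) ∂P)) := by
    apply tendsto_integral_of_dominated_convergence (fun _ => (2:ℝ))
    · intro k
      exact ((nua_eq F hp hp1 hP hνa hB k).1.sub (cyl_int (GG_cyl T k B) P)).aestronglyMeasurable
    · exact integrable_const _
    · intro k
      refine ae_of_all _ fun ω => ?_
      rw [Real.norm_eq_abs]
      have h2 := GG_bd T k ω B
      have h3 : 0 ≤ (ν (shift^[k] ω)).real B := measureReal_nonneg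
      have h4 : (ν (shift^[k] ω)).real B ≤ 1 := measureReal_le_one
      rw [abs_le]; constructor <;> linarith [h2.1, h2.2]
    · refine ae_of_all _ fun ω => ?_
      apply squeeze_zero_norm (a := fun k => C * θ ^ k * (BVnorm (h ω) + 1) * mLeb.real B)
      · intro k
        have := dens_vs_leb H (fam_dens F ω) ω k hB
        rw [← map_real H _ _ _ hB, ← fam_iter H F] at this
        exact this
      · have := (((tendsto_pow_atTop_nhds_zero_of_lt_one H.hθ0.le H.hθ1).const_mul C).mul_const
          (BVnorm (h ω) + 1)).mul_const (mLeb.real B)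
        simpa using this
  have h2 : ∀ k, ∫ ω, ((ν (shift^[k] ω)).real B - GG T k ω B) ∂P =
      νa.real B - ∫ ω, GG T k ω B ∂P := by
    intro k
    rw [integral_sub (nua_eq F hp hp1 hP hνa hB k).1 (cyl_int (GG_cyl T k B) P),
      (nua_eq F hp hp1 hP hνa hB k).2]
  simp_rw [h2] at h1
  have := (tendsto_const_nhds (x := νa.real B)).sub h1
  simpa using this

lemma nua_GG [IsProbabilityMeasure P] (H : Hyp T Pop C θ M cmin) (F : Fam Pop h ν)
    (hp : ∀ i, 0 < p i) (hp1 : ∑ i, p i = 1) (hP : IsBern p P)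
    (hνa : ∀ A : Set ℝ, MeasurableSet A → νa A = ∫⁻ ω, ν ω A ∂P) {B : Set ℝ}
    (hB : MeasurableSet B) (L : ℕ) :
    |νa.real B - ∫ ω, GG T L ω B ∂P| ≤ C * θ ^ L * (K0 C θ M + 1) * mLeb.real B := by
  have h1 := (tendsto_add_atTop_iff_nat L).2 (GG_tendsto H F hp hp1 hP hνa hB)
  refine le_of_tendsto (h1.sub_const (∫ ω, GG T L ω B ∂P)).abs (Eventually.of_forall fun k => ?_)
  have hmp := bern_shift_iter hp hp1 hP k
  have hi := cyl_int (GG_cyl T L B) P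
  have h3 := integral_map (μ := P) (φ := shift^[k]) (f := fun ω => GG T L ω B)
    hmp.measurable.aemeasurable (by rw [hmp.map_eq]; exact hi.aestronglyMeasurable)
  rw [hmp.map_eq] at h3
  have hi2 : Integrable (fun ω => GG T L (shift^[k] ω) B) P := hmp.integrable_comp_of_integrable hi
  rw [h3, ← integral_sub (cyl_int (GG_cyl T (k + L) B) P) hi2]
  have := norm_integral_le_of_norm_le_const (μ := P)
    (f := fun ω => GG T (k + L) ω B - GG T L (shift^[k] ω) B)
    (ae_of_all _ fun ω => GG_comp H k L ω hB)
  simpa using this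

lemma lim_exch {l : Filter ℝ} [NeBot l] {φ : ℝ → ℝ} {φL : ℕ → ℝ → ℝ} {bL E : ℕ → ℝ}
    (h : ∀ L, ∀ᶠ ε in l, |φ ε - φL L ε| ≤ E L) (hE : Tendsto E atTop (𝓝 0))
    (hb : ∀ L, Tendsto (φL L) l (𝓝 (bL L))) :
    ∃ b, Tendsto φ l (𝓝 b) ∧ ∀ L, |b - bL L| ≤ E L := by
  have hc : Cauchy (map φ l) := by
    rw [Metric.cauchy_iff]
    refine ⟨inferInstance, fun η hη => ?_⟩
    obtain ⟨L, hL⟩ := ((hE.eventually_lt_const (show 0 < η / 4 by linarith))).exists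
    refine ⟨Metric.ball (bL L) (η / 2), ?_, ?_⟩
    · rw [mem_map]
      filter_upwards [h L, (Metric.tendsto_nhds.1 (hb L)) (η / 4) (by linarith)] with ε h1 h2
      rw [mem_preimage, Metric.mem_ball]
      have := dist_triangle (φ ε) (φL L ε) (bL L)
      rw [Real.dist_eq (φ ε) (φL L ε)] at this
      linarith
    · intro x hx y hy
      rw [Metric.mem_ball] at hx hy
      have := dist_triangle_right x y (bL L)
      linarith
  obtain ⟨b, hb'⟩ := CompleteSpace.complete hc
  refine ⟨b, hb', fun L => ?_⟩
  have hb'' : Tendsto φ l (𝓝 b) := hb'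
  exact le_of_tendsto (hb''.sub (hb L)).abs (h L)

/-- Existence of the local density of the annealed measure, with approximations. -/
lemma exists_b [IsProbabilityMeasure P] (H : Hyp T Pop C θ M cmin) (F : Fam Pop h ν)
    (hcm : 0 < cmin)
    (hp : ∀ i, 0 < p i) (hp1 : ∑ i, p i = 1) (hP : IsBern p P)
    (hνa : ∀ A : Set ℝ, MeasurableSet A → νa A = ∫⁻ ω, ν ω A ∂P) {x0 : ℝ}
    (hx0 : x0 ∈ Icc (0:ℝ) 1) :
    ∃ (b : ℝ) (c : ℕ → Om m → ℝ), 0 < b ∧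
      Tendsto (fun ε : ℝ => νa.real (bl x0 ε) / ε) (𝓝[>] (0 : ℝ)) (𝓝 b) ∧
      (∀ L ω, Tendsto (fun ε : ℝ => GG T L ω (bl x0 ε) / ε) (𝓝[>] (0 : ℝ)) (𝓝 (c L ω))) ∧
      (∀ L, Cyl L (c L)) ∧
      ∀ L, |b - ∫ ω, c L ω ∂P| ≤ C * θ ^ L * (K0 C θ M + 1) * 2 := by
  have hex : ∀ L ω, ∃ cl, Tendsto (fun ε : ℝ => GG T L ω (bl x0 ε) / ε) (𝓝[>] (0 : ℝ)) (𝓝 cl) := by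
    intro L ω
    obtain ⟨R, hR, -⟩ := hasDens_one H L ω
    obtain ⟨cl, hcl⟩ := local_dens hR hx0
    refine ⟨cl, hcl.congr fun ε => ?_⟩
    rw [map_real H _ _ _ (bl_meas _ _), GG]
  choose c hc using hex
  have hcyl : ∀ L, Cyl L (c L) := by
    intro L ω ω' hh
    refine tendsto_nhds_unique (hc L ω) ((hc L ω').congr fun ε => ?_)
    have := GG_cyl T L (bl x0 ε) ω ω' hh
    beta_reduce at this
    rw [this]
  have hK := K0_ge_one H
  have hC := H.hC
  have hbL : ∀ L, Tendsto (fun ε : ℝ => (∫ ω, GG T L ω (bl x0 ε) ∂P) / ε) (𝓝[>] (0:ℝ))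
      (𝓝 (∫ ω, c L ω ∂P)) := by
    intro L
    simp_rw [← integral_div]
    apply tendsto_integral_filter_of_dominated_convergence (fun _ => K0 C θ M * 2)
    · exact Eventually.of_forall fun ε =>
        ((cyl_meas (GG_cyl T L (bl x0 ε))).div_const ε).aestronglyMeasurable
    · filter_upwards [self_mem_nhdsWithin] with ε hε
      have hε0 : 0 < ε := mem_Ioi.1 hε
      refine ae_of_all _ fun ω => ?_
      obtain ⟨R, hR, hRb⟩ := hasDens_one H L ω
      have h1 := hR.real_le (bl_meas x0 ε)
      rw [map_real H _ _ _ (bl_meas _ _)] at h1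
      have h2 := mLeb_bl_le x0 hε0.le
      have h3 : GG T L ω (bl x0 ε) ≤ K0 C θ M * (2 * ε) := by
        refine h1.trans ?_
        have := BVnorm_nonneg R
        gcongr
      rw [Real.norm_of_nonneg (div_nonneg (GG_bd T L ω _).1 hε0.le), div_le_iff₀ hε0]
      linarith
    · exact integrable_const _
    · exact ae_of_all _ fun ω => hc L ω
  obtain ⟨b, hb1, hb2⟩ := lim_exch (l := 𝓝[>] (0:ℝ))
    (φ := fun ε : ℝ => νa.real (bl x0 ε) / ε)
    (φL := fun L ε => (∫ ω, GG T L ω (bl x0 ε) ∂P) / ε)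
    (E := fun L => C * θ ^ L * (K0 C θ M + 1) * 2) (bL := fun L => ∫ ω, c L ω ∂P)
    (by
      intro L
      filter_upwards [self_mem_nhdsWithin] with ε hε
      have hε0 : 0 < ε := mem_Ioi.1 hε
      rw [← sub_div, abs_div, abs_of_pos hε0, div_le_iff₀ hε0]
      refine (nua_GG H F hp hp1 hP hνa (bl_meas x0 ε) L).trans ?_
      have h2 := mLeb_bl_le x0 hε0.le
      have h5 : 0 ≤ C * θ ^ L := mul_nonneg (by linarith [H.hC]) (pow_nonneg H.hθ0.le _)
      rw [mul_assoc (C * θ ^ L * (K0 C θ M + 1)) 2 ε]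
      gcongr)
    (by
      have := (((tendsto_pow_atTop_nhds_zero_of_lt_one H.hθ0.le H.hθ1).const_mul C).mul_const
          (K0 C θ M + 1)).mul_const 2
      simpa using this)
    hbL
  refine ⟨b, c, ?_, hb1, hc, hcyl, hb2⟩
  refine hcm.trans_le (ge_of_tendsto hb1 ?_)
  filter_upwards [Ioc_mem_nhdsGT (show (0:ℝ) < 1 / 2 by norm_num)] with ε hε
  rw [le_div_iff₀ hε.1]
  have h1 : cmin * mLeb.real (bl x0 ε) ≤ νa.real (bl x0 ε) := by
    refine ge_of_tendsto (GG_tendsto H F hp hp1 hP hνa (bl_meas x0 ε)) ?_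
    filter_upwards [eventually_ge_atTop 1] with k hk
    have := integral_mono (integrable_const (μ := P) (cmin * mLeb.real (bl x0 ε)))
      (cyl_int (GG_cyl T k (bl x0 ε)) P) (fun ω => GG_ge H hk ω (bl_meas x0 ε))
    simpa using this
  refine le_trans ?_ h1
  have := mLeb_bl_ge hx0 hε.1 hε.2
  gcongr

/-- Uniformity over cylinder-determined predicates. -/
lemma cyl_ev {ι : Type*} {l : Filter ι} {L : ℕ} {Q : ι → Om m → Prop}
    (hQ : ∀ n (ω ω' : Om m), (∀ i : ℕ, i < L → ω i = ω' i) → Q n ω → Q n ω')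
    (hev : ∀ ω, ∀ᶠ n in l, Q n ω) : ∀ᶠ n in l, ∀ ω, Q n ω := by
  classical
  rcases isEmpty_or_nonempty (Om m) with he | ⟨⟨ω0⟩⟩
  · exact Eventually.of_forall fun n ω => (he.false ω).elim
  let rep : (Fin L → Fin m) → Om m := fun w i =>
    if hh : 0 ≤ i ∧ i.toNat < L then w ⟨i.toNat, hh.2⟩ else ω0 i
  have h1 : ∀ᶠ n in l, ∀ w, Q n (rep w) := eventually_all.2 fun w => hev _
  filter_upwards [h1] with n hn ω
  refine hQ n _ ω ?_ (hn fun i => ω (i : ℕ))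
  intro i hi
  simp [rep, hi]

end Fam

/-! ### Assembly -/

lemma lim_exch2 {ι : Type*} {l : Filter ι} {φ : ι → ℝ} {φL : ℕ → ι → ℝ} {bL E : ℕ → ℝ} {b : ℝ}
    (h : ∀ L, ∀ᶠ n in l, |φ n - φL L n| ≤ E L) (hE : Tendsto E atTop (𝓝 0))
    (hb : ∀ L, Tendsto (φL L) l (𝓝 (bL L))) (hbb : Tendsto bL atTop (𝓝 b)) :
    Tendsto φ l (𝓝 b) := by
  rw [Metric.tendsto_nhds]
  intro η hη
  obtain ⟨L, hL, hL2⟩ := ((hE.eventually_lt_const (show 0 < η / 3 by linarith)).and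
    ((Metric.tendsto_nhds.1 hbb) (η / 3) (by linarith))).exists
  filter_upwards [h L, (Metric.tendsto_nhds.1 (hb L)) (η / 3) (by linarith)] with n h1 h2
  have h3 := dist_triangle (φ n) (φL L n) b
  have h4 := dist_triangle (φL L n) (bL L) b
  rw [Real.dist_eq (φ n) (φL L n)] at h3
  linarith

lemma sublin_div {e : ℕ → ℝ} (he : SubLin e) {k : ℕ → ℕ} {B D0 : ℝ} (hB : 0 ≤ B) (hD0 : 0 ≤ D0)
    (hk : ∀ n, (k n : ℝ) ≤ B * n + D0) : Tendsto (fun n : ℕ => e (k n) / n) atTop (𝓝 0) := by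
  rw [Metric.tendsto_nhds]
  intro η hη
  obtain ⟨D, hD, h1⟩ := he (η / (2 * (B + 1))) (by positivity)
  have h2 : Tendsto (fun n : ℕ => (η / (2 * (B + 1)) * D0 + D) / (n : ℝ)) atTop (𝓝 0) :=
    tendsto_natCast_atTop_atTop.const_div_atTop _
  filter_upwards [h2.eventually_lt_const (show 0 < η / 2 by linarith), eventually_gt_atTop 0]
    with n hn hn0
  have hn1 : (0:ℝ) < n := by exact_mod_cast hn0
  rw [Real.dist_eq, sub_zero, abs_div, abs_of_pos hn1, div_lt_iff₀ hn1]
  rw [div_lt_iff₀ hn1] at hn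
  refine (h1 (k n)).trans_lt ?_
  have h3 : η / (2 * (B + 1)) * (k n) ≤ η / (2 * (B + 1)) * (B * n + D0) := by
    have := hk n
    gcongr
  have h4 : η / (2 * (B + 1)) * B ≤ η / 2 := by
    rw [div_mul_eq_mul_div, div_le_div_iff₀ (by positivity) (by norm_num)]
    nlinarith
  have h5 := mul_le_mul_of_nonneg_right h4 hn1.le
  nlinarith

lemma window_sum {g : ℕ → ℝ} {a s τ : ℝ}
    (hg : SubLin (fun n => ∑ k ∈ Finset.range n, g k - a * n)) (hs : 0 ≤ s) (hτ : 0 ≤ τ) :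
    Tendsto (fun n : ℕ => (∑ i ∈ Finset.range ⌊(n:ℝ) * τ⌋₊, g (⌊(n:ℝ) * s⌋₊ + 1 + i)) / n) atTop
      (𝓝 (a * τ)) := by
  have f1 : ∀ n : ℕ, (⌊(n:ℝ) * s⌋₊ : ℝ) ≤ n * s := fun n => Nat.floor_le (by positivity)
  have f2 : ∀ n : ℕ, (⌊(n:ℝ) * τ⌋₊ : ℝ) ≤ n * τ := fun n => Nat.floor_le (by positivity)
  have h1 := sublin_div hg (k := fun n => ⌊(n:ℝ) * s⌋₊ + 1) (B := s) (D0 := 1) hs zero_le_one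
    (fun n => by push_cast; linarith [f1 n])
  have h2 := sublin_div hg (k := fun n => ⌊(n:ℝ) * s⌋₊ + 1 + ⌊(n:ℝ) * τ⌋₊) (B := s + τ) (D0 := 1)
    (by positivity) zero_le_one (fun n => by push_cast; linarith [f1 n, f2 n])
  have h3 : Tendsto (fun n : ℕ => (⌊(n:ℝ) * τ⌋₊ : ℝ) / n) atTop (𝓝 τ) := by
    have := (tendsto_nat_floor_mul_div_atTop (R := ℝ) hτ).comp (tendsto_natCast_atTop_atTop (R := ℝ))
    refine this.congr fun n => ?_
    simp only [Function.comp, mul_comm]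
  have h4 := (h3.const_mul a).add (h2.sub h1)
  simp only [sub_zero, add_zero] at h4
  refine h4.congr fun n => ?_
  rw [Finset.sum_range_add]
  push_cast
  ring

lemma sum_shift_le {a : ℕ → ℝ} {κ : ℝ} (h0 : ∀ i, 0 ≤ a i) (h1 : ∀ i, a i ≤ κ) (N L : ℕ) :
    |∑ i ∈ Finset.range N, a i - ∑ i ∈ Finset.range N, a (L + i)| ≤ L * κ := by
  have e1 := Finset.sum_range_add a N L
  have e2 := Finset.sum_range_add a L N
  rw [add_comm L N] at e2
  have b : ∀ k : ℕ, 0 ≤ ∑ i ∈ Finset.range L, a (k + i) ∧ ∑ i ∈ Finset.range L, a (k + i) ≤ L * κ := by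
    intro k
    refine ⟨Finset.sum_nonneg fun i _ => h0 _, ?_⟩
    refine (Finset.sum_le_card_nsmul _ _ κ fun i _ => h1 _).trans ?_
    simp
  have b1 := b N
  have b2 := b 0
  simp only [zero_add] at b2
  rw [abs_le]
  constructor <;> linarith [b1.1, b1.2, b2.1, b2.2]

lemma sqrt_tendsto : Tendsto Nat.sqrt atTop atTop := by
  rw [tendsto_atTop]
  intro k
  filter_upwards [eventually_ge_atTop (k * k)] with n hn
  exact Nat.le_sqrt.2 hn

lemma err1_tendsto {θ : ℝ} (h0 : 0 < θ) (h1 : θ < 1) :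
    Tendsto (fun n : ℕ => (n : ℝ) * θ ^ (Nat.sqrt n)) atTop (𝓝 0) := by
  have h2 := ((tendsto_pow_const_mul_const_pow_of_abs_lt_one 2
    (show |θ| < 1 by rwa [abs_of_pos h0])).const_mul 3).comp sqrt_tendsto
  rw [mul_zero] at h2
  refine squeeze_zero' (Eventually.of_forall fun n => by positivity) ?_ h2
  filter_upwards [eventually_ge_atTop 1] with n hn
  simp only [Function.comp]
  have h3 := Nat.sqrt_le_add n
  have h4 : 1 ≤ Nat.sqrt n := Nat.le_sqrt.2 (by simpa using hn)
  have h5 : n ≤ 3 * (Nat.sqrt n) ^ 2 := by nlinarith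
  have h6 : (n : ℝ) ≤ 3 * (Nat.sqrt n : ℝ) ^ 2 := by exact_mod_cast h5
  rw [← mul_assoc]
  gcongr

lemma err2_tendsto : Tendsto (fun n : ℕ => (Nat.sqrt n : ℝ) / n) atTop (𝓝 0) := by
  have h2 : Tendsto (fun n : ℕ => (1:ℝ) / (Nat.sqrt n : ℝ)) atTop (𝓝 0) :=
    (tendsto_natCast_atTop_atTop.comp sqrt_tendsto).const_div_atTop 1
  refine squeeze_zero' (Eventually.of_forall fun n => by positivity) ?_ h2
  filter_upwards [eventually_ge_atTop 1] with n hn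
  have h4 : 1 ≤ Nat.sqrt n := Nat.le_sqrt.2 (by simpa using hn)
  have h3 : (Nat.sqrt n : ℝ) * Nat.sqrt n ≤ n := by exact_mod_cast Nat.sqrt_le n
  have h5 : (1:ℝ) ≤ Nat.sqrt n := by exact_mod_cast h4
  have h6 : (1:ℝ) ≤ n := by exact_mod_cast hn
  rw [div_le_div_iff₀ (by linarith) (by linarith)]
  linarith

section Main

variable {m : ℕ} {T : Fin m → ℝ → ℝ} {Pop : Fin m → (ℝ → ℝ) → ℝ → ℝ} {C θ M cmin : ℝ}
  {α x0 b : ℝ} {q : ℕ} {u : Fin q → ℝ} {v : Fin q → ℝ≥0∞}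

lemma no_short (hα : 0 < α) (hu : ∀ i, 0 < u i) (huv : ∀ i, ENNReal.ofReal (u i) < v i)
    (hb : 0 < b)
    (hx0cont : ∀ (ω : Om m) (n : ℕ), 1 ≤ n → ContinuousAt (randComp T ω n) x0)
    (hx0np : ∀ (ω : Om m) (n : ℕ), 1 ≤ n → randComp T ω n x0 ≠ x0) (L : ℕ) :
    ∀ᶠ n : ℕ in atTop, ∀ (ω : Om m) (i : ℕ), 1 ≤ i → i ≤ L →
      Aset α x0 ((b * (n : ℝ)) ^ α⁻¹) u v ∩
        randComp T ω i ⁻¹' (Aset α x0 ((b * (n : ℝ)) ^ α⁻¹) u v) = ∅ := by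
  have key : ∀ i : ℕ, 1 ≤ i → ∀ᶠ n : ℕ in atTop, ∀ ω : Om m,
      Aset α x0 ((b * (n : ℝ)) ^ α⁻¹) u v ∩
        randComp T ω i ⁻¹' (Aset α x0 ((b * (n : ℝ)) ^ α⁻¹) u v) = ∅ := by
    intro i hi
    apply cyl_ev (L := i)
    · intro n ω ω' hh h1
      rw [← randComp_congr T ω ω' i hh]
      exact h1
    · intro ω
      have hd : 0 < |randComp T ω i x0 - x0| := abs_pos.2 (sub_ne_zero.2 (hx0np ω i hi))
      set d := |randComp T ω i x0 - x0| with hdd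
      obtain ⟨δ, hδ, hδ2⟩ := Metric.continuousAt_iff.1 (hx0cont ω i hi) (d / 2) (by linarith)
      have h2 : Tendsto (fun n : ℕ => RR α u / (b * (n : ℝ))) atTop (𝓝 0) :=
        (tendsto_natCast_atTop_atTop.const_mul_atTop hb).const_div_atTop _
      filter_upwards [h2.eventually_lt_const hδ, h2.eventually_lt_const (show 0 < d / 2 by linarith),
        eventually_gt_atTop 0] with n h3 h4 hn
      have hn1 : (0:ℝ) < n := by exact_mod_cast hn
      rw [Set.eq_empty_iff_forall_notMem]
      rintro x ⟨hx1, hx2⟩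
      have g1 : |x - x0| < RR α u / (b * n) := A_sub hα (by positivity) hu huv hx1
      have g2 : |randComp T ω i x - x0| < RR α u / (b * n) := A_sub hα (by positivity) hu huv hx2
      have g3 := hδ2 (x := x) (by rw [Real.dist_eq]; linarith)
      rw [Real.dist_eq, abs_sub_comm] at g3
      have g4 := abs_sub_le (randComp T ω i x0) (randComp T ω i x) x0
      linarith
  have h2 : ∀ᶠ n : ℕ in atTop, ∀ i ∈ Finset.Icc 1 L, ∀ ω : Om m,
      Aset α x0 ((b * (n : ℝ)) ^ α⁻¹) u v ∩
        randComp T ω i ⁻¹' (Aset α x0 ((b * (n : ℝ)) ^ α⁻¹) u v) = ∅ :=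
    (Finset.eventually_all _).2 fun i hi => key i (Finset.mem_Icc.1 hi).1
  filter_upwards [h2] with n hn ω i h3 h4
  exact hn i (Finset.mem_Icc.2 ⟨h3, h4⟩) ω

/-- Convergence of the accumulated target measure along the orbit. -/
lemma sum_limit (H : Hyp T Pop C θ M cmin) (hα : 0 < α) (hu : ∀ i, 0 < u i)
    (huv : ∀ i, ENNReal.ofReal (u i) < v i)
    (hdisj : ∀ i j, i ≠ j → ∀ y : ℝ,
      ¬((u i < y ∧ ENNReal.ofReal y ≤ v i) ∧ (u j < y ∧ ENNReal.ofReal y ≤ v j)))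
    (hb : 0 < b) {c : ℕ → Om m → ℝ} {bL : ℕ → ℝ}
    (hc : ∀ L ω, Tendsto (fun ε : ℝ => GG T L ω (bl x0 ε) / ε) (𝓝[>] (0 : ℝ)) (𝓝 (c L ω)))
    (hcyl : ∀ L, Cyl L (c L)) (hbL : Tendsto bL atTop (𝓝 b))
    {ω : Om m} {μ : ℕ → Measure ℝ} {f : ℕ → ℝ → ℝ} {K : ℝ} (O : Orb T ω μ f K)
    (hω : ∀ L, SubLin (fun n => ∑ k ∈ Finset.range n, c L (shift^[k] ω) - bL L * n))
    {s τ : ℝ} (hs : 0 ≤ s) (hτ : 0 ≤ τ) :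
    Tendsto (fun n : ℕ => ∑ i ∈ Finset.range ⌊(n:ℝ) * τ⌋₊,
      (μ (⌊(n:ℝ) * s⌋₊ + 1 + i)).real (Aset α x0 ((b * (n : ℝ)) ^ α⁻¹) u v)) atTop
      (𝓝 (τ * PiAlpha α u v)) := by
  have hC := H.hC
  have hK : 0 ≤ K := (BVnorm_nonneg _).trans (O.bound 0)
  have hR : 0 ≤ RR α u := RR_nonneg hu
  have f2 : ∀ n : ℕ, (⌊(n:ℝ) * τ⌋₊ : ℝ) ≤ n * τ := fun n => Nat.floor_le (by positivity)
  apply lim_exch2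
    (φL := fun (L : ℕ) (n : ℕ) => ∑ i ∈ Finset.range ⌊(n:ℝ) * τ⌋₊,
      GG T L (shift^[⌊(n:ℝ) * s⌋₊ + 1 + i] ω) (Aset α x0 ((b * (n : ℝ)) ^ α⁻¹) u v))
    (bL := fun L => bL L * τ * (PiAlpha α u v / b))
    (E := fun L => τ * (C * θ ^ L * (K + 1) * (2 * (RR α u / b))) + θ ^ L)
  · -- comparison with the `L`-step approximation
    intro L
    have h2 : Tendsto (fun n : ℕ => (L * (K * (2 * (RR α u / b)))) / (n : ℝ)) atTop (𝓝 0) :=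
      tendsto_natCast_atTop_atTop.const_div_atTop _
    filter_upwards [h2.eventually_lt_const (pow_pos H.hθ0 L), eventually_gt_atTop 0] with n h3 hn
    have hn1 : (0:ℝ) < n := by exact_mod_cast hn
    set A := Aset α x0 ((b * (n : ℝ)) ^ α⁻¹) u v with hA
    have hAm : MeasurableSet A := A_meas _
    have hmA : mLeb.real A ≤ 2 * (RR α u / b) / n := by
      have := mLeb_A_le (x0 := x0) hα (show 0 < b * n by positivity) hu huv
      refine this.trans (le_of_eq ?_)
      field_simp
    set J := ⌊(n:ℝ) * s⌋₊
    set N := ⌊(n:ℝ) * τ⌋₊ with hN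
    have e1 := sum_shift_le (a := fun i => (μ (J + 1 + i)).real A) (κ := K * (2 * (RR α u / b) / n))
      (fun i => measureReal_nonneg)
      (fun i => (orb_real_le O _ hAm).trans (mul_le_mul_of_nonneg_left hmA hK)) N L
    have e2 : |∑ i ∈ Finset.range N, (μ (J + 1 + (L + i))).real A -
        ∑ i ∈ Finset.range N, GG T L (shift^[J + 1 + i] ω) A| ≤
        ∑ i ∈ Finset.range N, C * θ ^ L * (K + 1) * (2 * (RR α u / b) / n) := by
      rw [← Finset.sum_sub_distrib]
      refine (Finset.abs_sum_le_sum_abs _ _).trans (Finset.sum_le_sum fun i _ => ?_)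
      have := O.prob (J + 1 + i)
      have h5 := dens_vs_leb H (O.dens (J + 1 + i)) (shift^[J + 1 + i] ω) L hAm
      rw [← map_real H _ _ _ hAm, ← O.map] at h5
      have e : J + 1 + (L + i) = J + 1 + i + L := by ring
      rw [e]
      refine h5.trans ?_
      have h6 := O.bound (J + 1 + i)
      have h7 : 0 ≤ C * θ ^ L := mul_nonneg (by linarith [H.hC]) (pow_nonneg H.hθ0.le _)
      have := BVnorm_nonneg (f (J + 1 + i))
      gcongr
    rw [Finset.sum_const, Finset.card_range, nsmul_eq_mul] at e2
    have e3 : (N : ℝ) * (C * θ ^ L * (K + 1) * (2 * (RR α u / b) / n)) ≤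
        τ * (C * θ ^ L * (K + 1) * (2 * (RR α u / b))) := by
      have h7 : 0 ≤ C * θ ^ L := mul_nonneg (by linarith [H.hC]) (pow_nonneg H.hθ0.le _)
      calc (N : ℝ) * (C * θ ^ L * (K + 1) * (2 * (RR α u / b) / n))
          ≤ (n * τ) * (C * θ ^ L * (K + 1) * (2 * (RR α u / b) / n)) := by
            have := f2 n
            have h8 : 0 ≤ C * θ ^ L * (K + 1) * (2 * (RR α u / b) / n) := by positivity
            exact mul_le_mul_of_nonneg_right this h8
        _ = _ := by field_simp
    have e4 : (L : ℝ) * (K * (2 * (RR α u / b) / n)) = (L * (K * (2 * (RR α u / b)))) / (n : ℝ) := by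
      ring
    rw [e4] at e1
    have e5 := abs_sub_le (∑ i ∈ Finset.range N, (μ (J + 1 + i)).real A)
      (∑ i ∈ Finset.range N, (μ (J + 1 + (L + i))).real A)
      (∑ i ∈ Finset.range N, GG T L (shift^[J + 1 + i] ω) A)
    linarith
  · have h3 := tendsto_pow_atTop_nhds_zero_of_lt_one H.hθ0.le H.hθ1
    have := ((((h3.const_mul C).mul_const (K + 1)).mul_const (2 * (RR α u / b))).const_mul τ).add h3
    simpa using this
  · intro L
    have hw := (window_sum (hω L) hs hτ).mul_const (PiAlpha α u v / b)
    -- replace the rescaled measures by their limits, uniformly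
    have hunif : ∀ η : ℝ, 0 < η → ∀ᶠ n : ℕ in atTop, ∀ ω' : Om m,
        |(n:ℝ) * GG T L ω' (Aset α x0 ((b * (n : ℝ)) ^ α⁻¹) u v) - c L ω' * (PiAlpha α u v / b)|
          < η := by
      intro η hη
      apply cyl_ev (L := L)
      · intro n ω1 ω2 hh h1
        have g1 := GG_cyl T L (Aset α x0 ((b * (n : ℝ)) ^ α⁻¹) u v) ω1 ω2 hh
        beta_reduce at g1
        rwa [← g1, ← hcyl L ω1 ω2 hh]
      · intro ω'
        obtain ⟨R, hR, -⟩ := hasDens_one H L ω'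
        have h1 := A_asymp (b := b) (cl := c L ω') hα hu huv hdisj hR hb ((hc L ω').congr fun ε => by
          rw [map_real H _ _ _ (bl_meas _ _), GG])
        have h2 := (Metric.tendsto_nhds.1 h1) η hη
        filter_upwards [h2] with n hn
        rw [map_real H _ _ _ (A_meas _), Real.dist_eq] at hn
        have e : c L ω' * (PiAlpha α u v / b) = c L ω' / b * PiAlpha α u v := by ring
        rw [e]
        exact hn
    have hdiff : Tendsto (fun n : ℕ => ∑ i ∈ Finset.range ⌊(n:ℝ) * τ⌋₊,
        GG T L (shift^[⌊(n:ℝ) * s⌋₊ + 1 + i] ω) (Aset α x0 ((b * (n : ℝ)) ^ α⁻¹) u v) -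
        (∑ i ∈ Finset.range ⌊(n:ℝ) * τ⌋₊, c L (shift^[⌊(n:ℝ) * s⌋₊ + 1 + i] ω)) / n
          * (PiAlpha α u v / b)) atTop (𝓝 0) := by
      rw [Metric.tendsto_nhds]
      intro η hη
      filter_upwards [hunif (η / (τ + 1)) (by positivity), eventually_gt_atTop 0] with n h1 hn
      have hn1 : (0:ℝ) < n := by exact_mod_cast hn
      rw [Real.dist_eq, sub_zero]
      have e : ∑ i ∈ Finset.range ⌊(n:ℝ) * τ⌋₊,
        GG T L (shift^[⌊(n:ℝ) * s⌋₊ + 1 + i] ω) (Aset α x0 ((b * (n : ℝ)) ^ α⁻¹) u v) -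
        (∑ i ∈ Finset.range ⌊(n:ℝ) * τ⌋₊, c L (shift^[⌊(n:ℝ) * s⌋₊ + 1 + i] ω)) / n
          * (PiAlpha α u v / b) = (∑ i ∈ Finset.range ⌊(n:ℝ) * τ⌋₊,
        (n * GG T L (shift^[⌊(n:ℝ) * s⌋₊ + 1 + i] ω) (Aset α x0 ((b * (n : ℝ)) ^ α⁻¹) u v) -
          c L (shift^[⌊(n:ℝ) * s⌋₊ + 1 + i] ω) * (PiAlpha α u v / b))) / n := by
        rw [Finset.sum_sub_distrib, ← Finset.mul_sum, ← Finset.sum_mul]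
        field_simp
      rw [e, abs_div, abs_of_pos hn1, div_lt_iff₀ hn1]
      refine (Finset.abs_sum_le_sum_abs _ _).trans_lt ?_
      refine (Finset.sum_le_card_nsmul _ _ (η / (τ + 1)) fun i _ => (h1 _).le).trans_lt ?_
      rw [Finset.card_range, nsmul_eq_mul]
      have h4 : (⌊(n:ℝ) * τ⌋₊ : ℝ) * (η / (τ + 1)) ≤ n * τ * (η / (τ + 1)) := by
        have := f2 n
        gcongr
      refine h4.trans_lt ?_
      rw [← mul_div_assoc, div_lt_iff₀ (by positivity)]
      nlinarith [mul_pos hη hn1]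
    have := hdiff.add hw
    simpa using this
  · have := (hbL.mul_const τ).mul_const (PiAlpha α u v / b)
    have e : b * τ * (PiAlpha α u v / b) = τ * PiAlpha α u v := by field_simp
    rwa [e] at this

/-- The quenched hitting time law along one good realisation. -/
lemma hit_law (H : Hyp T Pop C θ M cmin) (hα : 0 < α) (hu : ∀ i, 0 < u i)
    (huv : ∀ i, ENNReal.ofReal (u i) < v i)
    (hdisj : ∀ i j, i ≠ j → ∀ y : ℝ,
      ¬((u i < y ∧ ENNReal.ofReal y ≤ v i) ∧ (u j < y ∧ ENNReal.ofReal y ≤ v j)))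
    (hb : 0 < b)
    (hx0cont : ∀ (ω : Om m) (n : ℕ), 1 ≤ n → ContinuousAt (randComp T ω n) x0)
    (hx0np : ∀ (ω : Om m) (n : ℕ), 1 ≤ n → randComp T ω n x0 ≠ x0)
    {c : ℕ → Om m → ℝ} {bL : ℕ → ℝ}
    (hc : ∀ L ω, Tendsto (fun ε : ℝ => GG T L ω (bl x0 ε) / ε) (𝓝[>] (0 : ℝ)) (𝓝 (c L ω)))
    (hcyl : ∀ L, Cyl L (c L)) (hbL : Tendsto bL atTop (𝓝 b))
    {ω : Om m} {μ : ℕ → Measure ℝ} {f : ℕ → ℝ → ℝ} {K : ℝ} (O : Orb T ω μ f K)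
    (hω : ∀ L, SubLin (fun n => ∑ k ∈ Finset.range n, c L (shift^[k] ω) - bL L * n))
    {s τ : ℝ} (hs : 0 ≤ s) (hτ : 0 ≤ τ) :
    Tendsto (fun n : ℕ => (μ ⌊(n:ℝ) * s⌋₊).real (survSet T (shift^[⌊(n:ℝ) * s⌋₊] ω)
      (Aset α x0 ((b * (n : ℝ)) ^ α⁻¹) u v) ⌊(n:ℝ) * τ⌋₊)) atTop
      (𝓝 (Real.exp (-(τ * PiAlpha α u v)))) := by
  have hC := H.hC
  have hK : 0 ≤ K := (BVnorm_nonneg _).trans (O.bound 0)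
  have hR : 0 ≤ RR α u := RR_nonneg hu
  have f2 : ∀ n : ℕ, (⌊(n:ℝ) * τ⌋₊ : ℝ) ≤ n * τ := fun n => Nat.floor_le (by positivity)
  have hθ1 : 0 < 1 - θ := by linarith [H.hθ1]
  have hθ0 := H.hθ0
  set r0 := 2 * (RR α u / b) with hr0
  set Q := C * ((6 * q + 1) * K) with hQ
  have hr00 : 0 ≤ r0 := by positivity
  have hQ0 : 0 ≤ Q := by positivity
  have hsum := sum_limit H hα hu huv hdisj hb hc hcyl hbL O hω hs hτ
  have hexp := (Real.continuous_exp.tendsto _).comp hsum.neg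
  apply lim_exch2 (φL := fun (_ : ℕ) (n : ℕ) => Real.exp (-∑ i ∈ Finset.range ⌊(n:ℝ) * τ⌋₊,
      (μ (⌊(n:ℝ) * s⌋₊ + 1 + i)).real (Aset α x0 ((b * (n : ℝ)) ^ α⁻¹) u v)))
    (bL := fun _ => Real.exp (-(τ * PiAlpha α u v)))
    (E := fun L => τ * (Q * r0 * (θ ^ L / (1 - θ))) + θ ^ L) _ _ (fun _ => hexp) tendsto_const_nhds
  · intro L
    have t1 : Tendsto (fun n : ℕ => τ * Q * ((n : ℝ) * θ ^ (Nat.sqrt n)) +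
        2 * τ * (K * r0) ^ 2 * ((Nat.sqrt n : ℝ) / n) + (τ * (K * r0) ^ 2) / n) atTop (𝓝 0) := by
      have h3 : Tendsto (fun n : ℕ => (τ * (K * r0) ^ 2) / (n : ℝ)) atTop (𝓝 0) :=
        tendsto_natCast_atTop_atTop.const_div_atTop _
      have := (((err1_tendsto H.hθ0 H.hθ1).const_mul (τ * Q)).add
        (err2_tendsto.const_mul (2 * τ * (K * r0) ^ 2))).add h3
      simpa using this
    have t2 : Tendsto (fun n : ℕ => (K * r0) / (n : ℝ)) atTop (𝓝 0) :=
      tendsto_natCast_atTop_atTop.const_div_atTop _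
    filter_upwards [t1.eventually_lt_const (pow_pos H.hθ0 L),
      t2.eventually_lt_const zero_lt_one, no_short hα hu huv hb hx0cont hx0np L,
      eventually_gt_atTop 0] with n h1 h2 h3 hn
    have hn1 : (0:ℝ) < n := by exact_mod_cast hn
    set A := Aset α x0 ((b * (n : ℝ)) ^ α⁻¹) u v with hA
    have hAm : MeasurableSet A := A_meas _
    have hmA : mLeb.real A ≤ r0 / n := by
      have := mLeb_A_le (x0 := x0) hα (show 0 < b * n by positivity) hu huv
      refine this.trans (le_of_eq ?_)
      rw [hr0]
      field_simp
    have hgood : GoodSet A (6 * q) := A_good hα (by positivity) hu huv hdisj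
    have hκ : ∀ j, (μ j).real A ≤ K * r0 / n := by
      intro j
      refine (orb_real_le O j hAm).trans ?_
      rw [mul_div_assoc]
      exact mul_le_mul_of_nonneg_left hmA hK
    refine (surv_main H O hgood (by positivity) hκ h2.le L (Nat.sqrt n)
      (fun j i => h3 (shift^[j] ω) i) ⌊(n:ℝ) * s⌋₊ ⌊(n:ℝ) * τ⌋₊).trans ?_
    have g1 : C * θ ^ (Nat.sqrt n) * ((6 * q + 1) * K) = Q * θ ^ (Nat.sqrt n) := by
      rw [hQ]; ring
    rw [g1]
    have g2 : Q * mLeb.real A * (θ ^ L / (1 - θ)) ≤ Q * (r0 / n) * (θ ^ L / (1 - θ)) := by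
      gcongr
    calc (⌊(n:ℝ) * τ⌋₊ : ℝ) * (Q * θ ^ (Nat.sqrt n) + (Q * mLeb.real A * (θ ^ L / (1 - θ)) +
            (Nat.sqrt n : ℝ) * (K * r0 / n) ^ 2) + (Nat.sqrt n : ℝ) * (K * r0 / n) ^ 2
            + (K * r0 / n) ^ 2)
        ≤ (n * τ) * (Q * θ ^ (Nat.sqrt n) + (Q * (r0 / n) * (θ ^ L / (1 - θ)) +
            (Nat.sqrt n : ℝ) * (K * r0 / n) ^ 2) + (Nat.sqrt n : ℝ) * (K * r0 / n) ^ 2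
            + (K * r0 / n) ^ 2) := by
          apply mul_le_mul (f2 n) (by linarith) (by positivity) (by positivity)
      _ = τ * (Q * r0 * (θ ^ L / (1 - θ))) + (τ * Q * ((n : ℝ) * θ ^ (Nat.sqrt n)) +
        2 * τ * (K * r0) ^ 2 * ((Nat.sqrt n : ℝ) / n) + (τ * (K * r0) ^ 2) / n) := by
          field_simp
          ring
      _ ≤ _ := by linarith
  · have h3 := tendsto_pow_atTop_nhds_zero_of_lt_one H.hθ0.le H.hθ1
    have := (((h3.div_const (1 - θ)).const_mul (Q * r0)).const_mul τ).add h3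
    simpa using this

end Main

theorem stmt12 (m : ℕ) (hm : 1 ≤ m) (T : Fin m → ℝ → ℝ) (lam : ℝ) (hlam : 1 < lam)
    (hT : ∀ i, PiecewiseC2Expanding (T i) lam)
    (hmaps : ∀ i, Set.MapsTo (T i) (Set.Icc 0 1) (Set.Icc 0 1))
    (hTmeas : ∀ i, Measurable (T i))
    -- the transfer operators with respect to Lebesgue measure, defined by duality
    (Pop : Fin m → (ℝ → ℝ) → ℝ → ℝ)
    (hdual : ∀ (i : Fin m) (f : ℝ → ℝ), Integrable f mLeb →
      ∀ g : ℝ → ℝ, Measurable g → (∃ Cg : ℝ, ∀ x, |g x| ≤ Cg) →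
        ∫ x, g (T i x) * f x ∂mLeb = ∫ x, g x * Pop i f x ∂mLeb)
    (hPopBV : ∀ (i : Fin m) (f : ℝ → ℝ), IsBV f → IsBV (Pop i f))
    -- (LY): uniform Lasota–Yorke inequalities
    (r : ℕ) (hr : 1 ≤ r) (M D : ℝ) (hM : 0 < M) (hD : 0 < D)
    (ρ : ℝ) (hρ : ρ ∈ Set.Ioo (0 : ℝ) 1)
    (hLY1 : ∀ (ω : Om m) (f : ℝ → ℝ), IsBV f → BVnorm (Pop (ω 0) f) ≤ M * BVnorm f)
    (hLY2 : ∀ (ω : Om m) (f : ℝ → ℝ), IsBV f →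
      var (Pcomp Pop ω r f) ≤ ρ * var f + D * ∫ x, |f x| ∂mLeb)
    -- (Dec): exponential decay on mean-zero BV functions
    (Cdec : ℝ) (hCdec : 0 < Cdec) (θ : ℝ) (hθ : θ ∈ Set.Ioo (0 : ℝ) 1)
    (hDec : ∀ (n : ℕ), 1 ≤ n → ∀ (ω : Om m) (f : ℝ → ℝ), IsBV f →
      (∫ x, f x ∂mLeb) = 0 → BVnorm (Pcomp Pop ω n f) ≤ Cdec * θ ^ n * BVnorm f)
    -- (Min): uniform lower bound
    (cmin : ℝ) (hcmin : 0 < cmin)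
    (hMin : ∀ (n : ℕ), 1 ≤ n → ∀ (ω : Om m), ∀ x ∈ Set.Icc (0 : ℝ) 1,
      cmin ≤ Pcomp Pop ω n (fun _ => 1) x)
    -- `P` is the Bernoulli product measure `(p_1, …, p_m)^{⊗ℤ}`
    (p : Fin m → ℝ) (hp : ∀ i, 0 < p i) (hp1 : ∑ i, p i = 1)
    (P : Measure (Om m)) (hPprob : IsProbabilityMeasure P)
    (hP : ∀ (s : Finset ℤ) (f : ℤ → Fin m),
      P {ω | ∀ i ∈ s, ω i = f i} = ENNReal.ofReal (∏ i ∈ s, p (f i)))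
    -- the equivariant family of BV probability densities and the quenched measures `ν^ω`
    (h : Om m → ℝ → ℝ) (hBV : ∀ ω, IsBV (h ω))
    (hequi : ∀ ω : Om m, Pop (ω 0) (h ω) =ᵐ[mLeb] h (shift ω))
    (hprobd : ∀ ω, (∀ᵐ x ∂mLeb, 0 ≤ h ω x) ∧ ∫ x, h ω x ∂mLeb = 1)
    (ν : Om m → Measure ℝ)
    (hν : ∀ ω, ν ω = mLeb.withDensity (fun x => ENNReal.ofReal (h ω x)))
    -- the annealed (stationary) measure `ν(A) = ∫ ν^ω(A) d𝐏(ω)`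
    (νa : Measure ℝ)
    (hνa : ∀ A : Set ℝ, MeasurableSet A → νa A = ∫⁻ ω, ν ω A ∂P)
    -- `α ∈ (0,2)` and `x0` non-periodic and outside all discontinuities
    (α : ℝ) (hα : α ∈ Set.Ioo (0 : ℝ) 2)
    (x0 : ℝ) (hx0 : x0 ∈ Set.Icc (0 : ℝ) 1)
    (hx0cont : ∀ (ω : Om m) (n : ℕ), 1 ≤ n → ContinuousAt (randComp T ω n) x0)
    (hx0np : ∀ (ω : Om m) (n : ℕ), 1 ≤ n → randComp T ω n x0 ≠ x0)
    -- the set `J = ⋃_i (u_i, v_i]`, a finite disjoint union of intervals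
    (q : ℕ) (hq : 1 ≤ q) (u : Fin q → ℝ) (v : Fin q → ℝ≥0∞)
    (hu : ∀ i, 0 < u i) (huv : ∀ i, ENNReal.ofReal (u i) < v i)
    (hdisj : ∀ i j, i ≠ j → ∀ y : ℝ,
      ¬((u i < y ∧ ENNReal.ofReal y ≤ v i) ∧ (u j < y ∧ ENNReal.ofReal y ≤ v j))) :
    ∃ b : ℝ, 0 < b ∧
      Tendsto (fun ε : ℝ => (νa {x | |x - x0| < ε}).toReal / ε) (𝓝[>] (0 : ℝ)) (𝓝 b) ∧
      ∀ᵐ ω ∂P, ∀ s t : ℝ, 0 ≤ s → s < t →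
        Tendsto (fun n : ℕ =>
          ((ν (shift^[⌊(n : ℝ) * s⌋₊] ω))
            (survSet T (shift^[⌊(n : ℝ) * s⌋₊] ω)
              (Aset α x0 ((b * (n : ℝ)) ^ α⁻¹) u v) ⌊(n : ℝ) * (t - s)⌋₊)).toReal)
          atTop (𝓝 (Real.exp (-(t - s) * PiAlpha α u v))) := by
  haveI := hPprob
  have H : Hyp T Pop (max Cdec 1) θ M cmin := by
    refine ⟨le_max_right _ _, hθ.1, hθ.2, hM, hTmeas, fun i f hf => hdual i f hf.1, hPopBV,
      fun i f hf => hLY1 (fun _ => i) f hf, fun n ω f hf h0 => ?_, hMin⟩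
    have hnn := BVnorm_nonneg f
    rcases Nat.eq_zero_or_pos n with rfl | hn
    · simp only [Pcomp, pow_zero, mul_one]
      exact le_mul_of_one_le_left hnn (le_max_right _ _)
    · refine (hDec n hn ω f hf h0).trans ?_
      have := hθ.1
      gcongr
      exact le_max_left _ _
  have F : Fam Pop h ν := ⟨hBV, hequi, hprobd, hν⟩
  have hB : IsBern p P := hP
  obtain ⟨b, c, hb, hlim, hc, hcyl, hbd⟩ := exists_b H F hcmin hp hp1 hB hνa hx0
  refine ⟨b, hb, hlim, ?_⟩
  have hbL : Tendsto (fun L => ∫ ω, c L ω ∂P) atTop (𝓝 b) := by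
    have h0 : Tendsto (fun L : ℕ => max Cdec 1 * θ ^ L * (K0 (max Cdec 1) θ M + 1) * 2) atTop
        (𝓝 0) := by
      have := (((tendsto_pow_atTop_nhds_zero_of_lt_one hθ.1.le hθ.2).const_mul
        (max Cdec 1)).mul_const (K0 (max Cdec 1) θ M + 1)).mul_const 2
      simpa only [mul_zero, zero_mul] using this
    rw [tendsto_iff_dist_tendsto_zero]
    refine squeeze_zero (fun _ => dist_nonneg) (fun L => ?_) h0
    rw [dist_comm, Real.dist_eq]
    exact hbd L
  filter_upwards [ae_all_iff.2 fun L => slln hp hp1 hB (hcyl L)] with ω hω s t hs hst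
  obtain ⟨f, O⟩ := fam_orb H F ω
  have := hit_law H hα.1 hu huv hdisj hb hx0cont hx0np hc hcyl hbL O hω hs
    (τ := t - s) (by linarith)
  rw [neg_mul]
  exact this
end
end
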